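/- arXiv:2209.09283 — 4 statements merged into one kernel-verified Lean document; each statement's English description precedes it below -/
import Mathlib

section
/- Let p be a prime with p ≡ 1 (mod 4) such that the real quadratic field ℚ(√p) has class number h_p = 1. Then for every squarefree integer m > 1 not divisible by p, the class number h_{mp} of ℚ(√(mp)) satisfies h_{mp} ≥ 2. -/
open NumberField

theorem exists_jacobiSym_eq_neg_one {l : ℕ} (hl : l.Prime) (hl2 : l ≠ 2) :
    ∃ a : ℕ, jacobiSym a l = -1 := by
  have := Fact.mk hl
  obtain ⟨a, ha⟩ := FiniteField.exists_nonsquare (F := ZMod l) (by rwa [ZMod.ringChar_zmod_n])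
  refine ⟨a.val, ?_⟩
  rw [ZMod.nonsquare_iff_jacobiSym_eq_neg_one]
  simpa using ha

theorem coprime_of_jacobiSym_eq_neg_one {a : ℤ} {b : ℕ} (h : jacobiSym a b = -1) :
    a.gcd b = 1 := by
  by_contra hab
  have hb : b ≠ 0 := by
    rintro rfl
    simp at h
  rw [jacobiSym.eq_zero_iff.mpr ⟨hb, hab⟩] at h
  norm_num at h

/-- The Jacobi symbol with a fixed squarefree numerator `m > 1` takes the value `-1`. -/
theorem exists_odd_jacobiSym_eq_neg_one {m : ℕ} (hm1 : 1 < m) (hm : Squarefree m) :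
    ∃ a : ℕ, Odd a ∧ jacobiSym m a = -1 := by
  by_cases h : ∃ l : ℕ, l.Prime ∧ l ∣ m ∧ l ≠ 2
  · obtain ⟨l, hl, ⟨k, rfl⟩, hl2⟩ := h
    have hlk : l.Coprime k := Nat.coprime_of_squarefree_mul hm
    have hcop : (4 * k).Coprime l := by
      refine Nat.Coprime.mul_left ?_ hlk.symm
      exact Nat.Coprime.pow_left 2 ((Nat.coprime_primes Nat.prime_two hl).mpr (Ne.symm hl2))
    obtain ⟨n, hn⟩ := exists_jacobiSym_eq_neg_one hl hl2
    obtain ⟨a, ha1, han⟩ := Nat.chineseRemainder hcop 1 n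
    have ha4 : a % 4 = 1 := ha1.of_mul_right k
    have hodd : Odd a := by rw [Nat.odd_iff]; omega
    refine ⟨a, hodd, ?_⟩
    have hk : jacobiSym k a = 1 := by
      rw [jacobiSym.mod_right' k hodd, show a % (4 * k) = 1 % (4 * k) from ha1,
        ← jacobiSym.mod_right' k odd_one, jacobiSym.one_right]
    have hla : jacobiSym l a = -1 := by
      rw [← jacobiSym.quadratic_reciprocity_one_mod_four ha4 (hl.odd_of_ne_two hl2), ← hn]
      exact jacobiSym.mod_left' (by exact_mod_cast han)
    push_cast
    rw [jacobiSym.mul_left, hk, hla]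
    norm_num
  · push Not at h
    have hm2 := Nat.eq_prime_pow_of_unique_prime_dvd (n := m) (p := 2) (by omega)
      (fun {d} hd hdm => h d hd hdm)
    have hlen : m.primeFactorsList.length = 1 := by
      rw [hm2, Nat.squarefree_pow_iff (by norm_num) (by rintro h0; rw [h0] at hm2; omega)] at hm
      exact hm.2
    rw [hlen] at hm2
    refine ⟨5, by decide, ?_⟩
    rw [hm2]
    norm_num

/-- Some prime `q` is a quadratic non-residue modulo `p` while `m * p` is a residue modulo `q`. -/
theorem exists_prime_jacobiSym {p m : ℕ} (hp : p.Prime) (hp4 : p % 4 = 1) (hm1 : 1 < m)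
    (hm : Squarefree m) (hpm : ¬ p ∣ m) :
    ∃ q : ℕ, q.Prime ∧ q ≠ 2 ∧ jacobiSym ((m * p : ℕ) : ℤ) q = 1 ∧ jacobiSym q p = -1 := by
  have hp2 : p ≠ 2 := by omega
  obtain ⟨a, haodd, ha⟩ := exists_odd_jacobiSym_eq_neg_one hm1 hm
  obtain ⟨n, hn⟩ := exists_jacobiSym_eq_neg_one hp hp2
  have hcop : (4 * m).Coprime p := by
    refine Nat.Coprime.mul_left ?_ ((Nat.Prime.coprime_iff_not_dvd hp).mpr hpm).symm
    exact Nat.Coprime.pow_left 2 ((Nat.coprime_primes Nat.prime_two hp).mpr (Ne.symm hp2))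
  obtain ⟨c, hca, hcn⟩ := Nat.chineseRemainder hcop a n
  have ham : a.Coprime (4 * m) := by
    refine Nat.Coprime.mul_right ?_ ?_
    · exact Nat.Coprime.pow_right 2 haodd.coprime_two_right
    · exact Nat.Coprime.symm (by simpa using coprime_of_jacobiSym_eq_neg_one ha)
  have hnp : n.Coprime p := by simpa using coprime_of_jacobiSym_eq_neg_one hn
  have hc : c.Coprime (4 * m * p) := by
    refine Nat.Coprime.mul_right ?_ ?_
    · rw [Nat.Coprime, hca.gcd_eq]; exact ham
    · rw [Nat.Coprime, hcn.gcd_eq]; exact hnp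
  obtain ⟨q, hq2, hq, hqc⟩ := Nat.forall_exists_prime_gt_and_modEq 2
    (by have := hp.pos; positivity) hc
  have hqodd : Odd q := hq.odd_of_ne_two (by omega)
  have hqp : jacobiSym q p = -1 := by
    rw [← hn]
    exact jacobiSym.mod_left' (by exact_mod_cast (hqc.of_mul_left _).trans hcn)
  have hmq : jacobiSym m q = -1 := by
    rw [jacobiSym.mod_right' m hqodd,
      show q % (4 * m) = a % (4 * m) from (hqc.of_mul_right _).trans hca,
      ← jacobiSym.mod_right' m haodd, ha]
  refine ⟨q, hq, by omega, ?_, hqp⟩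
  push_cast
  rw [jacobiSym.mul_left, hmq, jacobiSym.quadratic_reciprocity_one_mod_four hp4 hqodd, hqp]
  norm_num

section Quadratic

variable {L : Type*} [Field L] [NumberField L] {β : L} {d : ℤ}

theorem exists_basis_one_sqrt (hβ : β ^ 2 = (d : L)) (hd : ¬ IsSquare d)
    (hL : Module.finrank ℚ L = 2) : ∃ b : Module.Basis (Fin 2) ℚ L, b 0 = 1 ∧ b 1 = β := by
  have hli : LinearIndependent ℚ ![(1 : L), β] := by
    rw [LinearIndependent.pair_iff' one_ne_zero]
    intro a ha
    have h : ((a ^ 2 : ℚ) : L) = ((d : ℚ) : L) := by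
      rw [Rat.smul_one_eq_cast] at ha
      push_cast
      rw [ha, hβ]
    have h' : a ^ 2 = (d : ℚ) := by exact_mod_cast h
    exact hd (Rat.isSquare_intCast_iff.mp ⟨a, by rw [← h', sq]⟩)
  refine ⟨basisOfLinearIndependentOfCardEqFinrank hli (by simp [hL]), ?_, ?_⟩ <;> simp

theorem exists_eq_add_mul_sqrt (hβ : β ^ 2 = (d : L)) (hd : ¬ IsSquare d)
    (hL : Module.finrank ℚ L = 2) (y : L) : ∃ u v : ℚ, y = u + v * β := by
  obtain ⟨b, hb0, hb1⟩ := exists_basis_one_sqrt hβ hd hL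
  refine ⟨b.repr y 0, b.repr y 1, ?_⟩
  conv_lhs => rw [← b.sum_repr y]
  simp [Fin.sum_univ_two, hb0, hb1, Algebra.smul_def]

theorem trace_norm_add_mul_sqrt (hβ : β ^ 2 = (d : L)) (hd : ¬ IsSquare d)
    (hL : Module.finrank ℚ L = 2) (u v : ℚ) :
    Algebra.trace ℚ L (u + v * β) = 2 * u ∧
      Algebra.norm ℚ ((u : L) + v * β) = u ^ 2 - d * v ^ 2 := by
  obtain ⟨b, hb0, hb1⟩ := exists_basis_one_sqrt hβ hd hL
  have hβm : Algebra.leftMulMatrix b β = !![0, (d : ℚ); 1, 0] := by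
    have hββ : β * β = (d : ℚ) • b 0 := by
      rw [← sq, hβ, hb0, Algebra.smul_def]; simp
    ext i j
    rw [Algebra.leftMulMatrix_eq_repr_mul]
    fin_cases j
    · have h : β * b 0 = b 1 := by rw [hb0, hb1, mul_one]
      fin_cases i <;> simp [h]
    · have h : β * b 1 = (d : ℚ) • b 0 := by rw [hb1, hββ]
      fin_cases i <;> simp [h]
  have hM : Algebra.leftMulMatrix b (u + v * β) = !![u, d * v; v, u] := by
    have hy : (u : L) + v * β = algebraMap ℚ L u + v • β := by
      rw [Algebra.smul_def]; simp
    rw [hy, map_add, map_smul, AlgHom.commutes, hβm]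
    ext i j
    fin_cases i <;> fin_cases j <;> simp [Matrix.algebraMap_matrix_apply, mul_comm]
  constructor
  · rw [Algebra.trace_eq_matrix_trace b, hM, Matrix.trace_fin_two_of]; ring
  · rw [Algebra.norm_eq_matrix_det b, hM, Matrix.det_fin_two_of]; ring

/-- Four times the norm of an integer of `ℚ(√d)` is a square modulo each prime that divides `d`
exactly once. -/
theorem exists_dvd_sq_sub_four_mul_norm (hβ : β ^ 2 = (d : L)) (hd : ¬ IsSquare d)
    (hL : Module.finrank ℚ L = 2) {p k : ℤ} (hp : Prime p) (hdk : d = k * p) (hk : ¬ p ∣ k)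
    (c : 𝓞 L) : ∃ t : ℤ, p ∣ t ^ 2 - 4 * Algebra.norm ℤ c := by
  obtain ⟨u, v, hc⟩ := exists_eq_add_mul_sqrt hβ hd hL (c : L)
  obtain ⟨ht, hn⟩ := trace_norm_add_mul_sqrt hβ hd hL u v
  rw [← hc] at ht hn
  rw [← Algebra.coe_trace_int] at ht
  rw [← Algebra.coe_norm_int] at hn
  set t := Algebra.trace ℤ (𝓞 L) c
  set n := Algebra.norm ℤ c
  refine ⟨t, ?_⟩
  have hsq : (((t ^ 2 - 4 * n) * d : ℤ) : ℚ) = (2 * d * v) ^ 2 := by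
    push_cast
    rw [ht, hn]; ring
  obtain ⟨z, hz⟩ : IsSquare ((t ^ 2 - 4 * n) * d) :=
    Rat.isSquare_intCast_iff.mp ⟨2 * d * v, by rw [hsq, sq]⟩
  have hpz : p ∣ z := by
    have : p ∣ z * z := by rw [← hz, hdk]; exact ⟨(t ^ 2 - 4 * n) * k, by ring⟩
    exact (hp.dvd_or_dvd this).elim id id
  obtain ⟨w, rfl⟩ := hpz
  have h : p ∣ (t ^ 2 - 4 * n) * k := by
    refine ⟨w * w, mul_right_cancel₀ hp.ne_zero ?_⟩
    rw [hdk] at hz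
    linear_combination hz
  exact (hp.dvd_or_dvd h).resolve_right hk

/-- In a quadratic field `ℚ(√d)`, an odd prime `q ∤ d` modulo which `d` is a square
is not a prime element. -/
theorem not_prime_of_isSquare (hβ : β ^ 2 = (d : L)) (hd : ¬ IsSquare d)
    (hL : Module.finrank ℚ L = 2) {q : ℕ} (hq : q.Prime) (hq2 : q ≠ 2) {r : ℤ}
    (hr : (q : ℤ) ∣ r ^ 2 - d) (hqd : ¬ (q : ℤ) ∣ d) : ¬ Prime (q : 𝓞 L) := by
  intro hqL
  have hqZ : Prime (q : ℤ) := Nat.prime_iff_prime_int.mp hq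
  obtain ⟨B, rfl⟩ : ∃ B : 𝓞 L, (B : L) = β := by
    have hint : IsIntegral ℤ β := by
      refine IsIntegral.of_pow two_pos ?_
      rw [hβ]
      exact isIntegral_algebraMap (R := ℤ) (x := d)
    exact ⟨⟨β, hint⟩, rfl⟩
  have hB : B ^ 2 = (d : 𝓞 L) := by
    apply RingOfIntegers.ext
    simpa using hβ
  have key : ∀ s : ℤ, (q : 𝓞 L) ∣ (s : 𝓞 L) + B → (q : ℤ) ∣ s := by
    rintro s ⟨c, hc⟩
    have hc' : ((s : ℚ) : L) + (1 : ℚ) * (B : L) = (q : ℚ) • (c : L) := by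
      have := congrArg (fun x : 𝓞 L => (x : L)) hc
      simpa [Algebra.smul_def] using this
    have ht := (trace_norm_add_mul_sqrt hβ hd hL s 1).1
    rw [hc', map_smul, ← Algebra.coe_trace_int, smul_eq_mul] at ht
    have h2s : (q : ℤ) ∣ 2 * s := ⟨_, by exact_mod_cast ht.symm⟩
    refine (hqZ.dvd_or_dvd h2s).resolve_left fun h2 => hq2 ?_
    exact (Nat.prime_dvd_prime_iff_eq hq Nat.prime_two).mp (by exact_mod_cast h2)
  have hqr : ¬ (q : ℤ) ∣ r := fun h => hqd <| by
    have := dvd_sub (dvd_pow h two_ne_zero) hr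
    simpa using this
  have hmul : (q : 𝓞 L) ∣ ((r : 𝓞 L) + B) * (-(((-r : ℤ) : 𝓞 L) + B)) := by
    obtain ⟨k, hk⟩ := hr
    refine ⟨(k : 𝓞 L), ?_⟩
    have hk' : (r : 𝓞 L) ^ 2 - d = q * k := by exact_mod_cast congrArg (Int.cast (R := 𝓞 L)) hk
    push_cast
    linear_combination hk' - hB
  rcases hqL.dvd_or_dvd hmul with h | h
  · exact hqr (key r h)
  · exact hqr ((dvd_neg).mp (key (-r) ((dvd_neg).mp h)))

end Quadratic

/-- If `p ≡ 1 (mod 4)` is a prime with `h_p = 1`, then `h_{mp} ≥ 2` for every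
squarefree integer `m > 1` not divisible by `p`. -/
theorem stmt_2 (p : ℕ) (hp : p.Prime) (hp4 : p % 4 = 1)
    (K : Type*) [Field K] [NumberField K] (α : K)
    (hα : α ^ 2 = (p : K)) (hdegK : Module.finrank ℚ K = 2)
    (hclK : classNumber K = 1)
    (m : ℕ) (hm1 : 1 < m) (hmsf : Squarefree m) (hpm : ¬ p ∣ m)
    (L : Type*) [Field L] [NumberField L] (β : L)
    (hβ : β ^ 2 = ((m * p : ℕ) : L)) (hdegL : Module.finrank ℚ L = 2) :
    2 ≤ classNumber L := by
  have hpZ : Prime (p : ℤ) := Nat.prime_iff_prime_int.mp hp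
  have := Fact.mk hp
  obtain ⟨q, hq, hq2, hdq, hqp⟩ := exists_prime_jacobiSym hp hp4 hm1 hmsf hpm
  have := Fact.mk hq
  set d : ℤ := ((m * p : ℕ) : ℤ) with hd_def
  have hdmp : d = m * p := by simp [hd_def]
  have hpmZ : ¬ (p : ℤ) ∣ m := by exact_mod_cast hpm
  have hβd : β ^ 2 = (d : L) := by rw [hβ, hd_def, Int.cast_natCast]
  have hd : ¬ IsSquare d := by
    rintro ⟨z, hz⟩
    rw [hdmp] at hz
    obtain ⟨w, rfl⟩ : (p : ℤ) ∣ z := (hpZ.dvd_or_dvd (hz ▸ dvd_mul_left _ _)).elim id id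
    refine hpmZ ⟨w * w, mul_right_cancel₀ hpZ.ne_zero ?_⟩
    linear_combination hz
  have hqd : ¬ (q : ℤ) ∣ d := fun h => by
    have hz := jacobiSym.eq_zero_iff.mpr
      ⟨hq.ne_zero, fun h1 : d.gcd q = 1 => hq.one_lt.ne' ?_⟩
    · rw [hz] at hdq; norm_num at hdq
    · rwa [Int.gcd_eq_natAbs_right h, Int.natAbs_natCast] at h1
  obtain ⟨r, hr⟩ : ∃ r : ℤ, (q : ℤ) ∣ r ^ 2 - d := by
    obtain ⟨x, hx⟩ := ZMod.isSquare_of_jacobiSym_eq_one hdq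
    refine ⟨x.val, ?_⟩
    rw [← ZMod.intCast_zmod_eq_zero_iff_dvd]
    push_cast
    rw [hx, ZMod.natCast_zmod_val]; ring
  have hpos : 0 < classNumber L := Fintype.card_pos
  by_contra hlt
  have hL1 : classNumber L = 1 := by omega
  have := classNumber_eq_one_iff.mp hL1
  have hnp := not_prime_of_isSquare hβd hd hdegL hq hq2 hr hqd
  have hunit (x : 𝓞 L) : IsUnit x ↔ (Algebra.norm ℤ x).natAbs = 1 := by
    rw [NumberField.isUnit_iff_norm, RingOfIntegers.coe_norm, ← Algebra.coe_norm_int,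
      ← Int.cast_abs, Int.abs_eq_natAbs]
    norm_cast
  have hnorm : Algebra.norm ℤ (q : 𝓞 L) = (q : ℤ) ^ 2 := by
    have h := (trace_norm_add_mul_sqrt hβd hd hdegL q 0).2
    have hq' : ((q : ℚ) : L) + (0 : ℚ) * β = ((q : 𝓞 L) : L) := by simp
    rw [hq', ← Algebra.coe_norm_int] at h
    have h' : ((Algebra.norm ℤ (q : 𝓞 L) : ℤ) : ℚ) = ((q ^ 2 : ℤ) : ℚ) := by
      rw [h]; push_cast; ring
    exact_mod_cast h'
  have hqu : ¬ IsUnit (q : 𝓞 L) := by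
    rw [hunit, hnorm, Int.natAbs_pow, Int.natAbs_natCast]
    exact fun h => hq.ne_one (by simpa using h)
  rw [← irreducible_iff_prime, irreducible_iff] at hnp
  push Not at hnp
  obtain ⟨a, b, hab, ha, hb⟩ := hnp hqu
  rw [hunit] at ha hb
  have hNa : (Algebra.norm ℤ a).natAbs = q := by
    refine ((hq.mul_eq_prime_sq_iff ha hb).mp ?_).1
    rw [← Int.natAbs_mul, ← map_mul, ← hab, hnorm, Int.natAbs_pow, Int.natAbs_natCast]
  obtain ⟨t, ht⟩ := exists_dvd_sq_sub_four_mul_norm hβd hd hdegL hpZ hdmp hpmZ a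
  have hpodd : Odd p := hp.odd_of_ne_two (by omega)
  have hJ1 : jacobiSym (Algebra.norm ℤ a) p = -1 := by
    rcases Int.natAbs_eq (Algebra.norm ℤ a) with h | h
    · rw [h, hNa, hqp]
    · rw [h, hNa, jacobiSym.neg _ hpodd, ZMod.χ₄_nat_one_mod_four hp4, hqp]; norm_num
  have hJ : jacobiSym (t ^ 2) p = jacobiSym (4 * Algebra.norm ℤ a) p :=
    jacobiSym.mod_left' (Int.emod_eq_emod_iff_emod_sub_eq_zero.mpr (Int.emod_eq_zero_of_dvd ht))
  rw [jacobiSym.mul_left, jacobiSym.at_four hpodd, hJ1, jacobiSym.pow_left] at hJ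
  nlinarith [sq_nonneg (jacobiSym t p)]
end

section
/- Let d > 1 be a squarefree integer such that exactly two rational primes ramify in K_d = ℚ(√d) (i.e. n_d = 2) and the class number h_d of K_d lies in {1,2}. If the smallest ramified prime p₁ satisfies p₁ ≡ 3 (mod 4), then h_d = 1. -/
open NumberField

/-- The discriminant of the real quadratic field `ℚ(√d)` for a squarefree integer `d > 1`. -/
def quadDisc (d : ℕ) : ℕ := if d % 4 = 1 then d else 4 * d

theorem Int.dvd_left_of_dvd_sq_add_sq {p : ℕ} (hp : p.Prime) (hp4 : p % 4 = 3) {x y : ℤ}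
    (h : (p : ℤ) ∣ x ^ 2 + y ^ 2) : (p : ℤ) ∣ x := by
  have : Fact p.Prime := ⟨hp⟩
  by_contra hx
  have hx' : (x : ZMod p) ≠ 0 := by rwa [Ne, ZMod.intCast_zmod_eq_zero_iff_dvd]
  refine ZMod.mod_four_ne_three_of_sq_eq_neg_sq (p := p) (x := x) (y := y) hx' ?_ hp4
  rw [eq_neg_iff_add_eq_zero]
  exact_mod_cast (ZMod.intCast_zmod_eq_zero_iff_dvd _ p).mpr h

/-- Minus the square of a nonzero integer is not of the form `x ^ 2 - p * q * y ^ 2`. -/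
theorem Int.eq_zero_of_sq_add_sq_eq_mul_sq {p q : ℕ} (hp : p.Prime) (hp4 : p % 4 = 3)
    (hpq : ¬ p ∣ q) {x n y : ℤ} (h : x ^ 2 + n ^ 2 = p * q * y ^ 2) : n = 0 := by
  have hp' : Prime (p : ℤ) := Nat.prime_iff_prime_int.mp hp
  induction hk : n.natAbs using Nat.strong_induction_on generalizing x n y with
  | _ k ih =>
    subst hk
    have hd : (p : ℤ) ∣ x ^ 2 + n ^ 2 := h ▸ ⟨q * y ^ 2, by ring⟩
    obtain ⟨x, rfl⟩ := Int.dvd_left_of_dvd_sq_add_sq hp hp4 hd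
    obtain ⟨m, rfl⟩ := Int.dvd_left_of_dvd_sq_add_sq hp hp4 (add_comm ((p * x) ^ 2 : ℤ) _ ▸ hd)
    have h2 : (p : ℤ) * (x ^ 2 + m ^ 2) = q * y ^ 2 :=
      mul_left_cancel₀ hp'.ne_zero (by linear_combination h)
    obtain ⟨y, rfl⟩ := hp'.dvd_of_dvd_pow
      ((hp'.dvd_or_dvd ⟨_, h2.symm⟩).resolve_left (by exact_mod_cast hpq))
    have h3 : x ^ 2 + m ^ 2 = p * q * y ^ 2 :=
      mul_left_cancel₀ hp'.ne_zero (by linear_combination h2)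
    by_contra hn
    have hm : m ≠ 0 := by rintro rfl; simp at hn
    refine hm (ih _ ?_ h3 rfl)
    rw [Int.natAbs_mul, Int.natAbs_natCast]
    exact lt_mul_left (Int.natAbs_pos.mpr hm) hp.one_lt

/-- Legendre: for distinct primes `p, q ≡ 3 (mod 4)` one of `p * a ^ 2 - q * b ^ 2 = ± 1` is
solvable. -/
theorem exists_mul_sq_sub_mul_sq_sq_eq_one {p q : ℕ} (hp : p.Prime) (hq : q.Prime) (hpq : p ≠ q)
    (hp4 : p % 4 = 3) (hq4 : q % 4 = 3) :
    ∃ a b : ℤ, (p * a ^ 2 - q * b ^ 2) ^ 2 = 1 := by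
  have hcop : Nat.Coprime p q := (Nat.coprime_primes hp hq).mpr hpq
  have hpq' : ¬ p ∣ q := fun h ↦ hpq ((Nat.prime_dvd_prime_iff_eq hp hq).mp h)
  have hns : ¬ IsSquare ((p : ℤ) * q) := by
    rintro ⟨r, hr⟩
    have h1 : (p * q : ℕ) = r.natAbs * r.natAbs := by
      zify; rw [abs_mul_abs_self]; exact hr
    have hsq : Squarefree (p * q) :=
      (Nat.squarefree_mul hcop).mpr ⟨hp.squarefree, hq.squarefree⟩
    have h2 := hsq r.natAbs ⟨1, by rw [h1, mul_one]⟩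
    rw [Nat.isUnit_iff] at h2
    rw [h2] at h1
    exact hp.one_lt.ne' (Nat.eq_one_of_mul_eq_one_right h1)
  obtain ⟨s, hs⟩ := Pell.IsFundamental.exists_of_not_isSquare
    (by have := hp.pos; have := hq.pos; positivity) hns
  have hs1 : 1 < s.x := hs.1
  have hmod : (p * q : ℤ) % 4 = 1 := by
    rw [Int.mul_emod]; norm_cast; rw [hp4, hq4]
  obtain ⟨k, w, hk0, hxk, hkw⟩ : ∃ k w : ℕ, 0 < k ∧ s.x = 2 * k + 1 ∧
      k * (k + 1) = p * q * w ^ 2 := by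
    have hprop := s.prop
    obtain ⟨D, hD⟩ : ∃ D : ℤ, (p * q : ℤ) = 4 * D + 1 := ⟨p * q / 4, by omega⟩
    obtain ⟨w, hw⟩ : Even s.y := by
      by_contra hodd
      obtain ⟨w, hw⟩ := Int.not_even_iff_odd.mp hodd
      rw [hw] at hprop
      have h4 : s.x ^ 2 % 4 = 2 := by
        have : s.x ^ 2 = 4 * (D * (2 * w + 1) ^ 2 + w ^ 2 + w) + 2 := by
          linear_combination hprop + (2 * w + 1) ^ 2 * hD
        omega
      rcases Int.emod_two_eq_zero_or_one s.x with h | h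
      · obtain ⟨z, hz⟩ : ∃ z, s.x = 2 * z := ⟨s.x / 2, by omega⟩
        rw [hz] at h4; ring_nf at h4; omega
      · obtain ⟨z, hz⟩ : ∃ z, s.x = 2 * z + 1 := ⟨s.x / 2, by omega⟩
        rw [hz] at h4; ring_nf at h4; omega
    obtain ⟨k, hk⟩ : Odd s.x := by
      by_contra heven
      obtain ⟨z, hz⟩ := Int.not_odd_iff_even.mp heven
      rw [hz, hw] at hprop
      have : 4 * (z ^ 2 - p * q * w ^ 2) = 1 := by linear_combination hprop
      omega
    lift k to ℕ using by omega
    refine ⟨k, w.natAbs, by omega, hk, ?_⟩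
    zify
    rw [sq_abs]
    rw [hk, hw] at hprop
    have : 4 * ((k : ℤ) * (k + 1)) = 4 * (p * q * w ^ 2) := by linear_combination hprop
    linarith
  have hkcop : Nat.Coprime k (k + 1) := by simp
  have hw0 : w ≠ 0 := by rintro rfl; simp at hkw; omega
  have key : ∀ m n : ℕ, m ∣ k → n ∣ k + 1 → m * n = p * q →
      ∃ a b, k = m * a ^ 2 ∧ k + 1 = n * b ^ 2 := by
    rintro m n ⟨a, ha⟩ ⟨b, hb⟩ hmn
    have hab : a * b = w ^ 2 := by
      refine Nat.eq_of_mul_eq_mul_left (Nat.mul_pos hp.pos hq.pos) ?_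
      rw [← hkw, hb, ha, ← hmn]; ring
    have hc : IsCoprime (a : ℤ) b := by
      rw [Nat.isCoprime_iff_coprime]
      exact Nat.Coprime.coprime_dvd_left ⟨m, by rw [ha, mul_comm]⟩
        (Nat.Coprime.coprime_dvd_right ⟨n, by rw [hb, mul_comm]⟩ hkcop)
    have hsq : ∀ a b : ℕ, IsCoprime (a : ℤ) b → a * b = w ^ 2 → ∃ c, a = c ^ 2 := by
      intro a b hc hab
      obtain ⟨c, hc | hc⟩ := Int.sq_of_isCoprime hc (c := w) (by exact_mod_cast hab)
      · exact ⟨c.natAbs, by zify; rw [sq_abs, hc]⟩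
      · refine ⟨0, ?_⟩
        have := sq_nonneg c
        zify; omega
    obtain ⟨c, rfl⟩ := hsq a b hc hab
    obtain ⟨e, rfl⟩ := hsq b _ hc.symm (by rw [mul_comm, hab])
    exact ⟨c, e, ha, hb⟩
  have hpk : p ∣ k ∨ p ∣ k + 1 := hp.dvd_mul.mp ⟨q * w ^ 2, by rw [hkw]; ring⟩
  have hqk : q ∣ k ∨ q ∣ k + 1 := hq.dvd_mul.mp ⟨p * w ^ 2, by rw [hkw]; ring⟩
  rcases hpk with hpk | hpk <;> rcases hqk with hqk | hqk
  · obtain ⟨a, b, ha, hb⟩ := key (p * q) 1 (hcop.mul_dvd_of_dvd_of_dvd hpk hqk) (one_dvd _)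
      (mul_one _)
    have hb1 : 1 < b := by
      by_contra hb1
      have : b ≤ 1 := by omega
      interval_cases b <;> omega
    have := hs.x_le_x (a := Pell.Solution₁.mk (b : ℤ) a (by
      have : (b ^ 2 : ℤ) = k + 1 := by exact_mod_cast (by omega)
      have h2 : (k : ℤ) = p * q * a ^ 2 := by exact_mod_cast ha
      rw [this]; linarith)) (by simpa using hb1)
    rw [Pell.Solution₁.x_mk, hxk] at this
    have h3 : 2 * k + 1 ≤ b := by exact_mod_cast this
    nlinarith
  · obtain ⟨a, b, ha, hb⟩ := key p q hpk hqk rfl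
    refine ⟨a, b, ?_⟩
    zify at ha hb
    rw [← ha, ← hb]; ring
  · obtain ⟨a, b, ha, hb⟩ := key q p hqk hpk (mul_comm _ _)
    refine ⟨b, a, ?_⟩
    zify at ha hb
    rw [← ha, ← hb]; ring
  · obtain ⟨a, b, ha, hb⟩ := key 1 (p * q) (one_dvd _) (hcop.mul_dvd_of_dvd_of_dvd hpk hqk)
      (one_mul _)
    have : (1 : ℤ) = 0 := by
      refine Int.eq_zero_of_sq_add_sq_eq_mul_sq hp hp4 hpq' (x := a) (y := b) ?_
      zify at ha hb
      linarith
    omega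

/-- If `A ^ 2 = p * q` and `p * a ^ 2 - q * b ^ 2 = ± 1`, then `(p)` is the square of a principal
ideal, generated by `p * a + b * A`. -/
theorem exists_span_sq_eq_of_mul_sq_sub_mul_sq {R : Type*} [CommRing R] {A p q a b : R}
    (hA : A ^ 2 = p * q) (h : (p * a ^ 2 - q * b ^ 2) ^ 2 = 1) :
    ∃ π : R, Ideal.span {π} ^ 2 = Ideal.span {p} := by
  refine ⟨p * a + b * A, ?_⟩
  have hu : IsUnit (p * a ^ 2 + q * b ^ 2 + 2 * a * b * A) :=
    IsUnit.of_mul_eq_one (p * a ^ 2 + q * b ^ 2 - 2 * a * b * A)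
      (by linear_combination h - 4 * a ^ 2 * b ^ 2 * hA)
  rw [Ideal.span_singleton_pow, ← Ideal.span_singleton_mul_right_unit hu p]
  congr 2
  linear_combination b ^ 2 * hA

section

variable {K : Type*} [Field K] [NumberField K]

theorem NumberField.RingOfIntegers.intCast_dvd_intCast {a b : ℤ} (h : (a : 𝓞 K) ∣ b) : a ∣ b := by
  have h2 := map_dvd (Algebra.norm ℤ) h
  rw [← eq_intCast (algebraMap ℤ (𝓞 K)), ← eq_intCast (algebraMap ℤ (𝓞 K)),
    Algebra.norm_algebraMap, Algebra.norm_algebraMap] at h2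
  exact (Int.pow_dvd_pow_iff Module.finrank_pos.ne').mp h2

/-- An ideal whose square is generated by a rational integer is principal, provided every rational
prime is either the square of a principal ideal or generates a radical ideal. -/
theorem isPrincipal_of_sq_eq_span_intCast
    (H : ∀ l : ℕ, l.Prime → (∃ π : 𝓞 K, Ideal.span {π} ^ 2 = Ideal.span {(l : 𝓞 K)}) ∨
      ∀ x : 𝓞 K, (l : 𝓞 K) ∣ x ^ 2 → (l : 𝓞 K) ∣ x)
    {J : Ideal (𝓞 K)} {t : ℤ} (ht : t ≠ 0) (hJ : J ^ 2 = Ideal.span {(t : 𝓞 K)}) :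
    J.IsPrincipal := by
  have mul_span : ∀ (x : 𝓞 K) (J : Ideal (𝓞 K)), J.IsPrincipal →
      (Ideal.span {x} * J).IsPrincipal := by
    rintro x J ⟨y, rfl⟩
    exact ⟨x * y, by simp [Ideal.submodule_span_eq, Ideal.span_singleton_mul_span_singleton]⟩
  induction hn : t.natAbs using Nat.strong_induction_on generalizing t J with
  | _ n ih =>
    subst hn
    by_cases h1 : t.natAbs = 1
    · have hu : IsUnit ((t : ℤ) : 𝓞 K) := (Int.isUnit_iff_natAbs_eq.mpr h1).map (Int.castRingHom _)
      rw [Ideal.span_singleton_eq_top.mpr hu] at hJ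
      have : J = ⊤ := by
        rw [← Ideal.one_eq_top] at hJ ⊢
        exact (pow_eq_one_iff_left two_ne_zero).mp hJ
      rw [this]
      exact ⟨1, by simp⟩
    obtain ⟨l, hl, hlt⟩ := Nat.exists_prime_and_dvd h1
    rw [← Int.natCast_dvd] at hlt
    have hl0 : (l : 𝓞 K) ≠ 0 := by exact_mod_cast hl.ne_zero
    have hl0' : (Ideal.span {(l : 𝓞 K)}) ≠ 0 := by simpa using hl0
    have hlt' : (Ideal.span {(l : 𝓞 K)}) ∣ J ^ 2 := by
      rw [hJ, Ideal.dvd_span_singleton, Ideal.mem_span_singleton]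
      simpa using map_dvd (Int.castRingHom (𝓞 K)) hlt
    rcases H l hl with ⟨π, hπ⟩ | hrad
    · obtain ⟨s, rfl⟩ := hlt
      rw [← hπ, UniqueFactorizationMonoid.pow_dvd_pow_iff_dvd two_ne_zero] at hlt'
      obtain ⟨J, rfl⟩ := hlt'
      refine mul_span _ _ (ih _ ?_ (right_ne_zero_of_mul ht) (J := J) ?_ rfl)
      · rw [Int.natAbs_mul, Int.natAbs_natCast]
        exact lt_mul_left (Int.natAbs_pos.mpr (right_ne_zero_of_mul ht)) hl.one_lt
      · rw [mul_pow, hπ] at hJ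
        refine mul_left_cancel₀ hl0' ?_
        rw [hJ, Ideal.span_singleton_mul_span_singleton]
        push_cast; rfl
    · have hlJ : Ideal.span {(l : 𝓞 K)} ∣ J := by
        rw [Ideal.dvd_iff_le] at hlt' ⊢
        intro x hx
        exact Ideal.mem_span_singleton.mpr
          (hrad x (Ideal.mem_span_singleton.mp (hlt' (Ideal.pow_mem_pow hx 2))))
      obtain ⟨J, rfl⟩ := hlJ
      have hdvd : ((l ^ 2 : ℤ) : 𝓞 K) ∣ t := by
        rw [← Ideal.span_singleton_le_span_singleton, ← hJ, mul_pow, Ideal.span_singleton_pow]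
        push_cast
        exact Ideal.mul_le_left
      obtain ⟨s, rfl⟩ := NumberField.RingOfIntegers.intCast_dvd_intCast hdvd
      refine mul_span _ _ (ih _ ?_ (right_ne_zero_of_mul ht) (J := J) ?_ rfl)
      · rw [Int.natAbs_mul, Int.natAbs_pow, Int.natAbs_natCast]
        exact lt_mul_left (Int.natAbs_pos.mpr (right_ne_zero_of_mul ht))
          (Nat.one_lt_pow two_ne_zero hl.one_lt)
      · rw [mul_pow] at hJ
        refine mul_left_cancel₀ (pow_ne_zero 2 hl0') ?_
        rw [hJ, Ideal.span_singleton_pow, Ideal.span_singleton_mul_span_singleton]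
        push_cast; rfl

end

section

variable {K : Type*} [Field K] [NumberField K] {d : ℕ} {α : K}

theorem exists_basis_one_sqrt_s7 (hd1 : 1 < d) (hdsf : Squarefree d) (hα : α ^ 2 = (d : K))
    (hdeg : Module.finrank ℚ K = 2) : ∃ b : Module.Basis (Fin 2) ℚ K, ⇑b = ![1, α] := by
  have hli : LinearIndependent ℚ ![1, α] := by
    rw [LinearIndependent.pair_iff' one_ne_zero]
    rintro r rfl
    have hr : r ^ 2 = d := by
      apply (algebraMap ℚ K).injective
      rw [Algebra.smul_def, mul_one] at hα
      simpa using hα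
    have hsq : IsSquare ((d : ℤ) : ℚ) := ⟨r, by rw [← sq, hr]; simp⟩
    rw [Rat.isSquare_intCast_iff, Int.isSquare_natCast_iff] at hsq
    obtain ⟨s, rfl⟩ := hsq
    have := Nat.isUnit_iff.mp (hdsf s dvd_rfl)
    simp [this] at hd1
  exact ⟨basisOfLinearIndependentOfCardEqFinrank hli (by simp [hdeg]), by simp⟩

theorem trace_norm_add_mul_sqrt_s7 {b : Module.Basis (Fin 2) ℚ K} (hb : ⇑b = ![1, α])
    (hα : α ^ 2 = (d : K)) (r s : ℚ) :
    Algebra.trace ℚ K (r + s * α) = 2 * r ∧ Algebra.norm ℚ (r + s * α : K) = r ^ 2 - d * s ^ 2 := by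
  have hb0 : b 0 = 1 := by simp [hb]
  have hb1 : b 1 = α := by simp [hb]
  have h0 : (r + s * α : K) * b 0 = r • b 0 + s • b 1 := by
    rw [hb0, hb1]; simp [Algebra.smul_def]
  have h1 : (r + s * α : K) * b 1 = (d * s) • b 0 + r • b 1 := by
    rw [hb0, hb1]; simp [Algebra.smul_def]; linear_combination s * hα
  have hM : Algebra.leftMulMatrix b (r + s * α : K) = !![r, d * s; s, r] := by
    ext i j
    rw [Algebra.leftMulMatrix_eq_repr_mul]
    fin_cases j
    · simp only [Fin.zero_eta, h0]
      fin_cases i <;> simp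
    · simp only [Fin.mk_one, h1]
      fin_cases i <;> simp
  rw [Algebra.trace_eq_matrix_trace b, Algebra.norm_eq_matrix_det b, hM, Matrix.trace_fin_two_of,
    Matrix.det_fin_two_of]
  constructor <;> ring

/-- Integers of `ℚ(√d)` have the form `(u + v √d) / 2` with norm `(u ^ 2 - d * v ^ 2) / 4`. -/
theorem exists_two_mul_eq_add_mul_sqrt (hd1 : 1 < d) (hdsf : Squarefree d) (hα : α ^ 2 = (d : K))
    (hdeg : Module.finrank ℚ K = 2) (x : 𝓞 K) :
    ∃ u v : ℤ, 2 * (x : K) = u + v * α ∧ u ^ 2 - d * v ^ 2 = 4 * Algebra.norm ℤ x := by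
  obtain ⟨b, hb⟩ := exists_basis_one_sqrt_s7 hd1 hdsf hα hdeg
  obtain ⟨r, s, hx⟩ : ∃ r s : ℚ, (x : K) = r + s * α := by
    refine ⟨b.repr x 0, b.repr x 1, ?_⟩
    conv_lhs => rw [← b.sum_repr x]
    simp [Fin.sum_univ_two, hb, Algebra.smul_def]
  obtain ⟨htr, hnm⟩ := trace_norm_add_mul_sqrt_s7 hb hα r s
  rw [← hx, ← Algebra.coe_trace_int] at htr
  rw [← hx, ← Algebra.coe_norm_int] at hnm
  set u := Algebra.trace ℤ (𝓞 K) x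
  set N := Algebra.norm ℤ x
  have hsN : d * (2 * s) ^ 2 = ((u ^ 2 - 4 * N : ℤ) : ℚ) := by
    push_cast; rw [htr, hnm]; ring
  obtain ⟨v, hv⟩ : ∃ v : ℤ, (v : ℚ) = 2 * s := by
    set w := 2 * s
    refine ⟨w.num, Rat.coe_int_num_of_den_eq_one ?_⟩
    have hden : (w.den : ℤ) ^ 2 ∣ d * w.num ^ 2 := by
      refine ⟨u ^ 2 - 4 * N, ?_⟩
      have : (d : ℚ) * w.num ^ 2 = w.den ^ 2 * ((u ^ 2 - 4 * N : ℤ) : ℚ) := by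
        rw [← hsN, ← Rat.mul_den_eq_num]; ring
      exact_mod_cast this
    have hcop : IsCoprime ((w.den : ℤ) ^ 2) (w.num ^ 2) :=
      (Int.isCoprime_iff_gcd_eq_one.mpr (by
        simpa [Int.gcd, Nat.coprime_comm] using w.reduced)).pow
    have := hcop.dvd_of_dvd_mul_right hden
    rw [sq] at this
    exact Nat.isUnit_iff.mp (hdsf w.den (by exact_mod_cast this))
  refine ⟨u, v, ?_, ?_⟩
  · have h1 : (u : K) = 2 * r := by exact_mod_cast congrArg (algebraMap ℚ K) htr
    have h2 : (v : K) = 2 * s := by exact_mod_cast congrArg (algebraMap ℚ K) hv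
    rw [h1, h2, hx]; ring
  · rw [← hv] at hsN
    have : (d : ℤ) * v ^ 2 = u ^ 2 - 4 * N := by exact_mod_cast hsN
    linarith

theorem exists_two_mul_eq_of_four_dvd (hα : α ^ 2 = (d : K)) {u v : ℤ}
    (h : (4 : ℤ) ∣ u ^ 2 - d * v ^ 2) : ∃ x : 𝓞 K, 2 * (x : K) = u + v * α := by
  obtain ⟨N, hN⟩ := h
  have hN' : (u : K) ^ 2 - d * v ^ 2 = 4 * N := by exact_mod_cast congrArg (Int.cast : ℤ → K) hN
  have hint : IsIntegral ℤ ((u + v * α) / 2 : K) := by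
    refine ⟨Polynomial.X ^ 2 - Polynomial.C u * Polynomial.X + Polynomial.C N, by monicity!, ?_⟩
    simp only [Polynomial.eval₂_add, Polynomial.eval₂_sub, Polynomial.eval₂_mul,
      Polynomial.eval₂_pow, Polynomial.eval₂_X, Polynomial.eval₂_C]
    simp only [eq_intCast]
    linear_combination v ^ 2 / 4 * hα - hN' / 4
  obtain ⟨x, hx⟩ := (IsIntegralClosure.isIntegral_iff (A := 𝓞 K)).mp hint
  exact ⟨x, by rw [← NumberField.RingOfIntegers.coe_eq_algebraMap] at hx; rw [hx]; ring⟩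

theorem int_coeffs_ext (hd1 : 1 < d) (hdsf : Squarefree d) (hα : α ^ 2 = (d : K))
    (hdeg : Module.finrank ℚ K = 2) {u v u' v' : ℤ} (h : (u + v * α : K) = u' + v' * α) :
    u = u' ∧ v = v' := by
  obtain ⟨b, hb⟩ := exists_basis_one_sqrt_s7 hd1 hdsf hα hdeg
  have := b.linearIndependent
  rw [hb, LinearIndependent.pair_iff] at this
  have h2 := this ((u - u' : ℤ) : ℚ) ((v - v' : ℤ) : ℚ) (by
    simp [Algebra.smul_def]; linear_combination h)
  norm_cast at h2
  omega

/-- A rational prime not dividing `d ≡ 1 (mod 4)` generates a radical ideal in the ring of integers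
of `ℚ(√d)`. -/
theorem natCast_dvd_of_dvd_sq (hd1 : 1 < d) (hdsf : Squarefree d) (hd4 : d % 4 = 1)
    (hα : α ^ 2 = (d : K)) (hdeg : Module.finrank ℚ K = 2) {l : ℕ} (hl : l.Prime) (hld : ¬ l ∣ d)
    {x : 𝓞 K} (hx : (l : 𝓞 K) ∣ x ^ 2) : (l : 𝓞 K) ∣ x := by
  have hl' : Prime (l : ℤ) := Nat.prime_iff_prime_int.mp hl
  obtain ⟨D, hD⟩ : ∃ D : ℤ, (d : ℤ) = 4 * D + 1 := ⟨d / 4, by omega⟩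
  obtain ⟨u, v, hxuv, hN⟩ := exists_two_mul_eq_add_mul_sqrt hd1 hdsf hα hdeg x
  have hlN : (l : ℤ) ∣ Algebra.norm ℤ x := by
    refine hl'.dvd_of_dvd_pow (n := 2) ?_
    rw [← map_pow]
    have h := map_dvd (Algebra.norm ℤ) hx
    rw [← map_natCast (algebraMap ℤ (𝓞 K)), Algebra.norm_algebraMap] at h
    exact (dvd_pow_self _ Module.finrank_pos.ne').trans h
  obtain ⟨y, hy⟩ := hx
  obtain ⟨u', v', hyuv, -⟩ := exists_two_mul_eq_add_mul_sqrt hd1 hdsf hα hdeg y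
  have hy' : (x : K) ^ 2 = l * y := by exact_mod_cast congrArg (algebraMap (𝓞 K) K) hy
  obtain ⟨h1, h2⟩ := int_coeffs_ext hd1 hdsf hα hdeg (u := u ^ 2 + d * v ^ 2) (v := 2 * u * v)
    (u' := 2 * l * u') (v' := 2 * l * v') (by
      push_cast
      linear_combination 4 * hy' + 2 * l * hyuv - (2 * x + u + v * α) * hxuv - v ^ 2 * hα)
  obtain ⟨M, hM⟩ := hlN
  rw [hM] at hN
  suffices ∃ a b : ℤ, u = l * a ∧ v = l * b ∧ (4 : ℤ) ∣ a ^ 2 - d * b ^ 2 by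
    obtain ⟨a, b, rfl, rfl, hab⟩ := this
    obtain ⟨z, hz⟩ := exists_two_mul_eq_of_four_dvd (K := K) hα hab
    refine ⟨z, ?_⟩
    apply NumberField.RingOfIntegers.ext
    apply mul_left_cancel₀ (two_ne_zero (α := K))
    push_cast at hxuv ⊢
    rw [hxuv]
    linear_combination -l * hz
  have four_dvd : ∀ a b : ℤ, a % 2 = b % 2 → (4 : ℤ) ∣ a ^ 2 - d * b ^ 2 := by
    intro a b hab
    obtain ⟨c, rfl⟩ : ∃ c, a = b + 2 * c := ⟨(a - b) / 2, by omega⟩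
    exact ⟨b * c + c ^ 2 - D * b ^ 2, by rw [hD]; ring⟩
  have parity : ∀ (a b c : ℤ), a ^ 2 - d * b ^ 2 = 2 * c → a % 2 = b % 2 := by
    intro a b c h
    have h3 : Even (a ^ 2 - b ^ 2) :=
      even_iff_two_dvd.mpr ⟨c + 2 * D * b ^ 2, by rw [hD] at h; linear_combination h⟩
    rw [Int.even_sub, Int.even_pow' two_ne_zero, Int.even_pow' two_ne_zero, Int.even_iff,
      Int.even_iff] at h3
    omega
  have huv := parity u v (2 * (l * M)) (by rw [hN]; ring)
  rcases hl.eq_two_or_odd with rfl | hodd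
  · have hu : u % 2 = 0 := by
      by_contra hu
      obtain ⟨a, rfl⟩ : ∃ a, u = 2 * a + 1 := ⟨u / 2, by omega⟩
      obtain ⟨b, rfl⟩ : ∃ b, v = 2 * b + 1 := ⟨v / 2, by omega⟩
      push_cast at h2
      have : 4 * (v' - 2 * a * b - a - b) = 2 := by linear_combination -h2
      omega
    obtain ⟨a, rfl⟩ : ∃ a, u = 2 * a := ⟨u / 2, by omega⟩
    obtain ⟨b, rfl⟩ : ∃ b, v = 2 * b := ⟨v / 2, by omega⟩
    refine ⟨a, b, rfl, rfl, four_dvd a b (parity a b M ?_)⟩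
    push_cast at hN
    linarith
  · have hl2 : ¬ (l : ℤ) ∣ 2 := by
      intro h
      have := Nat.le_of_dvd two_pos (by exact_mod_cast h)
      have := hl.two_le
      omega
    obtain ⟨a, rfl⟩ : (l : ℤ) ∣ u := hl'.dvd_of_dvd_pow
      ((hl'.dvd_or_dvd (b := u ^ 2) ⟨2 * u' + 4 * M, by linear_combination h1 + hN⟩).resolve_left
        hl2)
    obtain ⟨b, rfl⟩ : (l : ℤ) ∣ v := by
      have h3 : (l : ℤ) ∣ 2 * (d * v ^ 2) := ⟨2 * u' - 4 * M, by linear_combination h1 - hN⟩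
      exact hl'.dvd_of_dvd_pow ((hl'.dvd_or_dvd ((hl'.dvd_or_dvd h3).resolve_left hl2)).resolve_left
        (by exact_mod_cast hld))
    refine ⟨a, b, rfl, rfl, four_dvd a b ?_⟩
    have mul_mod : ∀ c : ℤ, l * c % 2 = c % 2 := fun c ↦ by
      rw [Int.mul_emod, show (l : ℤ) % 2 = 1 by omega, one_mul, Int.emod_emod_of_dvd _ dvd_rfl]
    rwa [mul_mod, mul_mod] at huv

/-- In `ℚ(√(p q))` with `p, q ≡ 3 (mod 4)`, an ideal whose square is principal is inverse to a
principal ideal modulo principal ideals; so there are no ideal classes of order two. -/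
theorem exists_mul_eq_span_of_sq_isPrincipal {p q : ℕ} (hp : p.Prime) (hq : q.Prime) (hpq : p ≠ q)
    (hp4 : p % 4 = 3) (hq4 : q % 4 = 3) (hα : α ^ 2 = ((p * q : ℕ) : K))
    (hdeg : Module.finrank ℚ K = 2) {I : Ideal (𝓞 K)} (hI0 : I ≠ 0) (hI : (I ^ 2).IsPrincipal) :
    ∃ (β : 𝓞 K) (J : Ideal (𝓞 K)), β ≠ 0 ∧ J.IsPrincipal ∧ I * J = Ideal.span {β} := by
  have hsf : Squarefree (p * q) := (Nat.squarefree_mul ((Nat.coprime_primes hp hq).mpr hpq)).mpr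
    ⟨hp.squarefree, hq.squarefree⟩
  have hd1 : 1 < p * q := one_lt_mul'' hp.one_lt hq.one_lt
  have hd4 : p * q % 4 = 1 := by rw [Nat.mul_mod, hp4, hq4]
  have hpq' : ¬ p ∣ q := fun h ↦ hpq ((Nat.prime_dvd_prime_iff_eq hp hq).mp h)
  obtain ⟨A, hA⟩ : ∃ A : 𝓞 K, (A : K) = α := by
    have : IsIntegral ℤ (α ^ 2) := hα ▸ isIntegral_natCast _
    exact (IsIntegralClosure.isIntegral_iff (A := 𝓞 K)).mp (this.of_pow two_pos)
  have hA2 : A ^ 2 = (p : 𝓞 K) * q := by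
    apply NumberField.RingOfIntegers.ext
    rw [← hA] at hα
    exact_mod_cast hα
  obtain ⟨a, b, hab⟩ := exists_mul_sq_sub_mul_sq_sq_eq_one hp hq hpq hp4 hq4
  have hab' : ((p : 𝓞 K) * a ^ 2 - q * b ^ 2) ^ 2 = 1 := by exact_mod_cast congrArg (Int.cast) hab
  have H : ∀ l : ℕ, l.Prime → (∃ π : 𝓞 K, Ideal.span {π} ^ 2 = Ideal.span {(l : 𝓞 K)}) ∨
      ∀ x : 𝓞 K, (l : 𝓞 K) ∣ x ^ 2 → (l : 𝓞 K) ∣ x := by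
    intro l hl
    by_cases hld : l ∣ p * q
    · left
      rcases hl.dvd_mul.mp hld with h | h
      · rw [(Nat.prime_dvd_prime_iff_eq hl hp).mp h]
        exact exists_span_sq_eq_of_mul_sq_sub_mul_sq hA2 hab'
      · rw [(Nat.prime_dvd_prime_iff_eq hl hq).mp h]
        exact exists_span_sq_eq_of_mul_sq_sub_mul_sq (hA2.trans (mul_comm _ _)) (a := b) (b := a)
          (by linear_combination hab')
    · exact .inr fun x ↦ natCast_dvd_of_dvd_sq hd1 hsf hd4 hα hdeg hl hld
  obtain ⟨x, hx⟩ := hI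
  rw [Ideal.submodule_span_eq] at hx
  obtain ⟨u, v, hxuv, hN⟩ := exists_two_mul_eq_add_mul_sqrt hd1 hsf hα hdeg x
  set n : ℤ := (Ideal.absNorm I : ℤ) with hn
  have hn0 : n ≠ 0 := by
    rw [hn]
    exact_mod_cast Ideal.absNorm_eq_zero_iff.not.mpr hI0
  have hNn : Algebra.norm ℤ x = n ^ 2 := by
    have h := congrArg Ideal.absNorm hx
    rw [map_pow, Ideal.absNorm_span_singleton] at h
    have h' : n ^ 2 = |Algebra.norm ℤ x| := by rw [hn, Int.abs_eq_natAbs]; exact_mod_cast h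
    rcases abs_choice (Algebra.norm ℤ x) with h2 | h2
    · rw [h', h2]
    · rw [h2] at h'
      have := Int.eq_zero_of_sq_add_sq_eq_mul_sq hp hp4 hpq' (x := u) (n := 2 * n) (y := v)
        (by push_cast at hN; linear_combination hN + 4 * h')
      omega
  rw [hNn] at hN
  have hquad : x ^ 2 = u * x - n ^ 2 := by
    apply NumberField.RingOfIntegers.ext
    have hN' : (u : K) ^ 2 - (p * q : ℕ) * v ^ 2 = 4 * n ^ 2 := by
      exact_mod_cast congrArg (Int.cast : ℤ → K) hN
    have hu : ((u : 𝓞 K) : K) = u := map_intCast (algebraMap (𝓞 K) K) u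
    have hn' : ((n : 𝓞 K) : K) = n := map_intCast (algebraMap (𝓞 K) K) n
    push_cast at hα hN'
    change (x : K) ^ 2 = (u : 𝓞 K) * (x : K) - (n : 𝓞 K) ^ 2
    rw [hu, hn']
    linear_combination (2 * x - u + v * α) / 4 * hxuv + v ^ 2 / 4 * hα - hN' / 4
  clear hxuv hN hNn
  have hx0 : x ≠ 0 := by
    rintro rfl
    refine hI0 ((pow_eq_zero_iff two_ne_zero).mp (hx.trans ?_))
    simp
  obtain ⟨x, u, hx0, hx, hquad, ht⟩ : ∃ (x : 𝓞 K) (u : ℤ), x ≠ 0 ∧ I ^ 2 = Ideal.span {x} ∧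
      x ^ 2 = u * x - n ^ 2 ∧ u + 2 * n ≠ 0 := by
    by_cases ht : u + 2 * n = 0
    · exact ⟨-x, -u, neg_ne_zero.mpr hx0, by rw [hx, Ideal.span_singleton_neg], by
        push_cast; linear_combination hquad, by omega⟩
    · exact ⟨x, u, hx0, hx, hquad, ht⟩
  have hβ : (x + n) ^ 2 = x * (u + 2 * n : ℤ) := by push_cast; linear_combination hquad
  have hβ' : Ideal.span {x + (n : 𝓞 K)} ^ 2 = I ^ 2 * Ideal.span {((u + 2 * n : ℤ) : 𝓞 K)} := by
    rw [Ideal.span_singleton_pow, hβ, hx, Ideal.span_singleton_mul_span_singleton]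
  obtain ⟨J, hJ⟩ := (UniqueFactorizationMonoid.pow_dvd_pow_iff_dvd two_ne_zero).mp ⟨_, hβ'⟩
  refine ⟨x + n, J, ?_, isPrincipal_of_sq_eq_span_intCast H ht ?_, hJ.symm⟩
  · rw [← pow_ne_zero_iff two_ne_zero, hβ]
    exact mul_ne_zero hx0 (by exact_mod_cast ht)
  · rw [hJ, mul_pow] at hβ'
    exact mul_left_cancel₀ (pow_ne_zero 2 hI0) hβ'

end

/-- Suppose exactly two rational primes ramify in `K_d = ℚ(√d)` (i.e. `n_d = 2`) and
`h_d ∈ {1, 2}`. If the smallest ramified prime `p₁` satisfies `p₁ ≡ 3 (mod 4)`,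
then `h_d = 1`. -/
theorem stmt_7 (d : ℕ) (hd1 : 1 < d) (hdsf : Squarefree d)
    (K : Type*) [Field K] [NumberField K] (α : K)
    (hα : α ^ 2 = (d : K)) (hdeg : Module.finrank ℚ K = 2)
    (hnd : (quadDisc d).primeFactors.card = 2)
    (hcl : classNumber K = 1 ∨ classNumber K = 2)
    (p₁ : ℕ) (hp₁ : p₁.Prime) (hp₁d : p₁ ∣ quadDisc d)
    (hmin : ∀ q : ℕ, q.Prime → q ∣ quadDisc d → p₁ ≤ q)
    (hp₁4 : p₁ % 4 = 3) :
    classNumber K = 1 := by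
  have hd4 : d % 4 = 1 := by
    by_contra h
    have := hmin 2 Nat.prime_two (by rw [quadDisc, if_neg h]; exact ⟨2 * d, by ring⟩)
    have := hp₁.two_le
    omega
  rw [quadDisc, if_pos hd4] at hnd hp₁d
  obtain ⟨q, hq, hpq, rfl⟩ : ∃ q : ℕ, q.Prime ∧ p₁ ≠ q ∧ d = p₁ * q := by
    have hmem : p₁ ∈ d.primeFactors := Nat.mem_primeFactors.mpr ⟨hp₁, hp₁d, by omega⟩
    have hprod := Nat.prod_primeFactors_of_squarefree hdsf
    obtain ⟨q, hq⟩ := Finset.card_eq_one.mp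
      (show (d.primeFactors.erase p₁).card = 1 by rw [Finset.card_erase_of_mem hmem, hnd])
    rw [← Finset.mul_prod_erase _ _ hmem, hq, Finset.prod_singleton] at hprod
    have hqm : q ∈ d.primeFactors.erase p₁ := by simp [hq]
    rw [Finset.mem_erase] at hqm
    exact ⟨q, Nat.prime_of_mem_primeFactors hqm.2, hqm.1.symm, hprod.symm⟩
  have hq4 : q % 4 = 3 := by
    rw [Nat.mul_mod, hp₁4] at hd4
    omega
  refine hcl.resolve_right fun h2 ↦ ?_
  have hone : ∀ c : ClassGroup (𝓞 K), c = 1 := by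
    intro c
    obtain ⟨I, rfl⟩ := ClassGroup.mk0_surjective c
    have hsq : ClassGroup.mk0 (I ^ 2) = 1 := by
      rw [map_pow, ← h2, classNumber, pow_card_eq_one]
    rw [ClassGroup.mk0_eq_one_iff] at hsq
    obtain ⟨β, J, hβ, ⟨j, hj⟩, hIJ⟩ := exists_mul_eq_span_of_sq_isPrincipal hp₁ hq hpq hp₁4 hq4 hα hdeg
      (nonZeroDivisors.coe_ne_zero I) hsq
    have hj0 : j ≠ 0 := by
      rintro rfl
      rw [hj] at hIJ
      exact hβ (by simpa using hIJ.symm)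
    rw [← map_one ClassGroup.mk0, ClassGroup.mk0_eq_mk0_iff]
    exact ⟨j, β, hj0, hβ, by
      rw [← hIJ, hj, Ideal.submodule_span_eq, Submonoid.coe_one, mul_one, mul_comm]⟩
  have : Subsingleton (ClassGroup (𝓞 K)) := ⟨fun a b ↦ (hone a).trans (hone b).symm⟩
  have := Fintype.card_le_one_iff_subsingleton.mpr this
  rw [classNumber] at h2
  omega
end

section
/- Let d > 1 be a squarefree integer. The class number h_d of the real quadratic field K_d = ℚ(√d) is odd if and only if either n_d = 1, or the discriminant D of K_d can be written as D = d₁·d₂ where d₁ and d₂ are negative prime discriminants. -/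
open NumberField

/-- The negative prime discriminants: `-4`, `-8`, and `-q` for primes `q ≡ 3 (mod 4)`. -/
def IsNegPrimeDiscriminant (x : ℤ) : Prop :=
  x = -4 ∨ x = -8 ∨ ∃ q : ℕ, q.Prime ∧ q % 4 = 3 ∧ x = -(q : ℤ)

/-- `w` is a square root of the squarefree integer `d > 1` in the ring of integers of a
quadratic number field. -/
structure IsQuadraticRoot {K : Type*} [Field K] [NumberField K] (d : ℕ) (w : 𝓞 K) : Prop where
  one_lt : 1 < d
  squarefree : Squarefree d
  sq_eq : w ^ 2 = (d : 𝓞 K)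
  finrank_eq : Module.finrank ℚ K = 2

theorem Squarefree.eq_of_isSquare_mul {m n : ℕ} (hm : Squarefree m) (hn : Squarefree n)
    (h : IsSquare (m * n)) : m = n := by
  obtain ⟨k, hk⟩ := h
  have hm0 := hm.ne_zero
  have hn0 := hn.ne_zero
  refine Nat.eq_of_factorization_eq hm0 hn0 fun p => ?_
  have h1 := hm.natFactorization_le_one p
  have h2 := hn.natFactorization_le_one p
  have hk0 : k ≠ 0 := by
    rintro rfl
    simp [hm0, hn0] at hk
  have h3 : (m * n).factorization p = (k * k).factorization p := by rw [hk]
  rw [Nat.factorization_mul hm0 hn0, Nat.factorization_mul hk0 hk0] at h3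
  simp only [Finsupp.add_apply] at h3
  omega

theorem Rat.exists_int_of_sq_eq_intCast {n : ℤ} (q : ℚ) (h : q ^ 2 = n) : ∃ k : ℤ, q = k := by
  have hq : IsIntegral ℤ q := by
    refine IsIntegral.of_pow (n := 2) (by norm_num) ?_
    rw [h]
    exact isIntegral_algebraMap (R := ℤ) (A := ℚ) (x := n)
  obtain ⟨k, hk⟩ := IsIntegrallyClosed.isIntegral_iff.mp hq
  exact ⟨k, by simpa using hk.symm⟩

/-- If `d` is squarefree and `d * q ^ 2` is an integer, then so is the rational `q`. -/
theorem Rat.exists_int_of_squarefree_mul_sq {d : ℕ} (hd : Squarefree d) {q : ℚ} {n : ℤ}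
    (h : (d : ℚ) * q ^ 2 = n) : ∃ k : ℤ, q = k := by
  have hden : q.den ^ 2 ∣ d := by
    have h1 : (d : ℤ) * q.num ^ 2 = n * (q.den : ℤ) ^ 2 := by
      have hq : (q.den : ℚ) ≠ 0 := by exact_mod_cast q.den_nz
      have : (d : ℚ) * q.num ^ 2 = n * (q.den : ℚ) ^ 2 := by
        rw [← h]
        nth_rewrite 2 [← Rat.num_div_den q]
        field_simp
      exact_mod_cast this
    have h2 : (q.den : ℤ) ^ 2 ∣ d * q.num ^ 2 := ⟨n, by rw [h1]; ring⟩
    have h3 : IsCoprime ((q.den : ℤ) ^ 2) (q.num ^ 2) := by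
      refine IsCoprime.pow ?_
      rw [Int.isCoprime_iff_gcd_eq_one, Int.gcd, Int.natAbs_natCast]
      exact q.reduced.symm
    have := h3.dvd_of_dvd_mul_right h2
    exact_mod_cast this
  rw [pow_two] at hden
  have h1 : q.den = 1 := by simpa using hd _ hden
  exact ⟨q.num, (Rat.den_eq_one_iff q).mp h1 |>.symm⟩

namespace IsQuadraticRoot

variable {K : Type*} [Field K] [NumberField K] {d : ℕ} {w : 𝓞 K}

theorem not_isSquare (h : IsQuadraticRoot d w) : ¬ IsSquare d := by
  intro hs
  have := Squarefree.eq_of_isSquare_mul h.squarefree squarefree_one (by simpa using hs)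
  have := h.one_lt
  omega

theorem sq_coe (h : IsQuadraticRoot d w) : (w : K) ^ 2 = (d : K) := by
  have := congrArg (algebraMap (𝓞 K) K) h.sq_eq
  simpa using this

theorem ne_zero (h : IsQuadraticRoot d w) : w ≠ 0 := by
  rintro rfl
  have h1 := h.sq_eq
  have h2 := h.one_lt
  rw [zero_pow two_ne_zero] at h1
  have : d = 0 := by exact_mod_cast h1.symm
  omega

theorem coe_ne_ratCast (h : IsQuadraticRoot d w) (q : ℚ) : (w : K) ≠ (q : K) := by
  intro hq
  have h1 := h.sq_coe
  rw [hq] at h1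
  have h2 : q ^ 2 = (d : ℤ) := by
    have : q ^ 2 = (d : ℚ) := by exact_mod_cast h1
    simpa using this
  obtain ⟨k, rfl⟩ := Rat.exists_int_of_sq_eq_intCast q h2
  refine h.not_isSquare (Int.isSquare_natCast_iff.mp ⟨k, ?_⟩)
  have : k ^ 2 = (d : ℤ) := by exact_mod_cast h2
  rw [← this, pow_two]

theorem linearIndependent (h : IsQuadraticRoot d w) :
    LinearIndependent ℚ ![(1 : K), (w : K)] := by
  rw [LinearIndependent.pair_iff]
  intro s t hst
  have ht : t = 0 := by
    by_contra ht
    apply h.coe_ne_ratCast (-s / t)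
    have ht' : (t : K) ≠ 0 := by exact_mod_cast ht
    push_cast
    rw [eq_div_iff ht']
    simp only [Rat.smul_def] at hst
    linear_combination hst
  subst ht
  simpa using hst

theorem exists_coe_eq (h : IsQuadraticRoot d w) (x : K) :
    ∃ s t : ℚ, x = s + t * (w : K) ∧ Algebra.norm ℚ x = s ^ 2 - d * t ^ 2 ∧
      Algebra.trace ℚ K x = 2 * s := by
  let b := basisOfLinearIndependentOfCardEqFinrank h.linearIndependent
    (by simp [h.finrank_eq])
  have hb0 : b 0 = 1 := by simp [b]
  have hb1 : b 1 = (w : K) := by simp [b]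
  set s := b.repr x 0 with hs
  set t := b.repr x 1 with ht
  have hx : x = s • b 0 + t • b 1 := by
    rw [← Fin.sum_univ_two (f := fun i => b.repr x i • b i), b.sum_repr]
  have hx1 : x * b 1 = (d * t) • b 0 + s • b 1 := by
    rw [hx, hb0, hb1]
    simp only [Rat.smul_def]
    push_cast
    linear_combination (t : K) * h.sq_coe
  have hx0 : x * b 0 = s • b 0 + t • b 1 := by rw [← hx, hb0, mul_one]
  refine ⟨s, t, ?_, ?_, ?_⟩
  · rw [hb0, hb1] at hx
    simpa only [Rat.smul_def, mul_one] using hx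
  · rw [Algebra.norm_eq_matrix_det b, Matrix.det_fin_two]
    simp only [Algebra.leftMulMatrix_eq_repr_mul, hx0, hx1]
    simp
    ring
  · rw [Algebra.trace_eq_matrix_trace b, Matrix.trace_fin_two]
    simp only [Algebra.leftMulMatrix_eq_repr_mul, hx0, hx1]
    simp
    ring

theorem coe_eq_coe_iff (h : IsQuadraticRoot d w) {s t s' t' : ℚ}
    (he : (s : K) + t * w = s' + t' * w) : s = s' ∧ t = t' := by
  have := LinearIndependent.pair_iff.mp h.linearIndependent (s - s') (t - t') (by
    simp only [Rat.smul_def]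
    push_cast
    linear_combination he)
  exact ⟨sub_eq_zero.mp this.1, sub_eq_zero.mp this.2⟩

theorem intCast_eq_iff (h : IsQuadraticRoot d w) {a b a' b' : ℤ}
    (he : (a : 𝓞 K) + b * w = a' + b' * w) : a = a' ∧ b = b' := by
  have h1 := congrArg (algebraMap (𝓞 K) K) he
  simp only [map_add, map_mul, map_intCast] at h1
  have := h.coe_eq_coe_iff (s := a) (t := b) (s' := a') (t' := b') (by simpa using h1)
  exact_mod_cast this

theorem exists_two_mul_eq (h : IsQuadraticRoot d w) (x : 𝓞 K) :
    ∃ a b : ℤ, 2 * x = a + b * w ∧ a ^ 2 - d * b ^ 2 = 4 * Algebra.norm ℤ x := by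
  obtain ⟨s, t, hx, hn, ht⟩ := h.exists_coe_eq (x : K)
  rw [← Algebra.coe_norm_int] at hn
  rw [← Algebra.coe_trace_int] at ht
  set a := Algebra.trace ℤ (𝓞 K) x
  set n := Algebra.norm ℤ x
  obtain ⟨b, hb⟩ := Rat.exists_int_of_squarefree_mul_sq h.squarefree (q := 2 * t)
    (n := a ^ 2 - 4 * n) (by push_cast; rw [hn, ht]; ring)
  refine ⟨a, b, ?_, ?_⟩
  · apply RingOfIntegers.coe_injective
    have hb' : ((2 * t : ℚ) : K) = ((b : ℚ) : K) := by rw [hb]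
    have ha' : ((a : ℚ) : K) = ((2 * s : ℚ) : K) := by rw [ht]
    push_cast at ha' hb'
    simp only [map_mul, map_add, map_intCast, map_ofNat]
    change 2 * (x : K) = a + b * (w : K)
    rw [hx, ha', ← hb']
    ring
  · have : (a : ℚ) ^ 2 - d * b ^ 2 = 4 * n := by
      rw [hn, ht, ← hb]; ring
    exact_mod_cast this

theorem norm_eq (h : IsQuadraticRoot d w) {x : 𝓞 K} {a b : ℤ} (hx : 2 * x = a + b * w) :
    a ^ 2 - d * b ^ 2 = 4 * Algebra.norm ℤ x := by
  obtain ⟨a', b', hx', hn⟩ := h.exists_two_mul_eq x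
  obtain ⟨rfl, rfl⟩ := h.intCast_eq_iff (hx.symm.trans hx')
  exact hn

/-- Every integer satisfies its characteristic polynomial. -/
theorem sq_eq_of_two_mul_eq (h : IsQuadraticRoot d w) {x : 𝓞 K} {a b : ℤ}
    (hx : 2 * x = a + b * w) : x ^ 2 = a * x - (Algebra.norm ℤ x : ℤ) := by
  have hn : ((a ^ 2 - d * b ^ 2 : ℤ) : 𝓞 K) = ((4 * Algebra.norm ℤ x : ℤ) : 𝓞 K) := by
    rw [h.norm_eq hx]
  push_cast at hn
  have h4 : (4 : 𝓞 K) ≠ 0 := by norm_num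
  apply mul_left_cancel₀ h4
  linear_combination (2 * x - a + b * w) * hx - hn + (b : 𝓞 K) ^ 2 * h.sq_eq

theorem isSquare_or_of_sq_eq (h : IsQuadraticRoot d w) {x : 𝓞 K} {n : ℤ} (hx : x ^ 2 = n) :
    IsSquare n ∨ IsSquare (d * n) := by
  obtain ⟨a, b, hab, -⟩ := h.exists_two_mul_eq x
  have h1 : ((4 * n : ℤ) : 𝓞 K) + (0 : ℤ) * w
      = ((a ^ 2 + d * b ^ 2 : ℤ) : 𝓞 K) + ((2 * a * b : ℤ) : 𝓞 K) * w := by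
    push_cast
    linear_combination -4 * hx + (2 * x + a + b * w) * hab + (b : 𝓞 K) ^ 2 * h.sq_eq
  obtain ⟨h2, h3⟩ := h.intCast_eq_iff h1
  have even_of {c m : ℤ} (hc : 4 * m = c ^ 2) : IsSquare m := by
    have : (2 : ℤ) ∣ c := Int.prime_two.dvd_of_dvd_pow (n := 2) ⟨2 * m, by rw [← hc]; ring⟩
    obtain ⟨e, rfl⟩ := this
    exact ⟨e, by linarith⟩
  have h4 : a = 0 ∨ b = 0 := by
    have : a * b = 0 := by linarith
    exact mul_eq_zero.mp this
  rcases h4 with rfl | rfl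
  · right
    exact even_of (c := d * b) (by linear_combination (d : ℤ) * h2)
  · left
    exact even_of (c := a) (by linear_combination h2)

/-- An unramified rational prime `p` is squarefree in the ring of integers. -/
theorem dvd_of_dvd_sq (h : IsQuadraticRoot d w) {p : ℕ} (hp : p.Prime)
    (hpd : ¬ p ∣ quadDisc d) {x : 𝓞 K} (hx : (p : 𝓞 K) ∣ x ^ 2) : (p : 𝓞 K) ∣ x := by
  obtain ⟨a, b, hab, hn⟩ := h.exists_two_mul_eq x
  have hpZ : Prime (p : ℤ) := Nat.prime_iff_prime_int.mp hp
  have hpn : (p : ℤ) ∣ Algebra.norm ℤ x := by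
    obtain ⟨y, hy⟩ := hx
    have h1 : Algebra.norm ℤ (p : 𝓞 K) = (p : ℤ) ^ 2 := by
      have := h.norm_eq (x := (p : 𝓞 K)) (a := 2 * p) (b := 0) (by push_cast; ring)
      linarith
    have h2 : Algebra.norm ℤ x ^ 2 = p * (p * Algebra.norm ℤ y) := by
      rw [← map_pow, hy, map_mul, h1]; ring
    exact hpZ.dvd_of_dvd_pow ⟨_, h2⟩
  have hch := h.sq_eq_of_two_mul_eq hab
  by_cases hpa : (p : ℤ) ∣ a
  · have hpa' := hpa
    have hpn' := hpn
    obtain ⟨a', ha'⟩ := hpa'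
    obtain ⟨n', hn'⟩ := hpn'
    have hp2n : (p : ℤ) ^ 2 ∣ Algebra.norm ℤ x := by
      have hpdb : (p : ℤ) ∣ d * b ^ 2 := by
        rw [show (d : ℤ) * b ^ 2 = a ^ 2 - 4 * Algebra.norm ℤ x by linarith]
        exact dvd_sub (dvd_pow hpa two_ne_zero) (hpn.mul_left 4)
      have hpd' : ¬ (p : ℤ) ∣ d := by
        intro hc
        apply hpd
        have hc' : p ∣ d := by exact_mod_cast hc
        unfold quadDisc
        split_ifs
        · exact hc'
        · exact hc'.mul_left 4
      have hpb : (p : ℤ) ∣ b := hpZ.dvd_of_dvd_pow ((hpZ.dvd_or_dvd hpdb).resolve_left hpd')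
      obtain ⟨b', hb'⟩ := hpb
      by_cases hp2 : p = 2
      · have hd4 : d % 4 = 1 := by
          by_contra hd4
          apply hpd
          simp only [quadDisc, hd4, if_false, hp2]
          omega
        obtain ⟨e, he⟩ : ∃ e : ℤ, (d : ℤ) = 4 * e + 1 := ⟨d / 4, by omega⟩
        subst hp2
        push_cast at *
        have h1 : a' ^ 2 - d * b' ^ 2 = 2 * n' := by
          rw [hn', ha', hb'] at hn
          linarith
        have h2 : 2 ∣ a' - b' := by
          have h3 : (2 : ℤ) ∣ (a' - b') ^ 2 :=
            ⟨n' - a' * b' + (2 * e + 1) * b' ^ 2, by rw [he] at h1; linear_combination h1⟩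
          exact Int.prime_two.dvd_of_dvd_pow h3
        obtain ⟨c, hc⟩ := h2
        refine ⟨c ^ 2 + c * b' - e * b' ^ 2, ?_⟩
        rw [hn', ← h1, he, show a' = b' + 2 * c by linarith]
        ring
      · have h4 : IsCoprime ((p : ℤ) ^ 2) 4 := by
          have h3 : Nat.Coprime p 2 := (Nat.coprime_primes hp Nat.prime_two).mpr hp2
          have : IsCoprime (p : ℤ) (2 : ℕ) := Nat.isCoprime_iff_coprime.mpr h3
          have := this.pow (m := 2) (n := 2)
          norm_num at this
          exact this
        apply h4.dvd_of_dvd_mul_left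
        exact ⟨a' ^ 2 - d * b' ^ 2, by rw [← hn, ha', hb']; ring⟩
    obtain ⟨m, hm⟩ := hp2n
    have hp0 : (p : K) ≠ 0 := by exact_mod_cast hp.ne_zero
    have hint : IsIntegral ℤ ((x : K) / p) := by
      refine ⟨Polynomial.X ^ 2 - Polynomial.C a' * Polynomial.X + Polynomial.C m, ?_, ?_⟩
      · monicity!
      · have h1 := congrArg (algebraMap (𝓞 K) K) hch
        rw [hm, ha'] at h1
        simp only [map_pow, map_sub, map_mul, map_intCast, Int.cast_mul, Int.cast_pow,
          Int.cast_natCast, map_natCast] at h1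
        change (x : K) ^ 2 = p * a' * (x : K) - p ^ 2 * m at h1
        simp only [Polynomial.eval₂_add, Polynomial.eval₂_sub, Polynomial.eval₂_mul,
          Polynomial.eval₂_pow, Polynomial.eval₂_X, Polynomial.eval₂_C]
        simp only [eq_intCast]
        field_simp
        linear_combination h1
    obtain ⟨y, hy⟩ : ∃ y : 𝓞 K, (y : K) = (x : K) / p := ⟨⟨_, hint⟩, rfl⟩
    refine ⟨y, ?_⟩
    apply RingOfIntegers.coe_injective
    rw [map_mul, map_natCast]
    change (x : K) = p * (y : K)
    rw [hy]
    field_simp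
  · obtain ⟨u, v, huv⟩ := (hpZ.coprime_iff_not_dvd.mpr hpa)
    have h1 : (u : 𝓞 K) * p + v * a = 1 := by exact_mod_cast congrArg (Int.cast : ℤ → 𝓞 K) huv
    have h2 : (p : 𝓞 K) ∣ a * x := by
      rw [show (a : 𝓞 K) * x = x ^ 2 + (Algebra.norm ℤ x : ℤ) by rw [hch]; ring]
      refine dvd_add hx ?_
      have := map_dvd (Int.castRingHom (𝓞 K)) hpn
      simpa using this
    rw [show x = p * (u * x) + v * (a * x) by linear_combination -x * h1]
    exact dvd_add (dvd_mul_right _ _) (h2.mul_left _)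

theorem isTotallyReal (h : IsQuadraticRoot d w) : IsTotallyReal K := by
  refine ⟨fun v => ?_⟩
  rw [InfinitePlace.isReal_iff, ComplexEmbedding.isReal_iff]
  set φ := v.embedding
  have hw : φ (w : K) ^ 2 = (d : ℂ) := by
    rw [← map_pow, h.sq_coe, map_natCast]
  have hre := congrArg Complex.re hw
  have him := congrArg Complex.im hw
  simp only [pow_two, Complex.mul_re, Complex.mul_im, Complex.natCast_re, Complex.natCast_im]
    at hre him
  have hd : (0 : ℝ) < d := by exact_mod_cast h.one_lt.le
  have him0 : (φ (w : K)).im = 0 := by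
    have h0 : (φ (w : K)).re * (φ (w : K)).im = 0 := by linarith
    rcases mul_eq_zero.mp h0 with h0 | h0
    · rw [h0] at hre
      nlinarith [sq_nonneg (φ (w : K)).im]
    · exact h0
  ext x
  obtain ⟨s, t, rfl, -⟩ := h.exists_coe_eq x
  simp only [ComplexEmbedding.conjugate_coe_eq, map_add, map_mul, map_ratCast]
  rw [Complex.conj_eq_iff_im.mpr him0]

theorem torsion_eq (h : IsQuadraticRoot d w) {u : (𝓞 K)ˣ} (hu : u ∈ Units.torsion K) :
    u = 1 ∨ u = -1 := by
  have hR := h.isTotallyReal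
  obtain ⟨v⟩ : Nonempty (InfinitePlace K) := inferInstance
  have h1 := (Units.mem_torsion K).mp hu v
  rw [← InfinitePlace.norm_embedding_of_isReal (hR.isReal v), Real.norm_eq_abs, abs_eq zero_le_one]
    at h1
  set σ := InfinitePlace.embedding_of_isReal (hR.isReal v)
  rcases h1 with h1 | h1
  · left
    rw [← map_one σ] at h1
    have h2 := σ.injective h1
    ext
    simpa using h2
  · right
    rw [← map_one σ, ← map_neg] at h1
    have h2 := σ.injective h1
    ext
    simpa using h2

theorem rank_eq_one (h : IsQuadraticRoot d w) : Units.rank K = 1 := by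
  have hR := h.isTotallyReal
  have h1 := InfinitePlace.card_eq_nrRealPlaces_add_nrComplexPlaces K
  rw [IsTotallyReal.nrComplexPlaces_eq_zero, ← IsTotallyReal.finrank, h.finrank_eq] at h1
  rw [Units.rank, h1]

/-- Up to squares, the unit group is generated by `-1` and a fundamental unit. -/
theorem exists_fundamental_unit (h : IsQuadraticRoot d w) : ∃ ε : (𝓞 K)ˣ,
    (∀ η : (𝓞 K)ˣ, ε ≠ η ^ 2 ∧ ε ≠ -η ^ 2) ∧
      ∀ u : (𝓞 K)ˣ, ∃ η : (𝓞 K)ˣ,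
        u = η ^ 2 ∨ u = -η ^ 2 ∨ u = ε * η ^ 2 ∨ u = -(ε * η ^ 2) := by
  have hr := h.rank_eq_one
  let i₀ : Fin (Units.rank K) := ⟨0, by omega⟩
  have huniq : ∀ i : Fin (Units.rank K), i = i₀ := fun i => by
    ext; simp only [i₀]; omega
  have hprod : ∀ f : Fin (Units.rank K) → ℤ,
      ∏ i, Units.fundSystem K i ^ f i = Units.fundSystem K i₀ ^ f i₀ := fun f =>
    Fintype.prod_eq_single i₀ fun i hi => absurd (huniq i) hi
  set ε := Units.fundSystem K i₀
  have hgen : ∀ u : (𝓞 K)ˣ, ∃ n : ℤ, u = ε ^ n ∨ u = -ε ^ n := by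
    intro u
    obtain ⟨⟨ζ, f⟩, hf, -⟩ := Units.exist_unique_eq_mul_prod K u
    simp only [hprod] at hf
    refine ⟨f i₀, ?_⟩
    rcases h.torsion_eq ζ.2 with h1 | h1
    · left; rw [hf, h1, one_mul]
    · right; rw [hf, h1, neg_one_mul]
  have htors : ∀ n : ℤ, ε ^ n ∈ Units.torsion K → n = 0 := by
    intro n hn
    have hu := (Units.exist_unique_eq_mul_prod K (ε ^ n)).unique
      (y₁ := ⟨⟨ε ^ n, hn⟩, 0⟩) (y₂ := ⟨1, fun _ => n⟩)
      (by simp) (by simp only [hprod]; simp)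
    have := congrFun (congrArg Prod.snd hu) i₀
    simpa using this.symm
  have hneg : (-1 : (𝓞 K)ˣ) ∈ Units.torsion K := by
    rw [Units.mem_torsion]
    intro v
    rw [← InfinitePlace.norm_embedding_eq]
    simp
  refine ⟨ε, fun η => ?_, fun u => ?_⟩
  · obtain ⟨n, hn⟩ := hgen η
    have hsq : η ^ 2 = ε ^ (2 * n) := by
      rcases hn with rfl | rfl
      · rw [← zpow_natCast, ← zpow_mul, mul_comm]; rfl
      · rw [neg_sq, ← zpow_natCast, ← zpow_mul, mul_comm]; rfl
    have hkey : ε ^ (1 - 2 * n) ∉ Units.torsion K := fun hc => by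
      have := htors _ hc
      omega
    constructor
    · intro he
      apply hkey
      rw [zpow_sub, zpow_one, ← hsq, ← he, mul_inv_cancel]
      exact one_mem _
    · intro he
      apply hkey
      rw [zpow_sub, zpow_one, ← hsq, ← neg_eq_iff_eq_neg.mpr he, inv_neg, mul_neg, mul_inv_cancel]
      exact hneg
  · obtain ⟨n, hn⟩ := hgen u
    obtain ⟨k, hk | hk⟩ := Int.even_or_odd' n
    · refine ⟨ε ^ k, ?_⟩
      have : (ε ^ k) ^ 2 = ε ^ n := by
        rw [hk, ← zpow_natCast, ← zpow_mul, mul_comm]; rfl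
      rw [this]
      tauto
    · refine ⟨ε ^ k, ?_⟩
      have : ε * (ε ^ k) ^ 2 = ε ^ n := by
        rw [hk, zpow_add, zpow_one, ← zpow_natCast, ← zpow_mul, mul_comm, mul_comm k]; rfl
      rw [this]
      tauto

end IsQuadraticRoot

namespace Ideal

theorem span_intCast_natAbs {R : Type*} [CommRing R] [IsDomain R] (T : ℤ) :
    span {(T : R)} = span {((T.natAbs : ℕ) : R)} := by
  rw [span_singleton_eq_span_singleton]
  have := (Int.associated_natAbs T).map (Int.castRingHom R)
  simpa using this

variable {R : Type*} [CommRing R] [IsDedekindDomain R]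

theorem eq_of_sq_eq_sq {I J : Ideal R} (h : I ^ 2 = J ^ 2) : I = J :=
  dvd_antisymm ((UniqueFactorizationMonoid.pow_dvd_pow_iff_dvd two_ne_zero).mp h.dvd)
    ((UniqueFactorizationMonoid.pow_dvd_pow_iff_dvd two_ne_zero).mp h.symm.dvd)

theorem isPrincipal_of_mul_span_singleton_eq {J : Ideal R} {b c : R} (hb : b ≠ 0)
    (h : span {b} * J = span {c}) : J.IsPrincipal := by
  have hc : c ∈ span {b} := by
    refine (mul_le_left : span {b} * J ≤ span {b}) ?_
    rw [h]
    exact mem_span_singleton_self c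
  obtain ⟨e, rfl⟩ := mem_span_singleton.mp hc
  rw [← span_singleton_mul_span_singleton, span_singleton_mul_right_inj hb] at h
  exact ⟨e, h⟩

theorem isPrincipal_of_sq_mul_eq {J : Ideal R} {b c : R} (hb : b ≠ 0)
    (h : span {b} ^ 2 * J ^ 2 = span {c} ^ 2) : J.IsPrincipal :=
  isPrincipal_of_mul_span_singleton_eq hb (eq_of_sq_eq_sq (by rw [mul_pow, h]))

/-- If `m ^ 2 = x * y` and `x, m, y` generate the unit ideal, then `(x, m) ^ 2 = (x)`. -/
theorem span_pair_sq_eq {R : Type*} [CommRing R] {x m y u v t : R} (hm : m ^ 2 = x * y)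
    (h1 : u * x + v * m + t * y = 1) : span {x, m} ^ 2 = span {x} := by
  rw [pow_two]
  apply le_antisymm
  · rw [mul_le]
    intro r hr s hs
    obtain ⟨a, b, rfl⟩ := mem_span_pair.mp hr
    obtain ⟨a', b', rfl⟩ := mem_span_pair.mp hs
    rw [mem_span_singleton]
    exact ⟨a * a' * x + a * b' * m + a' * b * m + b * b' * y, by linear_combination b * b' * hm⟩
  · rw [span_singleton_le_iff_mem]
    have hx : x ∈ span {x, m} := subset_span (by simp)
    have hm' : m ∈ span {x, m} := subset_span (by simp)
    have hx2 : u * (x * x) + v * (x * m) + t * (m * m) = x := by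
      linear_combination x * h1 + t * hm
    have : u * (x * x) + v * (x * m) + t * (m * m) ∈ span {x, m} * span {x, m} := add_mem (add_mem (mul_mem_left _ _ (mul_mem_mul hx hx))
      (mul_mem_left _ _ (mul_mem_mul hx hm'))) (mul_mem_left _ _ (mul_mem_mul hm' hm'))
    rwa [hx2] at this

end Ideal

namespace NumberField

variable {K : Type*} [Field K] [NumberField K]

theorem odd_classNumber_iff : Odd (classNumber K) ↔
    ∀ (I : Ideal (𝓞 K)) (a : 𝓞 K), a ≠ 0 → I ^ 2 = Ideal.span {a} → I.IsPrincipal := by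
  have mem_of_ne {I : Ideal (𝓞 K)} (hI : I ≠ 0) : I ∈ nonZeroDivisors (Ideal (𝓞 K)) :=
    mem_nonZeroDivisors_of_ne_zero hI
  have ne_of_sq {I : Ideal (𝓞 K)} {a : 𝓞 K} (ha : a ≠ 0) (h : I ^ 2 = Ideal.span {a}) :
      I ≠ 0 := by
    rintro rfl
    rw [zero_pow two_ne_zero] at h
    exact ha (Ideal.span_singleton_eq_bot.mp h.symm)
  constructor
  · intro hodd I a ha h
    have hI := mem_of_ne (ne_of_sq ha h)
    rw [← ClassGroup.mk0_eq_one_iff hI]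
    have h2 : ClassGroup.mk0 ⟨I, hI⟩ ^ 2 = 1 := by
      rw [← map_pow]
      exact (ClassGroup.mk0_eq_one_iff (pow_mem hI 2)).mpr ⟨a, h⟩
    rw [← orderOf_eq_one_iff]
    have h3 := orderOf_dvd_of_pow_eq_one h2
    have h4 : orderOf (ClassGroup.mk0 ⟨I, hI⟩) ∣ classNumber K := orderOf_dvd_card
    have h5 : Nat.Coprime (classNumber K) 2 := hodd.coprime_two_right
    exact Nat.eq_one_of_dvd_coprimes h5 h4 h3
  · intro H
    by_contra hodd
    rw [Nat.not_odd_iff_even, even_iff_two_dvd] at hodd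
    have : Fact (Nat.Prime 2) := ⟨Nat.prime_two⟩
    obtain ⟨c, hc⟩ := exists_prime_orderOf_dvd_card (G := ClassGroup (𝓞 K)) 2 hodd
    obtain ⟨⟨I, hI⟩, rfl⟩ := ClassGroup.mk0_surjective c
    have h2 : ClassGroup.mk0 ⟨I, hI⟩ ^ 2 = 1 := by rw [← hc, pow_orderOf_eq_one]
    rw [← map_pow] at h2
    obtain ⟨a, ha⟩ := ((ClassGroup.mk0_eq_one_iff (pow_mem hI 2)).mp h2).principal
    have h1 : I.IsPrincipal := by
      refine H I a ?_ ha
      rintro rfl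
      rw [Submodule.span_zero_singleton] at ha
      exact nonZeroDivisors.ne_zero (pow_mem hI 2) ha
    rw [← ClassGroup.mk0_eq_one_iff hI] at h1
    rw [h1, orderOf_one] at hc
    omega

/-- In odd class number, a generator of the square of an ideal is a unit times a square. -/
theorem exists_eq_sq_mul_unit_of_odd (hodd : Odd (classNumber K)) {x m y u v t : 𝓞 K}
    (hx : x ≠ 0) (hm : m ^ 2 = x * y) (h1 : u * x + v * m + t * y = 1) :
    ∃ (c : 𝓞 K) (ε : (𝓞 K)ˣ), x = c ^ 2 * ε := by
  have hsq := Ideal.span_pair_sq_eq hm h1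
  obtain ⟨c, hc⟩ := (odd_classNumber_iff.mp hodd _ x hx hsq).principal
  have hc' : Ideal.span {x, m} = Ideal.span {c} := hc
  rw [hc', Ideal.span_singleton_pow, Ideal.span_singleton_eq_span_singleton] at hsq
  obtain ⟨ε, hε⟩ := hsq
  exact ⟨c, ε, hε.symm⟩

end NumberField

namespace IsQuadraticRoot

variable {K : Type*} [Field K] [NumberField K] {d : ℕ} {w : 𝓞 K}

theorem norm_intCast (h : IsQuadraticRoot d w) (n : ℤ) : Algebra.norm ℤ (n : 𝓞 K) = n ^ 2 := by
  have := h.norm_eq (x := (n : 𝓞 K)) (a := 2 * n) (b := 0) (by push_cast; ring)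
  linarith

theorem intCast_dvd_iff (h : IsQuadraticRoot d w) {m n : ℤ} :
    (m : 𝓞 K) ∣ (n : 𝓞 K) ↔ m ∣ n := by
  refine ⟨fun ⟨z, hz⟩ => ?_, fun hmn => by simpa using map_dvd (Int.castRingHom (𝓞 K)) hmn⟩
  have h1 := congrArg (Algebra.norm ℤ) hz
  rw [map_mul, h.norm_intCast, h.norm_intCast] at h1
  exact (Int.pow_dvd_pow_iff two_ne_zero).mp ⟨_, h1⟩

/-- If a rational integer generates the square of an ideal, then its squarefree part is
supported at the ramified primes. -/
theorem exists_natAbs_eq_of_sq_eq_span (h : IsQuadraticRoot d w) {J : Ideal (𝓞 K)} {T : ℤ}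
    (hT : T ≠ 0) (hJ : J ^ 2 = Ideal.span {(T : 𝓞 K)}) :
    ∃ m r : ℕ, m ≠ 0 ∧ T.natAbs = m ^ 2 * r ∧ Squarefree r ∧
      ∀ p, p.Prime → p ∣ r → p ∣ quadDisc d := by
  obtain ⟨r, m, hmr, hr⟩ := Nat.sq_mul_squarefree T.natAbs
  have hm0 : m ≠ 0 := by
    rintro rfl
    apply hT
    simpa using hmr.symm
  refine ⟨m, r, hm0, hmr.symm, hr, fun p hp hpr => ?_⟩
  by_contra hpD
  have hm0' : Ideal.span {(m : 𝓞 K)} ≠ 0 := by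
    rw [Ne, Ideal.zero_eq_bot, Ideal.span_singleton_eq_bot]
    exact_mod_cast hm0
  rw [Ideal.span_intCast_natAbs, ← hmr] at hJ
  push_cast at hJ
  rw [← Ideal.span_singleton_mul_span_singleton, ← Ideal.span_singleton_pow] at hJ
  obtain ⟨J', rfl⟩ := (UniqueFactorizationMonoid.pow_dvd_pow_iff_dvd two_ne_zero).mp (Dvd.intro _ hJ.symm)
  rw [mul_pow] at hJ
  have hJ' := mul_left_cancel₀ (pow_ne_zero 2 hm0') hJ
  have hle : J' ≤ Ideal.span {(p : 𝓞 K)} := by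
    intro x hx
    rw [Ideal.mem_span_singleton]
    apply h.dvd_of_dvd_sq hp hpD
    have hx2 : x ^ 2 ∈ Ideal.span {(r : 𝓞 K)} := hJ' ▸ Ideal.pow_mem_pow hx 2
    refine dvd_trans ?_ (Ideal.mem_span_singleton.mp hx2)
    exact_mod_cast h.intCast_dvd_iff.mpr (Int.natCast_dvd_natCast.mpr hpr)
  have hle2 := Ideal.pow_right_mono hle 2
  rw [hJ', Ideal.span_singleton_pow, Ideal.span_singleton_le_span_singleton] at hle2
  have : ((p ^ 2 : ℕ) : ℤ) ∣ r := by
    apply h.intCast_dvd_iff.mp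
    push_cast
    exact hle2
  have h2 : p * p ∣ r := by
    rw [← pow_two]; exact_mod_cast this
  exact hp.one_lt.ne' (Nat.isUnit_iff.mp (hr p h2))

theorem norm_unit {K : Type*} [Field K] (ε : (𝓞 K)ˣ) :
    Algebra.norm ℤ (ε : 𝓞 K) = 1 ∨ Algebra.norm ℤ (ε : 𝓞 K) = -1 :=
  Int.isUnit_iff.mp (ε.isUnit.map (Algebra.norm ℤ))

theorem not_sq_eq_of_fundamental {ε : (𝓞 K)ˣ} (hε : ∀ η : (𝓞 K)ˣ, ε ≠ η ^ 2 ∧ ε ≠ -η ^ 2)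
    {c : 𝓞 K} {n : ℕ} (hn : n ≠ 0) :
    ¬ (c ^ 2 = ε * (n : 𝓞 K) ^ 2 ∨ c ^ 2 = -(ε * (n : 𝓞 K) ^ 2)) := by
  intro h
  have hn' : (n : 𝓞 K) ^ 2 ≠ 0 := pow_ne_zero 2 (by exact_mod_cast hn)
  have hdvd : (n : 𝓞 K) ∣ c := by
    rw [← IsIntegrallyClosed.pow_dvd_pow_iff two_ne_zero]
    rcases h with h | h
    · exact ⟨ε, by rw [h, mul_comm]⟩
    · exact ⟨-ε, by rw [h]; ring⟩
  obtain ⟨e, rfl⟩ := hdvd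
  have he : e ^ 2 = ε ∨ e ^ 2 = -ε := by
    rcases h with h | h
    · left; apply mul_left_cancel₀ hn'; linear_combination h
    · right; apply mul_left_cancel₀ hn'; linear_combination h
  have heu : IsUnit e := by
    rw [← isUnit_pow_iff two_ne_zero]
    rcases he with he | he
    · rw [he]; exact ε.isUnit
    · rw [he]; exact ε.isUnit.neg
  obtain ⟨η, rfl⟩ := heu
  rcases he with he | he
  · exact (hε η).1 (Units.ext (by simpa using he.symm))
  · exact (hε η).2 (Units.ext (by push_cast; rw [he, neg_neg]))

/-- A fundamental unit of norm `1` yields a nontrivial relation between ramified primes. -/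
theorem exists_relation_of_norm_eq_one (h : IsQuadraticRoot d w) {ε : (𝓞 K)ˣ}
    (hε : ∀ η : (𝓞 K)ˣ, ε ≠ η ^ 2 ∧ ε ≠ -η ^ 2) (hN : Algebra.norm ℤ (ε : 𝓞 K) = 1) :
    ∃ (b : 𝓞 K) (m r : ℕ), b ≠ 0 ∧ m ≠ 0 ∧ Squarefree r ∧
      (∀ p, p.Prime → p ∣ r → p ∣ quadDisc d) ∧
      (b ^ 2 = ε * ((m : 𝓞 K) ^ 2 * r) ∨ b ^ 2 = -(ε * ((m : 𝓞 K) ^ 2 * r))) ∧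
      ¬ (IsSquare r ∨ IsSquare (d * r)) := by
  obtain ⟨A, B, hAB, -⟩ := h.exists_two_mul_eq (ε : 𝓞 K)
  have hch := h.sq_eq_of_two_mul_eq hAB
  rw [hN] at hch
  push_cast at hch
  have hb0 : 1 + (ε : 𝓞 K) ≠ 0 := by
    intro h0
    apply (hε 1).2
    ext
    push_cast
    have : (ε : 𝓞 K) = -1 := by linear_combination h0
    simp [this]
  have hb2 : (1 + (ε : 𝓞 K)) ^ 2 = ε * ((A + 2 : ℤ) : 𝓞 K) := by
    push_cast; linear_combination hch
  have hT : A + 2 ≠ 0 := by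
    intro h0
    rw [h0, Int.cast_zero, mul_zero] at hb2
    exact hb0 (pow_eq_zero_iff two_ne_zero |>.mp hb2)
  have hJ : Ideal.span {1 + (ε : 𝓞 K)} ^ 2 = Ideal.span {((A + 2 : ℤ) : 𝓞 K)} := by
    rw [Ideal.span_singleton_pow, hb2, Ideal.span_singleton_mul_left_unit ε.isUnit]
  obtain ⟨m, r, hm, hmr, hr, hsupp⟩ := h.exists_natAbs_eq_of_sq_eq_span hT hJ
  have hrel : (1 + (ε : 𝓞 K)) ^ 2 = ε * ((m : 𝓞 K) ^ 2 * r) ∨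
      (1 + (ε : 𝓞 K)) ^ 2 = -(ε * ((m : 𝓞 K) ^ 2 * r)) := by
    rw [hb2]
    have hc : (m : 𝓞 K) ^ 2 * r = (((A + 2).natAbs : ℤ) : 𝓞 K) := by
      rw [hmr]; push_cast; ring
    rw [hc]
    rcases Int.natAbs_eq (A + 2) with h1 | h1
    · left; rw [← h1]
    · right; rw [h1]; push_cast; simp
  refine ⟨_, m, r, hb0, hm, hr, hsupp, hrel, ?_⟩
  have hr0 := hr.ne_zero
  rintro (⟨k, hk⟩ | ⟨k, hk⟩)
  · have hk0 : k ≠ 0 := by rintro rfl; exact hr0 hk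
    refine not_sq_eq_of_fundamental hε (c := 1 + (ε : 𝓞 K)) (mul_ne_zero hm hk0) ?_
    have hk' : (r : 𝓞 K) = k * k := by exact_mod_cast congrArg (Nat.cast : ℕ → 𝓞 K) hk
    rw [hk'] at hrel
    push_cast
    rwa [show ((m : 𝓞 K) * k) ^ 2 = (m : 𝓞 K) ^ 2 * (k * k) by ring]
  · have hk0 : k ≠ 0 := by
      rintro rfl
      have := h.one_lt
      rcases Nat.mul_eq_zero.mp hk with h1 | h1
      · omega
      · exact hr0 h1
    refine not_sq_eq_of_fundamental hε (c := (1 + (ε : 𝓞 K)) * w) (mul_ne_zero hm hk0) ?_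
    have hk' : (d : 𝓞 K) * r = k * k := by exact_mod_cast congrArg (Nat.cast : ℕ → 𝓞 K) hk
    push_cast
    rw [mul_pow, mul_pow, h.sq_eq, pow_two (k : 𝓞 K), ← hk']
    rcases hrel with h1 | h1
    · left; rw [h1]; ring
    · right; rw [h1]; ring

/-- Criterion for the class number to be odd in terms of squarefree integers supported at the
ramified primes. -/
theorem odd_classNumber_of_relations (h : IsQuadraticRoot d w)
    (hnorm : ∀ (a : 𝓞 K) (n : ℤ), n ≠ 0 → Algebra.norm ℤ a = -n ^ 2 →
      ∃ u : (𝓞 K)ˣ, Algebra.norm ℤ (u : 𝓞 K) = -1)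
    (hrel : ∀ r : ℕ, Squarefree r → (∀ p, p.Prime → p ∣ r → p ∣ quadDisc d) →
      ∃ b c : 𝓞 K, b ≠ 0 ∧ Associated (r * b ^ 2) (c ^ 2)) :
    Odd (classNumber K) := by
  have hint : ∀ (J : Ideal (𝓞 K)) (T : ℤ), T ≠ 0 → J ^ 2 = Ideal.span {(T : 𝓞 K)} →
      J.IsPrincipal := by
    intro J T hT hJ
    obtain ⟨m, r, hm, hmr, hr, hsupp⟩ := h.exists_natAbs_eq_of_sq_eq_span hT hJ
    obtain ⟨b, c, hb, hbc⟩ := hrel r hr hsupp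
    refine Ideal.isPrincipal_of_sq_mul_eq (c := m * c) hb ?_
    rw [hJ, Ideal.span_intCast_natAbs, hmr, Ideal.span_singleton_pow, Ideal.span_singleton_pow,
      Ideal.span_singleton_mul_span_singleton, Ideal.span_singleton_eq_span_singleton]
    have := hbc.mul_left ((m : 𝓞 K) ^ 2)
    push_cast
    convert this using 1 <;> ring
  have hpos : ∀ (I : Ideal (𝓞 K)) (a : 𝓞 K) (n : ℤ), n ≠ 0 → Algebra.norm ℤ a = n ^ 2 →
      I ^ 2 = Ideal.span {a} → I.IsPrincipal := by
    intro I a n hn hN hI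
    by_cases hb : a + n = 0
    · refine hint I (-n) (neg_ne_zero.mpr hn) ?_
      rw [hI, show a = ((-n : ℤ) : 𝓞 K) by push_cast; linear_combination hb]
    · obtain ⟨A, B, hAB, -⟩ := h.exists_two_mul_eq a
      have hch := h.sq_eq_of_two_mul_eq hAB
      rw [hN] at hch
      push_cast at hch
      have hb2 : (a + n) ^ 2 = a * ((A + 2 * n : ℤ) : 𝓞 K) := by
        push_cast; linear_combination hch
      have hT : A + 2 * n ≠ 0 := by
        intro h0
        rw [h0, Int.cast_zero, mul_zero] at hb2
        exact hb (pow_eq_zero_iff two_ne_zero |>.mp hb2)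
      have hsq : Ideal.span {a + (n : 𝓞 K)} ^ 2
          = I ^ 2 * Ideal.span {((A + 2 * n : ℤ) : 𝓞 K)} := by
        rw [hI, Ideal.span_singleton_pow, hb2, Ideal.span_singleton_mul_span_singleton]
      obtain ⟨J, hJ⟩ := (UniqueFactorizationMonoid.pow_dvd_pow_iff_dvd two_ne_zero).mp
        (Dvd.intro _ hsq.symm)
      have hI0 : I ^ 2 ≠ 0 := by
        rw [hI, Ne, Ideal.zero_eq_bot, Ideal.span_singleton_eq_bot]
        rintro rfl
        rw [Algebra.norm_zero] at hN
        exact hn (pow_eq_zero_iff two_ne_zero |>.mp hN.symm)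
      have hJ2 : J ^ 2 = Ideal.span {((A + 2 * n : ℤ) : 𝓞 K)} := by
        rw [hJ, mul_pow] at hsq
        exact mul_left_cancel₀ hI0 hsq
      obtain ⟨j, hj⟩ := (hint J _ hT hJ2).principal
      have hj' : J = Ideal.span {j} := hj
      have hj0 : j ≠ 0 := by
        rintro rfl
        rw [hj', mul_comm, Ideal.span_singleton_zero, Ideal.bot_mul] at hJ
        exact hb (Ideal.span_singleton_eq_bot.mp hJ)
      exact Ideal.isPrincipal_of_mul_span_singleton_eq (c := a + n) hj0
        (by rw [hJ, hj', mul_comm])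
  rw [odd_classNumber_iff]
  intro I a ha hI
  have habs : Ideal.absNorm I ^ 2 = (Algebra.norm ℤ a).natAbs := by
    rw [← map_pow, hI, Ideal.absNorm_span_singleton]
  obtain ⟨n, hn_def⟩ : ∃ n : ℤ, n = (Ideal.absNorm I : ℤ) := ⟨_, rfl⟩
  have hn : n ≠ 0 := by
    intro h0
    have : Ideal.absNorm I = 0 := by exact_mod_cast hn_def.symm.trans h0
    rw [this, zero_pow two_ne_zero] at habs
    exact ha (Algebra.norm_eq_zero_iff.mp (Int.natAbs_eq_zero.mp habs.symm))
  have hcast : ((Algebra.norm ℤ a).natAbs : ℤ) = n ^ 2 := by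
    rw [← habs, hn_def]; push_cast; rfl
  rcases Int.natAbs_eq (Algebra.norm ℤ a) with h1 | h1
  · exact hpos I a n hn (by rw [h1, hcast]) hI
  · rw [hcast] at h1
    obtain ⟨u, hu⟩ := hnorm a n hn h1
    refine hpos I (u * a) n hn (by rw [map_mul, hu, h1]; ring) ?_
    rw [Ideal.span_singleton_mul_left_unit u.isUnit, hI]

theorem exists_associated_of_isSquare (h : IsQuadraticRoot d w) {r : ℕ}
    (hr : IsSquare r ∨ IsSquare (d * r)) :
    ∃ b c : 𝓞 K, b ≠ 0 ∧ Associated (r * b ^ 2) (c ^ 2) := by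
  rcases hr with ⟨k, hk⟩ | ⟨k, hk⟩
  · refine ⟨1, k, one_ne_zero, ?_⟩
    rw [hk]
    push_cast
    rw [one_pow, mul_one, pow_two]
  · refine ⟨w, k, h.ne_zero, ?_⟩
    have hk' : (d : 𝓞 K) * r = k * k := by exact_mod_cast congrArg (Nat.cast : ℕ → 𝓞 K) hk
    rw [h.sq_eq, mul_comm, hk', pow_two]

/-- If all squarefree integers supported at the ramified primes become squares, then the class
number is odd. -/
theorem odd_classNumber_of_forall_isSquare (h : IsQuadraticRoot d w)
    (hsq : ∀ r : ℕ, Squarefree r → (∀ p, p.Prime → p ∣ r → p ∣ quadDisc d) →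
      IsSquare r ∨ IsSquare (d * r)) : Odd (classNumber K) := by
  obtain ⟨ε, hε, -⟩ := h.exists_fundamental_unit
  have hN : Algebra.norm ℤ (ε : 𝓞 K) = -1 := by
    refine (norm_unit ε).resolve_left fun hN => ?_
    obtain ⟨b, m, r, -, -, hr, hsupp, -, hns⟩ := h.exists_relation_of_norm_eq_one hε hN
    exact hns (hsq r hr hsupp)
  exact h.odd_classNumber_of_relations (fun _ _ _ _ => ⟨ε, hN⟩)
    fun r hr hsupp => h.exists_associated_of_isSquare (hsq r hr hsupp)

theorem odd_classNumber_of_norm_ne (h : IsQuadraticRoot d w)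
    (hnorm : ∀ (a : 𝓞 K) (n : ℤ), n ≠ 0 → Algebra.norm ℤ a ≠ -n ^ 2)
    (hsq : ∀ r s : ℕ, Squarefree r → (∀ p, p.Prime → p ∣ r → p ∣ quadDisc d) →
      Squarefree s → (∀ p, p.Prime → p ∣ s → p ∣ quadDisc d) →
      (IsSquare r ∨ IsSquare (d * r)) ∨ (IsSquare s ∨ IsSquare (d * s)) ∨
        (IsSquare (r * s) ∨ IsSquare (d * (r * s)))) : Odd (classNumber K) := by
  obtain ⟨ε, hε, -⟩ := h.exists_fundamental_unit
  have hN : Algebra.norm ℤ (ε : 𝓞 K) = 1 :=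
    (norm_unit ε).resolve_right fun hN => hnorm ε 1 one_ne_zero (by rw [hN]; norm_num)
  obtain ⟨b₀, m, s, hb₀, hm, hs, hsupp', hrel, hns⟩ := h.exists_relation_of_norm_eq_one hε hN
  refine h.odd_classNumber_of_relations (fun a n hn ha => absurd ha (hnorm a n hn))
    fun r hr hsupp => ?_
  rcases hsq r s hr hsupp hs hsupp' with h1 | h1 | h1
  · exact h.exists_associated_of_isSquare h1
  · exact absurd h1 hns
  · obtain ⟨b, c, hb, hbc⟩ := h.exists_associated_of_isSquare h1
    refine ⟨b₀ * b, m * c, mul_ne_zero hb₀ hb, ?_⟩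
    have h2 : Associated (r * (b₀ * b) ^ 2) ((m : 𝓞 K) ^ 2 * (((r * s : ℕ) : 𝓞 K) * b ^ 2)) := by
      rcases hrel with h3 | h3
      · refine ⟨ε⁻¹, ?_⟩
        rw [Units.mul_inv_eq_iff_eq_mul, mul_pow, h3]
        push_cast
        ring
      · refine ⟨-ε⁻¹, ?_⟩
        rw [Units.val_neg, mul_neg, ← neg_mul, Units.mul_inv_eq_iff_eq_mul, mul_pow, h3]
        push_cast
        ring
    rw [mul_pow (m : 𝓞 K) c]
    exact h2.trans (hbc.mul_left _)

end IsQuadraticRoot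

theorem Squarefree.exists_eq_pow_mul_pow {r p q : ℕ} (hr : Squarefree r) (hpq : p ≠ q)
    (h : ∀ l : ℕ, l.Prime → l ∣ r → l = p ∨ l = q) :
    ∃ a b : ℕ, a ≤ 1 ∧ b ≤ 1 ∧ r = p ^ a * q ^ b := by
  refine ⟨r.factorization p, r.factorization q, hr.natFactorization_le_one p,
    hr.natFactorization_le_one q, ?_⟩
  have hsub : r.factorization.support ⊆ {p, q} := by
    intro l hl
    rw [Nat.support_factorization, Nat.mem_primeFactors] at hl
    simpa using h l hl.1 hl.2.1
  have h1 := Nat.prod_factorization_pow_eq_self hr.ne_zero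
  rw [Finsupp.prod_of_support_subset _ hsub _ (by simp), Finset.prod_pair hpq] at h1
  exact h1.symm

theorem isSquare_pow_mul_pow {p q i j : ℕ} (hi : i % 2 = 0) (hj : j % 2 = 0) :
    IsSquare (p ^ i * q ^ j) :=
  ((Nat.even_iff.mpr hi).isSquare_pow p).mul ((Nat.even_iff.mpr hj).isSquare_pow q)

theorem dvd_quadDisc {d : ℕ} : d ∣ quadDisc d := by
  unfold quadDisc
  split_ifs
  · exact dvd_rfl
  · exact Nat.dvd_mul_left _ _

theorem eq_prime_of_card_eq_one {d : ℕ} (hd : 1 < d) (hsf : Squarefree d)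
    (h : (quadDisc d).primeFactors.card = 1) :
    d.Prime ∧ ∀ p, p.Prime → p ∣ quadDisc d → p = d := by
  have hD : quadDisc d ≠ 0 := by unfold quadDisc; split_ifs <;> omega
  obtain ⟨p, hp⟩ := Finset.card_eq_one.mp h
  have hall : ∀ l : ℕ, l.Prime → l ∣ quadDisc d → l = p := fun l hl hld => by
    simpa [hp] using Nat.mem_primeFactors.mpr ⟨hl, hld, hD⟩
  obtain ⟨l, hl, hld⟩ := Nat.exists_prime_and_dvd hd.ne'
  have hlp := hall l hl (hld.trans dvd_quadDisc)
  have hpr : p.Prime := hlp ▸ hl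
  obtain ⟨a, b, ha, hb, hab⟩ := hsf.exists_eq_pow_mul_pow (p := p) (q := 1) hpr.one_lt.ne'
    fun l hl hld => Or.inl (hall l hl (hld.trans dvd_quadDisc))
  have hdp : d = p := by
    interval_cases a <;> simp_all
  subst hdp
  exact ⟨hpr, hall⟩

theorem exists_prime_of_eq_four_mul {d : ℕ} {q k : ℕ} (hq : q.Prime)
    (hq3 : q % 4 = 3) (hk : k = 4 ∨ k = 8) (h : quadDisc d = k * q) :
    ∃ p q : ℕ, p ≠ q ∧ q.Prime ∧ q % 4 = 3 ∧ q ∣ d ∧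
      ∀ l : ℕ, l.Prime → l ∣ quadDisc d → l = p ∨ l = q := by
  refine ⟨2, q, by omega, hq, hq3, ?_, ?_⟩
  · unfold quadDisc at h
    split_ifs at h
    · rw [h]; exact Nat.dvd_mul_left _ _
    · rcases hk with rfl | rfl
      · exact ⟨1, by omega⟩
      · exact ⟨2, by omega⟩
  · intro l hl hld
    have : l ∣ 2 ^ 3 * q := by
      rcases hk with rfl | rfl
      · exact (h ▸ hld).trans ⟨2, by ring⟩
      · exact h ▸ hld
    rcases hl.dvd_mul.mp this with h1 | h1
    · exact Or.inl ((Nat.prime_dvd_prime_iff_eq hl Nat.prime_two).mp (hl.dvd_of_dvd_pow h1))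
    · exact Or.inr ((Nat.prime_dvd_prime_iff_eq hl hq).mp h1)

theorem not_squarefree_of_quadDisc_eq {d k : ℕ} (hk : k = 4 ∨ k = 8) {l : ℕ}
    (hl : l = 4 ∨ l = 8) (h : quadDisc d = k * l) : ¬ Squarefree d := by
  intro hsf
  have h4 : ¬ 2 * 2 ∣ d := fun h2 => by simpa using hsf 2 h2
  unfold quadDisc at h
  rcases hk with rfl | rfl <;> rcases hl with rfl | rfl <;> split_ifs at h <;> omega

theorem exists_prime_of_negPrimeDiscriminant {d : ℕ} (hsf : Squarefree d) {d₁ d₂ : ℤ}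
    (h₁ : IsNegPrimeDiscriminant d₁) (h₂ : IsNegPrimeDiscriminant d₂)
    (h : (quadDisc d : ℤ) = d₁ * d₂) :
    ∃ p q : ℕ, p ≠ q ∧ q.Prime ∧ q % 4 = 3 ∧ q ∣ d ∧
      ∀ l : ℕ, l.Prime → l ∣ quadDisc d → l = p ∨ l = q := by
  have key : ∀ x : ℤ, IsNegPrimeDiscriminant x →
      ∃ k : ℕ, x = -(k : ℤ) ∧ ((k = 4 ∨ k = 8) ∨ (k.Prime ∧ k % 4 = 3)) := by
    rintro x (rfl | rfl | ⟨q, hq, hq3, rfl⟩)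
    · exact ⟨4, by norm_num, by simp⟩
    · exact ⟨8, by norm_num, by simp⟩
    · exact ⟨q, rfl, Or.inr ⟨hq, hq3⟩⟩
  obtain ⟨k, rfl, hk⟩ := key d₁ h₁
  obtain ⟨l, rfl, hl⟩ := key d₂ h₂
  rw [neg_mul_neg] at h
  have hD : quadDisc d = k * l := by exact_mod_cast h
  rcases hk with hk | ⟨hk, hk3⟩ <;> rcases hl with hl | ⟨hl, hl3⟩
  · exact absurd hsf (not_squarefree_of_quadDisc_eq hk hl hD)
  · exact exists_prime_of_eq_four_mul hl hl3 hk hD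
  · exact exists_prime_of_eq_four_mul hk hk3 hl (hD.trans (mul_comm _ _))
  · have hmod : k * l % 4 = 1 := by simp [Nat.mul_mod, hk3, hl3]
    have hdkl : d = k * l := by
      unfold quadDisc at hD
      split_ifs at hD <;> omega
    refine ⟨k, l, ?_, hl, hl3, hdkl ▸ Nat.dvd_mul_left _ _, ?_⟩
    · rintro rfl
      exact hk.one_lt.ne' (Nat.isUnit_iff.mp (hsf k ⟨1, by rw [hdkl, mul_one]⟩))
    · intro p hp hpD
      rw [hD] at hpD
      exact (hp.dvd_mul.mp hpD).imp (Nat.prime_dvd_prime_iff_eq hp hk).mp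
        (Nat.prime_dvd_prime_iff_eq hp hl).mp

namespace IsQuadraticRoot

variable {K : Type*} [Field K] [NumberField K] {d : ℕ} {w : 𝓞 K}

theorem norm_ne_neg_sq (h : IsQuadraticRoot d w) {q : ℕ} (hq : q.Prime) (hq3 : q % 4 = 3)
    (hqd : q ∣ d) (a : 𝓞 K) (n : ℤ) (hn : n ≠ 0) : Algebra.norm ℤ a ≠ -n ^ 2 := by
  intro hN
  have : Fact q.Prime := ⟨hq⟩
  obtain ⟨A, B, -, hAB⟩ := h.exists_two_mul_eq a
  rw [hN] at hAB
  have hd0 : d ≠ 0 := h.squarefree.ne_zero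
  have hB : B ≠ 0 := by
    rintro rfl
    have : 0 < n ^ 2 := by positivity
    nlinarith [sq_nonneg A]
  have hsum : d * B.natAbs ^ 2 = A.natAbs ^ 2 + (2 * n).natAbs ^ 2 := by
    zify
    simp only [sq_abs]
    linear_combination -hAB
  have hB' : B.natAbs ^ 2 ≠ 0 := pow_ne_zero 2 (Int.natAbs_ne_zero.mpr hB)
  have hev := Nat.eq_sq_add_sq_iff.mp ⟨_, _, hsum⟩ (q := q)
    (Nat.mem_primeFactors.mpr ⟨hq, hqd.mul_right _, mul_ne_zero hd0 hB'⟩) hq3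
  have h1 : padicValNat q d = 1 := by
    have h2 := h.squarefree.natFactorization_le_one q
    have h3 := hq.factorization_pos_of_dvd hd0 hqd
    rw [← Nat.factorization_def d hq]
    omega
  rw [padicValNat.mul hd0 hB', padicValNat.pow, h1,
    Nat.even_iff] at hev
  omega

theorem odd_classNumber_of_card_eq_one (h : IsQuadraticRoot d w)
    (hcard : (quadDisc d).primeFactors.card = 1) : Odd (classNumber K) := by
  obtain ⟨hp, hall⟩ := eq_prime_of_card_eq_one h.one_lt h.squarefree hcard
  refine h.odd_classNumber_of_forall_isSquare fun r hr hsupp => ?_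
  obtain ⟨a, b, ha, hb, hab⟩ := hr.exists_eq_pow_mul_pow (p := d) (q := 1) hp.one_lt.ne'
    fun l hl hlr => Or.inl (hall l hl (hsupp l hl hlr))
  interval_cases a
  · left; rw [hab]; exact ⟨1, by simp⟩
  · right; rw [hab]; exact ⟨d, by simp⟩

theorem odd_classNumber_of_negPrimeDiscriminant (h : IsQuadraticRoot d w) {d₁ d₂ : ℤ}
    (h₁ : IsNegPrimeDiscriminant d₁) (h₂ : IsNegPrimeDiscriminant d₂)
    (hD : (quadDisc d : ℤ) = d₁ * d₂) : Odd (classNumber K) := by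
  obtain ⟨p, q, hpq, hq, hq3, hqd, hall⟩ :=
    exists_prime_of_negPrimeDiscriminant h.squarefree h₁ h₂ hD
  refine h.odd_classNumber_of_norm_ne (fun a n hn => h.norm_ne_neg_sq hq hq3 hqd a n hn)
    fun r s hr hrs hs hss => ?_
  obtain ⟨a, b, ha, hb, hab⟩ := hr.exists_eq_pow_mul_pow hpq
    fun l hl hlr => hall l hl (hrs l hl hlr)
  obtain ⟨a', b', ha', hb', hab'⟩ := hs.exists_eq_pow_mul_pow hpq
    fun l hl hlr => hall l hl (hss l hl hlr)
  obtain ⟨e, f, he, hf, hef⟩ := h.squarefree.exists_eq_pow_mul_pow hpq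
    fun l hl hlr => hall l hl (hlr.trans dvd_quadDisc)
  have hne : e + f ≠ 0 := by
    intro h0
    have := h.one_lt
    obtain ⟨rfl, rfl⟩ : e = 0 ∧ f = 0 := by omega
    simp at hef
    omega
  have hmul : ∀ i j k l : ℕ, p ^ i * q ^ j * (p ^ k * q ^ l) = p ^ (i + k) * q ^ (j + l) :=
    fun i j k l => by ring
  rw [hab, hab', hef]
  simp only [hmul]
  by_contra hcon
  simp only [not_or] at hcon
  obtain ⟨⟨c1, c2⟩, ⟨c3, c4⟩, c5, c6⟩ := hcon
  have key : ∀ i j : ℕ, ¬ IsSquare (p ^ i * q ^ j) → ¬ (i % 2 = 0 ∧ j % 2 = 0) :=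
    fun i j hij hc => hij (isSquare_pow_mul_pow hc.1 hc.2)
  have k1 := key _ _ c1
  have k2 := key _ _ c2
  have k3 := key _ _ c3
  have k4 := key _ _ c4
  have k5 := key _ _ c5
  have k6 := key _ _ c6
  omega

theorem exists_eq_sq_mul_unit_of_dvd (h : IsQuadraticRoot d w) (hodd : Odd (classNumber K))
    {p : ℕ} (hp : p.Prime) (hpD : p ∣ quadDisc d) :
    ∃ (c : 𝓞 K) (ε : (𝓞 K)ˣ), (p : 𝓞 K) = c ^ 2 * ε := by
  have hp0 : (p : 𝓞 K) ≠ 0 := by exact_mod_cast hp.ne_zero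
  by_cases hpd : p ∣ d
  · obtain ⟨e, rfl⟩ := hpd
    have hcop : IsCoprime (p : ℤ) e :=
      Nat.isCoprime_iff_coprime.mpr (Nat.coprime_of_squarefree_mul h.squarefree)
    obtain ⟨u, v, huv⟩ := hcop
    refine exists_eq_sq_mul_unit_of_odd hodd (m := w) (y := e) (u := u) (v := 0) (t := v) hp0
      (by rw [h.sq_eq]; push_cast; rfl) ?_
    rw [zero_mul, add_zero]
    exact_mod_cast congrArg (Int.cast : ℤ → 𝓞 K) huv
  · have hD : quadDisc d = 4 * d ∧ d % 4 ≠ 1 := by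
      unfold quadDisc at hpD ⊢
      split_ifs at hpD ⊢ with h1
      · exact absurd hpD hpd
      · exact ⟨rfl, h1⟩
    have hp2 : p = 2 := by
      rw [hD.1] at hpD
      have h4 := (hp.dvd_mul.mp hpD).resolve_right hpd
      exact (Nat.prime_dvd_prime_iff_eq hp Nat.prime_two).mp
        (hp.dvd_of_dvd_pow (n := 2) (by simpa using h4))
    subst hp2
    obtain ⟨k, hk⟩ : ∃ k, d = 4 * k + 3 := ⟨d / 4, by omega⟩
    refine exists_eq_sq_mul_unit_of_odd hodd (m := 1 + w) (y := 2 * k + 2 + w) (u := k + 1)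
      (v := 1) (t := -1) hp0 ?_ (by push_cast; ring)
    have := h.sq_eq
    rw [hk] at this
    push_cast at this ⊢
    linear_combination this

theorem isSquare_or_of_sq_eq_natCast (h : IsQuadraticRoot d w) {x : 𝓞 K} {n : ℕ} (hn : n ≠ 0)
    (hx : (n : 𝓞 K) = x ^ 2 ∨ (n : 𝓞 K) = -x ^ 2) : IsSquare n ∨ IsSquare (d * n) := by
  have hn' : 0 < n := Nat.pos_of_ne_zero hn
  have hd' : 0 < d := by have := h.one_lt; omega
  rcases hx with hx | hx
  · rcases h.isSquare_or_of_sq_eq (x := x) (n := n) (by rw [← hx]; simp) with h1 | h1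
    · left; exact_mod_cast h1
    · right; exact_mod_cast h1
  · exfalso
    have hdn : 0 < (d : ℤ) * n := by positivity
    rcases h.isSquare_or_of_sq_eq (x := x) (n := -n)
      (by push_cast; linear_combination hx) with h1 | h1
    · have := h1.nonneg
      omega
    · have := h1.nonneg
      rw [mul_neg] at this
      omega

theorem eq_fundamental_mul_sq (h : IsQuadraticRoot d w) (hodd : Odd (classNumber K))
    {ε : (𝓞 K)ˣ} (hε : ∀ u : (𝓞 K)ˣ, ∃ η : (𝓞 K)ˣ,
        u = η ^ 2 ∨ u = -η ^ 2 ∨ u = ε * η ^ 2 ∨ u = -(ε * η ^ 2))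
    {p : ℕ} (hp : p.Prime) (hpD : p ∣ quadDisc d) (hpd : p ≠ d) :
    ∃ c : 𝓞 K, (p : 𝓞 K) = ε * c ^ 2 ∨ (p : 𝓞 K) = -(ε * c ^ 2) := by
  obtain ⟨c, u, hc⟩ := h.exists_eq_sq_mul_unit_of_dvd hodd hp hpD
  obtain ⟨η, hη⟩ := hε u
  have hns : ¬ ((p : 𝓞 K) = (c * η) ^ 2 ∨ (p : 𝓞 K) = -(c * η) ^ 2) := by
    intro hcon
    rcases h.isSquare_or_of_sq_eq_natCast hp.ne_zero hcon with h1 | h1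
    · exact hp.prime.not_isSquare h1
    · exact hpd (Squarefree.eq_of_isSquare_mul h.squarefree hp.prime.squarefree h1).symm
  refine ⟨c * η, ?_⟩
  rcases hη with rfl | rfl | rfl | rfl
  · exact absurd (Or.inl (by rw [hc]; push_cast; ring)) hns
  · exact absurd (Or.inr (by rw [hc]; push_cast; ring)) hns
  · left; rw [hc]; push_cast; ring
  · right; rw [hc]; push_cast; ring

theorem mul_eq_of_odd_classNumber (h : IsQuadraticRoot d w) (hodd : Odd (classNumber K))
    {p q : ℕ} (hp : p.Prime) (hq : q.Prime) (hpD : p ∣ quadDisc d) (hqD : q ∣ quadDisc d)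
    (hpq : p ≠ q) (hpd : p ≠ d) (hqd : q ≠ d) : p * q = d := by
  obtain ⟨ε, -, hε⟩ := h.exists_fundamental_unit
  obtain ⟨c, hc⟩ := h.eq_fundamental_mul_sq hodd hε hp hpD hpd
  obtain ⟨e, he⟩ := h.eq_fundamental_mul_sq hodd hε hq hqD hqd
  have hsq : ((p * q : ℕ) : 𝓞 K) = (ε * c * e) ^ 2 ∨ ((p * q : ℕ) : 𝓞 K) = -(ε * c * e) ^ 2 := by
    push_cast
    rcases hc with hc | hc <;> rcases he with he | he <;> rw [hc, he]
    · left; ring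
    · right; ring
    · right; ring
    · left; ring
  have hsf : Squarefree (p * q) := (Nat.squarefree_mul ((Nat.coprime_primes hp hq).mpr hpq)).mpr
    ⟨hp.prime.squarefree, hq.prime.squarefree⟩
  rcases h.isSquare_or_of_sq_eq_natCast (mul_ne_zero hp.ne_zero hq.ne_zero) hsq with h1 | h1
  · exact absurd (Squarefree.eq_of_isSquare_mul hp.prime.squarefree hq.prime.squarefree h1) hpq
  · exact (Squarefree.eq_of_isSquare_mul h.squarefree hsf h1).symm

theorem norm_unit_eq_one_of_odd (h : IsQuadraticRoot d w) (hodd : Odd (classNumber K))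
    {p : ℕ} (hp : p.Prime) (hpD : p ∣ quadDisc d) (hpd : p ≠ d) (u : (𝓞 K)ˣ) :
    Algebra.norm ℤ (u : 𝓞 K) = 1 := by
  obtain ⟨ε, -, hε⟩ := h.exists_fundamental_unit
  obtain ⟨c, hc⟩ := h.eq_fundamental_mul_sq hodd hε hp hpD hpd
  have hneg : Algebra.norm ℤ (-1 : 𝓞 K) = 1 := by simpa using h.norm_intCast (-1)
  have hneg' : ∀ x : 𝓞 K, Algebra.norm ℤ (-x) = Algebra.norm ℤ x := fun x => by
    rw [← neg_one_mul, map_mul, hneg, one_mul]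
  have hεN : Algebra.norm ℤ (ε : 𝓞 K) = 1 := by
    refine (norm_unit ε).resolve_right fun hN => ?_
    have h1 : (p : ℤ) ^ 2 = -(Algebra.norm ℤ c) ^ 2 := by
      have h2 := h.norm_intCast (p : ℤ)
      rw [Int.cast_natCast] at h2
      rw [← h2]
      rcases hc with hc | hc
      · rw [hc, map_mul, map_pow, hN]; ring
      · rw [hc, hneg', map_mul, map_pow, hN]; ring
    have : (0 : ℤ) < p := by exact_mod_cast hp.pos
    nlinarith [sq_nonneg (Algebra.norm ℤ c)]
  obtain ⟨η, hη⟩ := hε u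
  have hη2 : Algebra.norm ℤ (η : 𝓞 K) ^ 2 = 1 := by
    rcases norm_unit η with h1 | h1 <;> rw [h1] <;> norm_num
  rcases hη with rfl | rfl | rfl | rfl <;> simp [hneg', hη2, hεN]

theorem exists_norm_unit_eq_neg_one_of_coprime (h : IsQuadraticRoot d w)
    (hodd : Odd (classNumber K)) {a b : ℤ} (hab : (d : ℤ) = a ^ 2 + b ^ 2)
    (hcop : IsCoprime (2 * a) b) :
    ∃ u : (𝓞 K)ˣ, Algebra.norm ℤ (u : 𝓞 K) = -1 := by
  have hb : b ≠ 0 := by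
    rintro rfl
    apply h.not_isSquare
    refine ⟨a.natAbs, ?_⟩
    zify
    rw [abs_mul_abs_self, hab]
    ring
  have hN : Algebra.norm ℤ (w + a) = -b ^ 2 := by
    have := h.norm_eq (x := w + a) (a := 2 * a) (b := 2) (by push_cast; ring)
    rw [hab] at this
    linarith
  have hx : w + (a : 𝓞 K) ≠ 0 := by
    intro h0
    rw [h0, Algebra.norm_zero] at hN
    exact hb (pow_eq_zero_iff two_ne_zero |>.mp (neg_eq_zero.mp hN.symm))
  obtain ⟨s, v, hsv⟩ := hcop
  have hd : (d : 𝓞 K) = a ^ 2 + b ^ 2 := by exact_mod_cast congrArg (Int.cast : ℤ → 𝓞 K) hab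
  obtain ⟨c, u, hc⟩ := exists_eq_sq_mul_unit_of_odd hodd (m := (b : 𝓞 K)) (y := w - a)
    (u := s) (v := v) (t := -s) hx (by linear_combination -hd - h.sq_eq) (by
      have : (s : 𝓞 K) * (2 * a) + v * b = 1 := by
        exact_mod_cast congrArg (Int.cast : ℤ → 𝓞 K) hsv
      linear_combination this)
  refine ⟨u, (norm_unit u).resolve_left fun hu => ?_⟩
  rw [hc, map_mul, map_pow, hu] at hN
  have : 0 < b ^ 2 := by positivity
  nlinarith [sq_nonneg (Algebra.norm ℤ c)]

theorem exists_norm_unit_eq_neg_one (h : IsQuadraticRoot d w) (hodd : Odd (classNumber K))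
    (hd : ∀ q : ℕ, q.Prime → q ∣ d → q % 4 ≠ 3) :
    ∃ u : (𝓞 K)ˣ, Algebra.norm ℤ (u : 𝓞 K) = -1 := by
  obtain ⟨a, b, hab⟩ := Nat.eq_sq_add_sq_iff.mpr fun {q} hq hq3 =>
    absurd hq3 (hd q (Nat.prime_of_mem_primeFactors hq) (Nat.dvd_of_mem_primeFactors hq))
  have hcop : a.Coprime b := by
    refine Nat.coprime_of_dvd fun l hl hla hlb => ?_
    have hdvd : l * l ∣ d := by
      rw [hab, ← pow_two]
      exact (pow_dvd_pow_of_dvd hla 2).add (pow_dvd_pow_of_dvd hlb 2)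
    exact hl.one_lt.ne' (Nat.isUnit_iff.mp (h.squarefree l hdvd))
  have key : ∀ x y : ℕ, d = x ^ 2 + y ^ 2 → x.Coprime y → Odd y →
      ∃ u : (𝓞 K)ˣ, Algebra.norm ℤ (u : 𝓞 K) = -1 := by
    intro x y hxy hc hy
    refine h.exists_norm_unit_eq_neg_one_of_coprime hodd (a := x) (b := y)
      (by exact_mod_cast hxy) ?_
    have : (2 * x).Coprime y := Nat.Coprime.mul_left hy.coprime_two_left hc
    exact_mod_cast Nat.isCoprime_iff_coprime.mpr this
  rcases Nat.even_or_odd b with hb | hb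
  · refine key b a (by rw [hab, add_comm]) hcop.symm ?_
    rw [← Nat.not_even_iff_odd]
    intro ha
    have := Nat.dvd_gcd ha.two_dvd hb.two_dvd
    rw [hcop] at this
    omega
  · exact key a b hab hcop hb

theorem exists_negPrimeDiscriminant_of_prime_three_mod_four (h : IsQuadraticRoot d w)
    (hodd : Odd (classNumber K)) {p q : ℕ} (hp : p.Prime) (hq : q.Prime)
    (hd : p * q = d) (hp3 : p % 4 = 3) :
    ∃ d₁ d₂ : ℤ, d₁ < 0 ∧ d₂ < 0 ∧ IsNegPrimeDiscriminant d₁ ∧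
      IsNegPrimeDiscriminant d₂ ∧ (quadDisc d : ℤ) = d₁ * d₂ := by
  have hmod : d % 4 = 3 * (q % 4) % 4 := by rw [← hd, Nat.mul_mod, hp3]
  have hp0 : (0 : ℤ) < p := by exact_mod_cast hp.pos
  have hq0 : (0 : ℤ) < q := by exact_mod_cast hq.pos
  rcases hq.eq_two_or_odd with rfl | hq2
  · refine ⟨-8, -p, by norm_num, by omega, Or.inr (Or.inl rfl),
      Or.inr (Or.inr ⟨p, hp, hp3, rfl⟩), ?_⟩
    rw [quadDisc, if_neg (by omega), ← hd]
    push_cast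
    ring
  · have hq3 : q % 4 = 3 := by
      by_contra hq3
      have hD : quadDisc d = 4 * d := by rw [quadDisc, if_neg (by omega)]
      have hpD : p ∣ quadDisc d := (Dvd.intro _ hd).trans dvd_quadDisc
      have hpd : p ≠ d := by
        intro hpd
        have h1 : p * q = p * 1 := by rw [hd, mul_one, hpd]
        exact hq.one_lt.ne' (Nat.eq_of_mul_eq_mul_left hp.pos h1)
      have := h.mul_eq_of_odd_classNumber hodd Nat.prime_two hp
        (hD ▸ ⟨2 * d, by ring⟩) hpD (by omega) (by omega) hpd
      omega
    refine ⟨-p, -q, by omega, by omega, Or.inr (Or.inr ⟨p, hp, hp3, rfl⟩),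
      Or.inr (Or.inr ⟨q, hq, hq3, rfl⟩), ?_⟩
    rw [quadDisc, if_pos (by omega), ← hd]
    push_cast
    ring

theorem exists_negPrimeDiscriminant_of_odd (h : IsQuadraticRoot d w)
    (hodd : Odd (classNumber K)) (hcard : (quadDisc d).primeFactors.card ≠ 1) :
    ∃ d₁ d₂ : ℤ, d₁ < 0 ∧ d₂ < 0 ∧ IsNegPrimeDiscriminant d₁ ∧
      IsNegPrimeDiscriminant d₂ ∧ (quadDisc d : ℤ) = d₁ * d₂ := by
  have hd1 := h.one_lt
  have hD1 : 1 < quadDisc d := by unfold quadDisc; split_ifs <;> omega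
  have hpos : 0 < (quadDisc d).primeFactors.card :=
    Finset.card_pos.mpr (Nat.nonempty_primeFactors.mpr hD1)
  obtain ⟨p, hp, q, hq, hpq⟩ := Finset.one_lt_card.mp
    (show 1 < (quadDisc d).primeFactors.card by omega)
  have key : ∀ p q : ℕ, p ∈ (quadDisc d).primeFactors → q ∈ (quadDisc d).primeFactors →
      p ≠ q → p = d →
      ∃ d₁ d₂ : ℤ, d₁ < 0 ∧ d₂ < 0 ∧ IsNegPrimeDiscriminant d₁ ∧
        IsNegPrimeDiscriminant d₂ ∧ (quadDisc d : ℤ) = d₁ * d₂ := by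
    rintro p q hp hq hpq rfl
    rw [Nat.mem_primeFactors] at hp hq
    obtain ⟨hp, -⟩ := hp
    obtain ⟨hq, hqD, -⟩ := hq
    have hqp : ¬ q ∣ p := fun hdvd => hpq ((Nat.prime_dvd_prime_iff_eq hq hp).mp hdvd).symm
    have hp1 : p % 4 ≠ 1 := by
      intro hp1
      rw [quadDisc, if_pos hp1] at hqD
      exact hqp hqD
    rw [quadDisc, if_neg hp1] at hqD ⊢
    have h4 := (hq.dvd_mul.mp hqD).resolve_right hqp
    have hq2 : q = 2 := (Nat.prime_dvd_prime_iff_eq hq Nat.prime_two).mp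
      (hq.dvd_of_dvd_pow (n := 2) (by simpa using h4))
    have hp2 := hp.eq_two_or_odd
    refine ⟨-4, -p, by norm_num, by omega, Or.inl rfl,
      Or.inr (Or.inr ⟨p, hp, by omega, rfl⟩), ?_⟩
    push_cast
    ring
  by_cases hpd : p = d
  · exact key p q hp hq hpq hpd
  by_cases hqd : q = d
  · exact key q p hq hp hpq.symm hqd
  rw [Nat.mem_primeFactors] at hp hq
  have hd := h.mul_eq_of_odd_classNumber hodd hp.1 hq.1 hp.2.1 hq.2.1 hpq hpd hqd
  by_cases hp3 : p % 4 = 3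
  · exact h.exists_negPrimeDiscriminant_of_prime_three_mod_four hodd hp.1 hq.1 hd hp3
  by_cases hq3 : q % 4 = 3
  · exact h.exists_negPrimeDiscriminant_of_prime_three_mod_four hodd hq.1 hp.1
      ((mul_comm _ _).trans hd) hq3
  obtain ⟨u, hu⟩ := h.exists_norm_unit_eq_neg_one hodd fun l hl hld => by
    rw [← hd] at hld
    rcases hl.dvd_mul.mp hld with h1 | h1
    · rwa [(Nat.prime_dvd_prime_iff_eq hl hp.1).mp h1]
    · rwa [(Nat.prime_dvd_prime_iff_eq hl hq.1).mp h1]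
  have := h.norm_unit_eq_one_of_odd hodd hp.1 hp.2.1 hpd u
  omega

end IsQuadraticRoot

/-- The class number `h_d` of `K_d = ℚ(√d)` is odd if and only if either `n_d = 1` or the
discriminant `D` of `K_d` factors as `D = d₁ · d₂` with `d₁, d₂` negative prime
discriminants. -/
theorem stmt_8 (d : ℕ) (hd1 : 1 < d) (hdsf : Squarefree d)
    (K : Type*) [Field K] [NumberField K] (α : K)
    (hα : α ^ 2 = (d : K)) (hdeg : Module.finrank ℚ K = 2) :
    Odd (classNumber K) ↔
      (quadDisc d).primeFactors.card = 1 ∨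
        ∃ d₁ d₂ : ℤ, d₁ < 0 ∧ d₂ < 0 ∧ IsNegPrimeDiscriminant d₁ ∧
          IsNegPrimeDiscriminant d₂ ∧ (quadDisc d : ℤ) = d₁ * d₂ := by
  have hint : IsIntegral ℤ α := by
    refine IsIntegral.of_pow (n := 2) two_pos ?_
    rw [hα]
    simpa using isIntegral_algebraMap (R := ℤ) (A := K) (x := (d : ℤ))
  obtain ⟨w, hw⟩ : ∃ w : 𝓞 K, (w : K) = α := ⟨⟨α, hint⟩, rfl⟩
  have hw2 : w ^ 2 = (d : 𝓞 K) := RingOfIntegers.ext (by simpa [hw] using hα)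
  have h : IsQuadraticRoot d w := ⟨hd1, hdsf, hw2, hdeg⟩
  constructor
  · intro hodd
    exact or_iff_not_imp_left.mpr (h.exists_negPrimeDiscriminant_of_odd hodd)
  · rintro (hcard | ⟨d₁, d₂, -, -, h₁, h₂, hD⟩)
    · exact h.odd_classNumber_of_card_eq_one hcard
    · exact h.odd_classNumber_of_negPrimeDiscriminant h₁ h₂ hD
end

section
/- Let d > 1 be a squarefree integer with n_d = t ramified primes, and set s = t − 1 if d is a sum of two squares of integers, and s = t − 2 otherwise. Then the quotient of the ideal class group C_d of K_d = ℚ(√d) by its subgroup of squares is isomorphic to (ℤ/2ℤ)^s; in particular, this quotient C_d/C_d² has exactly 2^s elements. -/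
open NumberField

namespace RealQuadratic

open scoped nonZeroDivisors

/-- The subgroup of squares of a commutative group. -/
abbrev squares (G : Type*) [CommGroup G] : Subgroup G := (powMonoidHom 2 : G →* G).range

theorem mem_squares {G : Type*} [CommGroup G] {x : G} : x ∈ squares G ↔ ∃ y, y ^ 2 = x := Iff.rfl

theorem index_squares_eq_card_ker (G : Type*) [CommGroup G] [Finite G] :
    (squares G).index = Nat.card (powMonoidHom 2 : G →* G).ker := by
  have h1 := Subgroup.index_mul_card (squares G)
  have h2 := Subgroup.index_mul_card (powMonoidHom 2 : G →* G).ker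
  rw [Subgroup.index_ker, mul_comm] at h2
  exact Nat.eq_of_mul_eq_mul_right Nat.card_pos (h1.trans h2.symm)

/-- An elementary abelian `2`-group is determined by its order. -/
theorem nonempty_mulEquiv_of_card_eq_two_pow (G : Type*) [CommGroup G] (h : ∀ g : G, g ^ 2 = 1)
    (s : ℕ) (hs : Nat.card G = 2 ^ s) : Nonempty (G ≃* (Fin s → Multiplicative (ZMod 2))) := by
  have : Finite G := Nat.finite_of_card_ne_zero (by rw [hs]; positivity)
  let _ : Module (ZMod 2) (Additive G) := AddCommGroup.zmodModule fun x => h x.toMul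
  have hr : Module.finrank (ZMod 2) (Additive G) = s := by
    have h2 := Module.natCard_eq_pow_finrank (K := ZMod 2) (V := Additive G)
    rw [Nat.card_zmod] at h2
    exact Nat.pow_right_injective le_rfl (h2.symm.trans hs)
  let e : Additive G ≃ₗ[ZMod 2] (Fin s → ZMod 2) := LinearEquiv.ofFinrankEq _ _ (by simp [hr])
  exact ⟨{ toFun := fun g i => .ofAdd (e (.ofMul g) i)
           invFun := fun f => (e.symm fun i => (f i).toAdd).toMul
           left_inv := fun g => by simp
           right_inv := fun f => by ext; simp
           map_mul' := fun a b => by ext; simp }⟩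

section Dedekind

variable (R K : Type*) [CommRing R] [IsDedekindDomain R] [Field K] [Algebra R K]
  [IsFractionRing R K]

/-- The elements of `Kˣ` whose principal fractional ideal is a square. -/
def idealSquares : Subgroup Kˣ :=
  (squares (FractionalIdeal R⁰ K)ˣ).comap (toPrincipalIdeal R K)

variable {R K}

theorem mem_idealSquares {x : Kˣ} : x ∈ idealSquares R K ↔
    ∃ J : FractionalIdeal R⁰ K, J * J = FractionalIdeal.spanSingleton R⁰ (x : K) := by
  rw [idealSquares, Subgroup.mem_comap, mem_squares]
  constructor
  · rintro ⟨y, hy⟩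
    refine ⟨y, ?_⟩
    rw [← coe_toPrincipalIdeal, ← hy, pow_two, Units.val_mul]
  · rintro ⟨J, hJ⟩
    have : J ≠ 0 := by
      rintro rfl
      exact x.ne_zero (FractionalIdeal.spanSingleton_eq_zero_iff.1 (by rw [← hJ, zero_mul]))
    refine ⟨Units.mk0 J this, ?_⟩
    ext1
    rw [coe_toPrincipalIdeal, ← hJ, pow_two, Units.val_mul, Units.val_mk0]

theorem squares_le_idealSquares : squares Kˣ ≤ idealSquares R K := by
  rintro _ ⟨y, rfl⟩
  exact ⟨toPrincipalIdeal R K y, (map_pow (toPrincipalIdeal R K) y 2).symm⟩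

theorem le_one_of_mul_self_le_one {J : FractionalIdeal R⁰ K} (h : J * J ≤ 1) : J ≤ 1 := by
  intro y hy
  obtain ⟨z, hz⟩ := (FractionalIdeal.mem_one_iff R⁰).1 (h (FractionalIdeal.mul_mem_mul hy hy))
  obtain ⟨w, hw⟩ := (IsIntegrallyClosed.isIntegral_iff (R := R)).1
    (IsIntegral.of_pow (R := R) (x := y) two_pos (by
      rw [pow_two, ← hz]; exact isIntegral_algebraMap))
  exact (FractionalIdeal.mem_one_iff R⁰).2 ⟨w, hw⟩

theorem injective_sq_units_fractionalIdeal :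
    Function.Injective (powMonoidHom 2 : (FractionalIdeal R⁰ K)ˣ →* (FractionalIdeal R⁰ K)ˣ) := by
  rw [injective_iff_map_eq_one]
  have key : ∀ J : (FractionalIdeal R⁰ K)ˣ, J ^ 2 = 1 → (J : FractionalIdeal R⁰ K) ≤ 1 :=
    fun J hJ => le_one_of_mul_self_le_one (by rw [← Units.val_mul, ← pow_two, hJ, Units.val_one])
  intro J hJ
  rw [powMonoidHom_apply] at hJ
  have h1 := key J hJ
  have h2 := key J⁻¹ (by rw [inv_pow, hJ, inv_one])
  ext1
  refine le_antisymm h1 ?_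
  calc ((1 : (FractionalIdeal R⁰ K)ˣ) : FractionalIdeal R⁰ K)
    _ = J * (J⁻¹ : (FractionalIdeal R⁰ K)ˣ) := by
        rw [← Units.val_mul, mul_inv_cancel]
    _ ≤ J * 1 := mul_le_mul_right h2 _
    _ = J := mul_one _

theorem ker_toPrincipalIdeal :
    (toPrincipalIdeal R K).ker = (Units.map (algebraMap R K : R →* K)).range := by
  ext x
  rw [MonoidHom.mem_ker, toPrincipalIdeal_eq_iff, Units.val_one]
  constructor
  · intro h
    have h' : FractionalIdeal.spanSingleton R⁰ ((x⁻¹ : Kˣ) : K) = 1 := by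
      have := FractionalIdeal.spanSingleton_mul_spanSingleton (S := R⁰) (x : K) ((x⁻¹ : Kˣ) : K)
      rwa [h, one_mul, ← Units.val_mul, mul_inv_cancel, Units.val_one,
        FractionalIdeal.spanSingleton_one] at this
    have mem : ∀ y : K, FractionalIdeal.spanSingleton R⁰ y = 1 → ∃ z, algebraMap R K z = y := by
      intro y hy
      rw [← FractionalIdeal.mem_one_iff R⁰, ← hy]
      exact FractionalIdeal.mem_spanSingleton_self _ _
    obtain ⟨a, ha⟩ := mem _ h
    obtain ⟨b, hb⟩ := mem _ h'
    have hab : a * b = 1 := by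
      apply IsFractionRing.injective R K
      rw [map_mul, ha, hb, map_one, ← Units.val_mul, mul_inv_cancel, Units.val_one]
    exact ⟨⟨a, b, hab, mul_comm a b ▸ hab⟩, Units.ext ha⟩
  · rintro ⟨u, rfl⟩
    apply le_antisymm
    · rw [FractionalIdeal.spanSingleton_le_iff_mem]
      exact (FractionalIdeal.mem_one_iff R⁰).2 ⟨u, rfl⟩
    · rw [FractionalIdeal.one_le]
      refine (FractionalIdeal.mem_spanSingleton _).2 ⟨(u⁻¹ : Rˣ), ?_⟩
      rw [Algebra.smul_def]
      simp

theorem comap_squares_units :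
    (squares Kˣ).comap (Units.map (algebraMap R K : R →* K)) = squares Rˣ := by
  ext u
  constructor
  · rintro ⟨y, hy⟩
    have hy' : y ∈ (toPrincipalIdeal R K).ker := by
      rw [MonoidHom.mem_ker]
      apply injective_sq_units_fractionalIdeal
      rw [map_one, powMonoidHom_apply, ← map_pow]
      have : (Units.map (algebraMap R K : R →* K)) u ∈ (toPrincipalIdeal R K).ker := by
        rw [ker_toPrincipalIdeal]; exact ⟨u, rfl⟩
      rw [← hy] at this
      exact this
    rw [ker_toPrincipalIdeal] at hy'
    obtain ⟨v, rfl⟩ := hy'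
    refine ⟨v, ?_⟩
    apply Units.map_injective
      (IsFractionRing.injective R K : Function.Injective (algebraMap R K : R →* K))
    rw [powMonoidHom_apply, map_pow]
    exact hy
  · rintro ⟨v, rfl⟩
    exact ⟨Units.map (algebraMap R K : R →* K) v, by simp⟩

theorem relIndex_range_toPrincipalIdeal :
    (toPrincipalIdeal R K).range.relIndex ((toPrincipalIdeal R K).range.comap (powMonoidHom 2)) =
      Nat.card (powMonoidHom 2 : ClassGroup R →* ClassGroup R).ker := by
  let q : (FractionalIdeal R⁰ K)ˣ →* ClassGroup R :=
    (ClassGroup.equiv (R := R) K).symm.toMonoidHom.comp (QuotientGroup.mk' _)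
  have hq : Function.Surjective q :=
    (ClassGroup.equiv (R := R) K).symm.surjective.comp (QuotientGroup.mk'_surjective _)
  have hk : q.ker = (toPrincipalIdeal R K).range := by
    ext x
    simp [q]
  have h2 : (toPrincipalIdeal R K).range.comap (powMonoidHom 2) =
      (powMonoidHom 2 : ClassGroup R →* ClassGroup R).ker.comap q := by
    ext x
    rw [← hk]
    simp [MonoidHom.mem_ker]
  rw [h2, ← hk, Subgroup.relIndex_ker, Subgroup.map_comap_eq_self_of_surjective hq]

theorem relIndex_squares_idealSquares [Finite (ClassGroup R)] :
    (squares Kˣ).relIndex (idealSquares R K) =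
      (squares Rˣ).index * (squares (ClassGroup R)).index := by
  have hle : squares Kˣ ⊔ (toPrincipalIdeal R K).ker ≤ idealSquares R K :=
    sup_le squares_le_idealSquares fun x hx => by
      rw [idealSquares, Subgroup.mem_comap, (MonoidHom.mem_ker).1 hx]
      exact one_mem _
  rw [← Subgroup.relIndex_mul_relIndex _ _ _ le_sup_left hle]
  congr 1
  · rw [Subgroup.relIndex_sup_left, ker_toPrincipalIdeal, MonoidHom.range_eq_map,
      ← Subgroup.relIndex_comap, comap_squares_units, Subgroup.relIndex_top_right]
  · rw [index_squares_eq_card_ker, ← relIndex_range_toPrincipalIdeal (K := K),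
      ← Subgroup.relIndex_map_map_of_injective _ _
        (injective_sq_units_fractionalIdeal (R := R) (K := K))]
    have h1 : (toPrincipalIdeal R K).range.map (powMonoidHom 2) =
        (squares Kˣ).map (toPrincipalIdeal R K) := by
      rw [MonoidHom.range_eq_map, squares, MonoidHom.range_eq_map, Subgroup.map_map,
        Subgroup.map_map]
      congr 1
      ext1 x
      simp
    have h2 : ((toPrincipalIdeal R K).range.comap (powMonoidHom 2)).map (powMonoidHom 2) =
        (idealSquares R K).map (toPrincipalIdeal R K) := by
      rw [Subgroup.map_comap_eq, idealSquares, Subgroup.map_comap_eq, inf_comm]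
    rw [h1, h2, Subgroup.relIndex_map_map,
      sup_eq_left.2 (le_sup_right.trans hle)]

end Dedekind

section Units

open NumberField.Units NumberField.InfinitePlace

variable {K : Type*} [Field K] [NumberField K] [IsTotallyReal K]

theorem torsion_eq_one_or_neg_one {x : (𝓞 K)ˣ} (hx : x ∈ torsion K) : x = 1 ∨ x = -1 := by
  by_cases! hc : 2 < orderOf x
  · have hx' : IsPrimitiveRoot (x : K) (orderOf x) :=
      (IsPrimitiveRoot.orderOf x).map_of_injective
        (f := (algebraMap (𝓞 K) K : 𝓞 K →* K).comp (Units.coeHom (𝓞 K))) (coe_injective K)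
    have h1 := IsPrimitiveRoot.nrRealPlaces_eq_zero_of_two_lt hc hx'
    have h2 := IsTotallyReal.finrank K
    have h3 := Module.finrank_pos (R := ℚ) (M := K)
    omega
  · interval_cases hi : orderOf x
    · exact absurd hi ((orderOf_pos_iff.2 ((CommGroup.mem_torsion x).1 hx)).ne')
    · exact Or.inl (orderOf_eq_one_iff.1 hi)
    · rw [← orderOf_units, CharP.orderOf_eq_two_iff 0 (by decide)] at hi
      exact Or.inr (Units.ext hi)

theorem not_isSquare_neg_one_of_isTotallyReal (y : K) : y ^ 2 ≠ -1 := by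
  intro h
  obtain ⟨w⟩ := (inferInstance : Nonempty (InfinitePlace K))
  have h1 : (embedding_of_isReal (IsTotallyReal.isReal w) y) ^ 2 = -1 := by
    rw [← map_pow, h, map_neg, map_one]
  nlinarith [sq_nonneg (embedding_of_isReal (IsTotallyReal.isReal w) y)]

theorem index_squares_units (hdeg : Module.finrank ℚ K = 2) : (squares (𝓞 K)ˣ).index = 4 := by
  have hr : rank K = 1 := by
    have h1 := IsTotallyReal.finrank K
    have h2 := card_eq_nrRealPlaces_add_nrComplexPlaces K
    have h3 := nrComplexPlaces_eq_zero_iff.2 (inferInstance : IsTotallyReal K)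
    rw [rank]
    omega
  let i₀ : Fin (rank K) := ⟨0, by omega⟩
  have : Unique (Fin (rank K)) := ⟨⟨i₀⟩, fun a => Fin.ext (by simp [i₀]; omega)⟩
  let ε := fundSystem K i₀
  have hprod : ∀ f : Fin (rank K) → ℤ, ∏ i, fundSystem K i ^ f i = ε ^ f i₀ := by
    intro f
    rw [Fintype.prod_unique, Subsingleton.elim default i₀]
  have hex : ∀ x : (𝓞 K)ˣ, ∃ ζ ∈ torsion K, ∃ k : ℤ, x = ζ * ε ^ k := by
    intro x
    obtain ⟨c, hc, -⟩ := exist_unique_eq_mul_prod K x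
    exact ⟨c.1, c.1.2, c.2 i₀, by rw [hc, hprod]⟩
  have huniq : ∀ ζ ∈ torsion K, ∀ ζ' ∈ torsion K, ∀ k k' : ℤ, ζ * ε ^ k = ζ' * ε ^ k' → k = k' := by
    intro ζ h ζ' h' k k' e
    have h1 := (exist_unique_eq_mul_prod K (ζ * ε ^ k)).unique (y₁ := (⟨ζ, h⟩, fun _ => k))
      (y₂ := (⟨ζ', h'⟩, fun _ => k')) (by simp only [hprod]) (by simp only [hprod, e])
    exact congrFun (congrArg Prod.snd h1) i₀
  have heven : ∀ ζ ∈ torsion K, ∀ k : ℤ,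
      ζ * ε ^ k ∈ squares (𝓞 K)ˣ ⊔ torsion K ↔ Even k := by
    intro ζ hζ k
    constructor
    · intro h
      obtain ⟨_, ⟨y, rfl⟩, ζ', hζ', h⟩ := Subgroup.mem_sup.1 h
      obtain ⟨ζ'', hζ'', j, rfl⟩ := hex y
      have := huniq (ζ'' ^ 2 * ζ') (mul_mem (pow_mem hζ'' 2) hζ') ζ hζ (j + j) k (by
        rw [← h, powMonoidHom_apply, mul_pow, zpow_add, ← pow_two, mul_right_comm])
      exact ⟨j, this.symm⟩
    · rintro ⟨j, rfl⟩
      rw [mul_comm]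
      refine Subgroup.mul_mem_sup ⟨ε ^ j, ?_⟩ hζ
      rw [powMonoidHom_apply, zpow_add, pow_two]
  have h1 : (squares (𝓞 K)ˣ ⊔ torsion K).index = 2 := by
    rw [Subgroup.index_eq_two_iff]
    refine ⟨ε, fun b => ?_⟩
    obtain ⟨ζ, hζ, k, rfl⟩ := hex b
    rw [mul_assoc, ← zpow_add_one, heven ζ hζ, heven ζ hζ, Int.even_add_one, _root_.xor_comm]
    by_cases h : Even k <;> simp [h]
  have h2 : (squares (𝓞 K)ˣ).relIndex (torsion K) = 2 := by
    have hneg : (-1 : (𝓞 K)ˣ) ∉ squares (𝓞 K)ˣ := by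
      rintro ⟨y, hy⟩
      refine not_isSquare_neg_one_of_isTotallyReal (y : K) ?_
      have := congrArg (fun u : (𝓞 K)ˣ => (u : K)) hy
      simpa using this
    rw [Subgroup.relIndex_eq_two_iff]
    refine ⟨-1, neg_one_mem_torsion, fun b hb => ?_⟩
    rcases torsion_eq_one_or_neg_one hb with rfl | rfl
    · simp [hneg, one_mem]
    · simp [hneg, one_mem]
  rw [← Subgroup.relIndex_mul_index (le_sup_left : squares (𝓞 K)ˣ ≤ squares (𝓞 K)ˣ ⊔ torsion K),
    h1, Subgroup.relIndex_sup_left, h2]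

end Units

section Coordinates

variable {d : ℕ} {K : Type*} [Field K] [NumberField K] {α : K}

theorem rat_sq_ne (hd1 : 1 < d) (hdsf : Squarefree d) (q : ℚ) : q ^ 2 ≠ d := by
  intro h
  have h1 : IsSquare (d : ℚ) := ⟨q, by rw [← h, pow_two]⟩
  rw [Rat.isSquare_natCast_iff] at h1
  obtain ⟨r, rfl⟩ := h1
  have := Nat.isUnit_iff.1 (hdsf r dvd_rfl)
  subst this
  omega

theorem exists_basis (hd1 : 1 < d) (hdsf : Squarefree d) (hα : α ^ 2 = (d : K))
    (hdeg : Module.finrank ℚ K = 2) : ∃ b : Module.Basis (Fin 2) ℚ K, b 0 = 1 ∧ b 1 = α := by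
  have hli : LinearIndependent ℚ ![(1 : K), α] := by
    rw [LinearIndependent.pair_iff]
    intro u v h
    rw [Algebra.smul_def, Algebra.smul_def, mul_one] at h
    have hv : v = 0 := by
      by_contra hv
      apply rat_sq_ne hd1 hdsf (-u / v)
      apply (algebraMap ℚ K).injective
      have hv' : algebraMap ℚ K v ≠ 0 := by simpa using hv
      rw [map_pow, map_div₀, map_neg, map_natCast, ← hα]
      congr 1
      rw [div_eq_iff hv']
      linear_combination -h
    subst hv
    simpa using h
  let b := basisOfLinearIndependentOfCardEqFinrank hli (by simp [hdeg])
  exact ⟨b, by simp [b], by simp [b]⟩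

theorem exists_coords (hd1 : 1 < d) (hdsf : Squarefree d) (hα : α ^ 2 = (d : K))
    (hdeg : Module.finrank ℚ K = 2) (x : K) : ∃ u v : ℚ, x = u + v * α := by
  obtain ⟨b, h0, h1⟩ := exists_basis hd1 hdsf hα hdeg
  refine ⟨b.repr x 0, b.repr x 1, ?_⟩
  conv_lhs => rw [← b.sum_repr x]
  simp [Fin.sum_univ_two, h0, h1, Algebra.smul_def]

theorem coords_unique (hd1 : 1 < d) (hdsf : Squarefree d) (hα : α ^ 2 = (d : K))
    (hdeg : Module.finrank ℚ K = 2) {u v u' v' : ℚ} (h : (u : K) + v * α = u' + v' * α) :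
    u = u' ∧ v = v' := by
  obtain ⟨b, h0, h1⟩ := exists_basis hd1 hdsf hα hdeg
  have key : ∀ u v : ℚ, b.repr ((u : K) + v * α) = Finsupp.single 0 u + Finsupp.single 1 v := by
    intro u v
    have : (u : K) + v * α = u • b 0 + v • b 1 := by simp [h0, h1, Algebra.smul_def]
    rw [this]
    simp
  have h2 := congrArg b.repr h
  rw [key, key] at h2
  have h3 := DFunLike.congr_fun h2 0
  have h4 := DFunLike.congr_fun h2 1
  simp at h3 h4
  exact ⟨h3, h4⟩

theorem leftMulMatrix_eq (hα : α ^ 2 = (d : K)) (b : Module.Basis (Fin 2) ℚ K) (h0 : b 0 = 1)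
    (h1 : b 1 = α) (u v : ℚ) :
    Algebra.leftMulMatrix b ((u : K) + v * α) = !![u, d * v; v, u] := by
  have e0 : ((u : K) + v * α) * b 0 = u • b 0 + v • b 1 := by
    simp [h0, h1, Algebra.smul_def]
  have e1 : ((u : K) + v * α) * b 1 = (d * v : ℚ) • b 0 + u • b 1 := by
    simp only [h0, h1, Algebra.smul_def, map_mul, map_natCast, ← hα, eq_ratCast]
    ring
  ext i j
  rw [Algebra.leftMulMatrix_eq_repr_mul]
  fin_cases i <;> fin_cases j <;> simp [e0, e1]

theorem norm_coords (hd1 : 1 < d) (hdsf : Squarefree d) (hα : α ^ 2 = (d : K))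
    (hdeg : Module.finrank ℚ K = 2) (u v : ℚ) :
    Algebra.norm ℚ ((u : K) + v * α) = u ^ 2 - d * v ^ 2 := by
  obtain ⟨b, h0, h1⟩ := exists_basis hd1 hdsf hα hdeg
  rw [Algebra.norm_eq_matrix_det b, leftMulMatrix_eq hα b h0 h1, Matrix.det_fin_two_of]
  ring

theorem trace_coords (hd1 : 1 < d) (hdsf : Squarefree d) (hα : α ^ 2 = (d : K))
    (hdeg : Module.finrank ℚ K = 2) (u v : ℚ) :
    Algebra.trace ℚ K ((u : K) + v * α) = 2 * u := by
  obtain ⟨b, h0, h1⟩ := exists_basis hd1 hdsf hα hdeg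
  rw [Algebra.trace_eq_matrix_trace b, leftMulMatrix_eq hα b h0 h1, Matrix.trace_fin_two_of]
  ring

theorem sq_eq_trace_mul_sub_norm (hd1 : 1 < d) (hdsf : Squarefree d) (hα : α ^ 2 = (d : K))
    (hdeg : Module.finrank ℚ K = 2) (x : K) :
    x ^ 2 = (Algebra.trace ℚ K x : K) * x - (Algebra.norm ℚ x : K) := by
  obtain ⟨u, v, rfl⟩ := exists_coords hd1 hdsf hα hdeg x
  rw [norm_coords hd1 hdsf hα hdeg, trace_coords hd1 hdsf hα hdeg]
  push_cast
  rw [← hα]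
  ring

theorem isTotallyReal (hd1 : 1 < d) (hdsf : Squarefree d) (hα : α ^ 2 = (d : K))
    (hdeg : Module.finrank ℚ K = 2) : IsTotallyReal K := by
  refine ⟨fun w => ?_⟩
  rw [InfinitePlace.isReal_iff]
  rw [ComplexEmbedding.isReal_iff]
  have h : w.embedding α ^ 2 = d := by rw [← map_pow, hα, map_natCast]
  have hr : (starRingEnd ℂ) (w.embedding α) = w.embedding α := by
    have hs : ((Real.sqrt d : ℝ) : ℂ) ^ 2 = d := by
      rw [← Complex.ofReal_pow, Real.sq_sqrt (Nat.cast_nonneg d), Complex.ofReal_natCast]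
    rcases sq_eq_sq_iff_eq_or_eq_neg.1 (h.trans hs.symm) with h | h <;> rw [h] <;> simp
  ext x
  obtain ⟨u, v, rfl⟩ := exists_coords hd1 hdsf hα hdeg x
  simp [ComplexEmbedding.conjugate_coe_eq, hr]

end Coordinates

section Ramified

theorem exists_mul_self_eq_spanSingleton {R K : Type*} [CommRing R] [IsDomain R] [Field K]
    [Algebra R K] [IsFractionRing R K] {a b c : K} (r₁ r₂ r₃ s₁ s₂ s₃ : R)
    (h₁ : a * a = algebraMap R K r₁ * c) (h₂ : a * b = algebraMap R K r₂ * c)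
    (h₃ : b * b = algebraMap R K r₃ * c)
    (h : c = algebraMap R K s₁ * (a * a) + algebraMap R K s₂ * (a * b) +
      algebraMap R K s₃ * (b * b)) :
    ∃ J : FractionalIdeal R⁰ K, J * J = FractionalIdeal.spanSingleton R⁰ c := by
  refine ⟨FractionalIdeal.spanSingleton R⁰ a + FractionalIdeal.spanSingleton R⁰ b, ?_⟩
  rw [add_mul, mul_add, mul_add]
  simp only [FractionalIdeal.spanSingleton_mul_spanSingleton, ← FractionalIdeal.sup_eq_add]
  apply le_antisymm
  · rw [mul_comm b a]
    simp only [sup_le_iff, FractionalIdeal.spanSingleton_le_iff_mem,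
      FractionalIdeal.mem_spanSingleton, Algebra.smul_def]
    exact ⟨⟨⟨r₁, h₁.symm⟩, ⟨r₂, h₂.symm⟩⟩, ⟨r₂, h₂.symm⟩, ⟨r₃, h₃.symm⟩⟩
  · rw [FractionalIdeal.spanSingleton_le_iff_mem]
    have mem : ∀ (I : FractionalIdeal R⁰ K) (s : R) (x : K),
        FractionalIdeal.spanSingleton R⁰ x ≤ I → algebraMap R K s * x ∈ I := by
      intro I s x hx
      rw [← Algebra.smul_def]
      exact Submodule.smul_mem (I : Submodule R K) s
        (hx (FractionalIdeal.mem_spanSingleton_self R⁰ x))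
    have key : ∀ (I : FractionalIdeal R⁰ K) {x y : K}, x ∈ I → y ∈ I → x + y ∈ I :=
      fun I _ _ hx hy => Submodule.add_mem (I : Submodule R K) hx hy
    rw [h]
    refine key _ (key _ (mem _ _ _ ?_) (mem _ _ _ ?_)) (mem _ _ _ ?_)
    · exact le_sup_left.trans le_sup_left
    · exact le_sup_right.trans le_sup_left
    · exact le_sup_right.trans le_sup_right

theorem isIntegral_of_sq_eq {K : Type*} [CommRing K] {x : K} (a b : ℤ)
    (h : x ^ 2 = a * x + b) : IsIntegral ℤ x := by
  refine ⟨Polynomial.X ^ 2 - (Polynomial.C a * Polynomial.X + Polynomial.C b), ?_, ?_⟩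
  · monicity!
  · simp [Polynomial.eval₂_C, h, -eq_intCast]

theorem mem_one_iff_isIntegral {K : Type*} [Field K] {x : K} :
    x ∈ (1 : FractionalIdeal (𝓞 K)⁰ K) ↔ IsIntegral ℤ x := by
  rw [FractionalIdeal.mem_one_iff]
  exact ⟨fun ⟨y, hy⟩ => hy ▸ y.isIntegral_coe, fun h => ⟨⟨x, h⟩, rfl⟩⟩

theorem mem_spanSingleton_iff_isIntegral_div {K : Type*} [Field K] [NumberField K] {x y : K}
    (hy : y ≠ 0) : x ∈ FractionalIdeal.spanSingleton (𝓞 K)⁰ y ↔ IsIntegral ℤ (x / y) := by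
  rw [FractionalIdeal.mem_spanSingleton]
  constructor
  · rintro ⟨z, rfl⟩
    rw [Algebra.smul_def, mul_div_cancel_right₀ _ hy]
    exact z.isIntegral_coe
  · intro h
    obtain ⟨c, hc⟩ : ∃ c : 𝓞 K, algebraMap (𝓞 K) K c = x / y := ⟨⟨x / y, h⟩, rfl⟩
    exact ⟨c, by rw [Algebra.smul_def, hc, div_mul_cancel₀ x hy]⟩

theorem exists_int_of_isIntegral {q : ℚ} (h : IsIntegral ℤ q) : ∃ n : ℤ, q = n := by
  obtain ⟨n, hn⟩ := (IsIntegrallyClosed.isIntegral_iff (R := ℤ)).1 h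
  exact ⟨n, by simpa using hn.symm⟩

theorem isIntegral_sqrt {K : Type*} [CommRing K] {d : ℕ} {α : K} (hα : α ^ 2 = (d : K)) :
    IsIntegral ℤ α :=
  isIntegral_of_sq_eq 0 d (by simp [hα])

/-- A square root of the discriminant. -/
def sqrtDisc {K : Type*} [CommRing K] (d : ℕ) (α : K) : K := if d % 4 = 1 then α else 2 * α

theorem sqrtDisc_sq {K : Type*} [CommRing K] {d : ℕ} {α : K} (hα : α ^ 2 = (d : K)) :
    sqrtDisc d α ^ 2 = (quadDisc d : K) := by
  unfold sqrtDisc quadDisc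
  split_ifs
  · exact hα
  · rw [mul_pow, hα]; push_cast; ring

variable {d : ℕ} {K : Type*} [Field K] [NumberField K] {α : K}

/-- The inverse different is contained in the fractional ideal generated by the inverse of a square
root of the discriminant. -/
theorem isIntegral_sqrtDisc_mul (hd1 : 1 < d) (hdsf : Squarefree d) (hα : α ^ 2 = (d : K))
    (hdeg : Module.finrank ℚ K = 2) {w : K}
    (hw : ∀ z : K, IsIntegral ℤ z → ∃ n : ℤ, Algebra.trace ℚ K (w * z) = n) :
    IsIntegral ℤ (sqrtDisc d α * w) := by
  obtain ⟨u, v, rfl⟩ := exists_coords hd1 hdsf hα hdeg w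
  have hI := isIntegral_sqrt hα
  have hZ : ∀ n : ℤ, IsIntegral ℤ (n : K) := fun n => isIntegral_algebraMap (R := ℤ) (x := n)
  obtain ⟨n₀, h₀⟩ := hw 1 isIntegral_one
  rw [mul_one, trace_coords hd1 hdsf hα hdeg] at h₀
  unfold sqrtDisc
  split_ifs with h4
  · obtain ⟨k, hk⟩ : ∃ k : ℕ, d = 4 * k + 1 := ⟨d / 4, by omega⟩
    have hk' : α ^ 2 = 4 * (k : K) + 1 := by rw [hα, hk]; push_cast; ring
    obtain ⟨n₁, h₁⟩ := hw ((1 + α) / 2) (isIntegral_of_sq_eq 1 k (by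
      field_simp; push_cast; linear_combination hk'))
    have e1 : ((u : K) + v * α) * ((1 + α) / 2) =
        (((u + v * d) / 2 : ℚ) : K) + ((u + v) / 2 : ℚ) * α := by
      push_cast; rw [← hα]; ring
    rw [e1, trace_coords hd1 hdsf hα hdeg] at h₁
    have hInt : IsIntegral ℤ ((1 - α) / 2) := isIntegral_of_sq_eq 1 k (by
      field_simp; push_cast; linear_combination hk')
    have e2 : α * ((u : K) + v * α) = (n₁ : K) - n₀ * ((1 - α) / 2) := by
      have a0 : (n₀ : K) = 2 * u := by exact_mod_cast congrArg (Rat.cast : ℚ → K) h₀.symm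
      have a1 : (n₁ : K) = u + v * d := by
        have : (n₁ : ℚ) = u + v * d := by rw [← h₁]; ring
        exact_mod_cast congrArg (Rat.cast : ℚ → K) this
      rw [a0, a1, ← hα]; ring
    rw [e2]
    exact (hZ n₁).sub ((hZ n₀).mul hInt)
  · obtain ⟨n₁, h₁⟩ := hw α hI
    have e1 : ((u : K) + v * α) * α = ((v * d : ℚ) : K) + (u : ℚ) * α := by
      push_cast; rw [← hα]; ring
    rw [e1, trace_coords hd1 hdsf hα hdeg] at h₁
    have e2 : 2 * α * ((u : K) + v * α) = (n₁ : K) + n₀ * α := by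
      have a0 : (n₀ : K) = 2 * u := by exact_mod_cast congrArg (Rat.cast : ℚ → K) h₀.symm
      have a1 : (n₁ : K) = 2 * (v * d) := by
        exact_mod_cast congrArg (Rat.cast : ℚ → K) h₁.symm
      rw [a0, a1, ← hα]; ring
    rw [e2]
    exact (hZ n₁).add ((hZ n₀).mul hI)

theorem exists_trace_eq_mul (hd1 : 1 < d) (hdsf : Squarefree d) (hα : α ^ 2 = (d : K))
    (hdeg : Module.finrank ℚ K = 2) {m : ℕ} (hm : Squarefree m) {x : K} (hx : IsIntegral ℤ x)
    (hx2 : IsIntegral ℤ (x ^ 2 / m)) : ∃ n : ℤ, Algebra.trace ℚ K x = m * n := by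
  have hm0 : (m : K) ≠ 0 := Nat.cast_ne_zero.2 hm.ne_zero
  have hm0' : (m : ℚ) ≠ 0 := Nat.cast_ne_zero.2 hm.ne_zero
  obtain ⟨N, hN⟩ := exists_int_of_isIntegral (Algebra.isIntegral_norm ℚ hx)
  obtain ⟨T, hT⟩ := exists_int_of_isIntegral (Algebra.isIntegral_trace (L := ℚ) hx)
  obtain ⟨c, hc⟩ := exists_int_of_isIntegral (Algebra.isIntegral_norm ℚ hx2)
  have hmN : (m : ℤ) ∣ N := by
    rw [← Int.pow_dvd_pow_iff two_ne_zero]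
    refine ⟨c, ?_⟩
    have h1 : Algebra.norm ℚ (x ^ 2 / (m : K)) * Algebra.norm ℚ (algebraMap ℚ K m) =
        Algebra.norm ℚ x ^ 2 := by
      rw [← map_mul, ← map_pow, map_natCast, div_mul_cancel₀ _ hm0]
    rw [Algebra.norm_algebraMap, hdeg, hc, hN] at h1
    have : (N : ℚ) ^ 2 = m ^ 2 * c := by rw [← h1]; ring
    exact_mod_cast this
  obtain ⟨n, rfl⟩ := hmN
  have hTx : IsIntegral ℤ ((T : K) * x / m) := by
    have h1 := sq_eq_trace_mul_sub_norm hd1 hdsf hα hdeg x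
    rw [hN, hT] at h1
    have h2 : (T : K) * x / m = x ^ 2 / m + n := by
      rw [h1]; field_simp; push_cast; ring
    rw [h2]
    exact hx2.add (isIntegral_algebraMap (R := ℤ) (x := n))
  obtain ⟨e, he⟩ := exists_int_of_isIntegral (Algebra.isIntegral_trace (L := ℚ) hTx)
  have hmT : (m : ℤ) ∣ T ^ 2 := by
    refine ⟨e, ?_⟩
    have h1 : (T : K) * x / m = ((T : ℚ) / m) • x := by
      rw [Algebra.smul_def]; simp; ring
    rw [h1, map_smul, hT, smul_eq_mul] at he
    have : (T : ℚ) ^ 2 = m * e := by rw [← he]; field_simp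
    exact_mod_cast this
  have hmsf : Squarefree (m : ℤ) := Int.squarefree_natCast.2 hm
  obtain ⟨f, rfl⟩ := (hmsf.dvd_pow_iff_dvd two_ne_zero).1 hmT
  exact ⟨f, by rw [hT]; push_cast; rfl⟩

/-- A squarefree positive integer generating a square ideal of `ℚ(√d)` divides the discriminant. -/
theorem dvd_quadDisc_of_mul_self_eq (hd1 : 1 < d) (hdsf : Squarefree d) (hα : α ^ 2 = (d : K))
    (hdeg : Module.finrank ℚ K = 2) {m : ℕ} (hm : Squarefree m)
    {J : FractionalIdeal (𝓞 K)⁰ K} (hJ : J * J = FractionalIdeal.spanSingleton (𝓞 K)⁰ (m : K)) :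
    m ∣ quadDisc d := by
  have hm0 : (m : K) ≠ 0 := Nat.cast_ne_zero.2 hm.ne_zero
  have hJ0 : J ≠ 0 := by
    rintro rfl
    rw [zero_mul, eq_comm, FractionalIdeal.spanSingleton_eq_zero_iff] at hJ
    exact hm0 hJ
  have hJ1 : J ≤ 1 := by
    apply le_one_of_mul_self_le_one
    rw [hJ, FractionalIdeal.spanSingleton_le_iff_mem, mem_one_iff_isIntegral]
    simpa using isIntegral_algebraMap (R := ℤ) (A := K) (x := (m : ℤ))
  have hle : FractionalIdeal.spanSingleton (𝓞 K)⁰ (sqrtDisc d α) * J ≤ J * J := by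
    rw [FractionalIdeal.spanSingleton_mul_le_iff]
    intro y hy
    rw [hJ, mem_spanSingleton_iff_isIntegral_div hm0, mul_div_assoc]
    apply isIntegral_sqrtDisc_mul hd1 hdsf hα hdeg
    intro z hz
    have hyz : y * z ∈ J := by
      obtain ⟨c, rfl⟩ : ∃ c : 𝓞 K, algebraMap (𝓞 K) K c = z := ⟨⟨z, hz⟩, rfl⟩
      rw [mul_comm, ← Algebra.smul_def]
      exact Submodule.smul_mem (J : Submodule (𝓞 K) K) c hy
    have hyz2 : (y * z) ^ 2 ∈ J * J := by
      rw [pow_two]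
      exact FractionalIdeal.mul_mem_mul hyz hyz
    rw [hJ, mem_spanSingleton_iff_isIntegral_div hm0] at hyz2
    obtain ⟨n, hn⟩ := exists_trace_eq_mul hd1 hdsf hα hdeg hm
      (mem_one_iff_isIntegral.1 (hJ1 hyz)) hyz2
    refine ⟨n, ?_⟩
    have h1 : y / m * z = ((m : ℚ)⁻¹) • (y * z) := by
      rw [Algebra.smul_def]; simp; ring
    have hm0' : (m : ℚ) ≠ 0 := Nat.cast_ne_zero.2 hm.ne_zero
    rw [h1, map_smul, hn, smul_eq_mul, inv_mul_cancel_left₀ hm0']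
  have hmem : sqrtDisc d α ∈ J := by
    rw [← FractionalIdeal.spanSingleton_le_iff_mem]
    calc _ = FractionalIdeal.spanSingleton (𝓞 K)⁰ (sqrtDisc d α) * J * J⁻¹ := by
          rw [mul_assoc, mul_inv_cancel₀ hJ0, mul_one]
      _ ≤ J * J * J⁻¹ := mul_le_mul_left hle _
      _ = J := by rw [mul_assoc, mul_inv_cancel₀ hJ0, mul_one]
  have hD := FractionalIdeal.mul_mem_mul hmem hmem
  rw [hJ, mem_spanSingleton_iff_isIntegral_div hm0, ← pow_two, sqrtDisc_sq hα] at hD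
  have h2 : ((quadDisc d : K) / m) = algebraMap ℚ K ((quadDisc d : ℚ) / m) := by simp
  rw [h2, isIntegral_algebraMap_iff (algebraMap ℚ K).injective] at hD
  obtain ⟨n, hn⟩ := exists_int_of_isIntegral hD
  rw [div_eq_iff (Nat.cast_ne_zero.2 hm.ne_zero)] at hn
  rw [← Int.natCast_dvd_natCast]
  refine ⟨n, ?_⟩
  rw [mul_comm]
  exact_mod_cast hn

theorem exists_mul_self_eq_of_prime_dvd_quadDisc (hdsf : Squarefree d) (hα : α ^ 2 = (d : K))
    {p : ℕ} (hp : p.Prime) (hpd : p ∣ quadDisc d) :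
    ∃ J : FractionalIdeal (𝓞 K)⁰ K, J * J = FractionalIdeal.spanSingleton (𝓞 K)⁰ (p : K) := by
  let β : 𝓞 K := ⟨α, isIntegral_sqrt hα⟩
  have hβ : algebraMap (𝓞 K) K β = α := rfl
  by_cases h : p ∣ d
  · obtain ⟨e, rfl⟩ := h
    have hcop : Nat.Coprime p e := Nat.coprime_of_squarefree_mul hdsf
    have hbez := congrArg (Int.cast : ℤ → K) (Nat.gcd_eq_gcd_ab p e)
    rw [hcop.gcd_eq_one] at hbez
    push_cast at hbez hα
    refine exists_mul_self_eq_spanSingleton (a := (p : K)) (b := α) (p : 𝓞 K) β (e : 𝓞 K)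
      (Nat.gcdA p e : 𝓞 K) 0 (Nat.gcdB p e : 𝓞 K) ?_ ?_ ?_ ?_
    · simp
    · rw [hβ]; ring
    · rw [← pow_two, hα]; simp; ring
    · rw [← pow_two α, hα]
      simp only [map_intCast, map_zero]
      linear_combination (p : K) * hbez
  · have h4 : d % 4 ≠ 1 := by
      intro h4
      rw [quadDisc, if_pos h4] at hpd
      exact h hpd
    rw [quadDisc, if_neg h4] at hpd
    have hp2 : p = 2 := by
      have : p ∣ 2 ^ 2 := (hp.dvd_mul.1 hpd).resolve_right h
      exact (Nat.prime_dvd_prime_iff_eq hp Nat.prime_two).1 (hp.dvd_of_dvd_pow this)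
    subst hp2
    obtain ⟨k, hk⟩ : ∃ k, d = 4 * k + 3 := ⟨d / 4, by omega⟩
    have hα' : α ^ 2 = 4 * k + 3 := by rw [hα, hk]; push_cast; ring
    refine exists_mul_self_eq_spanSingleton (a := 2) (b := 1 + α) 2 (1 + β) (2 * k + 2 + β)
      (k + 1 : 𝓞 K) 1 (-1) ?_ ?_ ?_ ?_
    · simp [map_ofNat]
    · simp [hβ]; ring
    · simp [hβ, map_ofNat]; linear_combination hα'
    · simp; linear_combination hα'

theorem exists_mul_self_eq_of_norm_eq_neg_one (hd1 : 1 < d) (hdsf : Squarefree d)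
    (hα : α ^ 2 = (d : K)) (hdeg : Module.finrank ℚ K = 2) {y : K}
    (hy : Algebra.norm ℚ y = -1) : ∃ B : ℕ, B ≠ 0 ∧
    ∃ J : FractionalIdeal (𝓞 K)⁰ K, J * J = FractionalIdeal.spanSingleton (𝓞 K)⁰ (y / B) := by
  have h := sq_eq_trace_mul_sub_norm hd1 hdsf hα hdeg y
  set T := Algebra.trace ℚ K y
  refine ⟨T.den, T.den_ne_zero, ?_⟩
  have hB0 : (T.den : K) ≠ 0 := Nat.cast_ne_zero.2 T.den_ne_zero
  have hT : (T : K) = T.num / T.den := Rat.cast_def T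
  rw [hy, hT] at h
  have hInt : IsIntegral ℤ (T.den * y) := isIntegral_of_sq_eq T.num (T.den ^ 2) (by
    rw [mul_pow, h]; push_cast; field_simp; ring)
  let z : 𝓞 K := ⟨T.den * y, hInt⟩
  have hz : algebraMap (𝓞 K) K z = T.den * y := rfl
  have hcop : Int.gcd T.num T.den = 1 := T.reduced
  have hbez := congrArg (Int.cast : ℤ → K) (Int.gcd_eq_gcd_ab T.num T.den)
  rw [hcop] at hbez
  push_cast at hbez
  refine exists_mul_self_eq_spanSingleton (a := 1) (b := y) (z - T.num) T.den z
    (-(Int.gcdA T.num T.den : 𝓞 K)) (Int.gcdB T.num T.den : 𝓞 K)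
    (Int.gcdA T.num T.den : 𝓞 K) ?_ ?_ ?_ ?_
  · simp [hz]; field_simp; field_simp at h; linear_combination -h
  · simp; field_simp
  · simp [hz]; field_simp
  · simp; field_simp; field_simp at h; linear_combination y * hbez - Int.gcdA T.num T.den * h

end Ramified

theorem relIndex_eq_card_of_transversal {G ι : Type*} [CommGroup G] {H L : Subgroup G} (f : ι → G)
    (hL : ∀ i, f i ∈ L) (hinj : ∀ i j, f i / f j ∈ H → i = j)
    (hsurj : ∀ x ∈ L, ∃ i, x / f i ∈ H) : H.relIndex L = Nat.card ι := by
  rw [Subgroup.relIndex, Subgroup.index_eq_card]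
  refine (Nat.card_congr (Equiv.ofBijective
    (fun i => (QuotientGroup.mk (⟨f i, hL i⟩ : L) : L ⧸ H.subgroupOf L)) ⟨?_, ?_⟩)).symm
  · intro i j h
    rw [QuotientGroup.eq, Subgroup.mem_subgroupOf] at h
    refine (hinj j i ?_).symm
    rw [div_eq_inv_mul]
    exact h
  · intro q
    induction q using QuotientGroup.induction_on with
    | H x =>
      obtain ⟨i, hi⟩ := hsurj x x.2
      refine ⟨i, ?_⟩
      rw [QuotientGroup.eq, Subgroup.mem_subgroupOf]
      rw [div_eq_inv_mul] at hi
      exact hi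

theorem eq_of_squarefree_of_mul_eq_sq {m n k : ℕ} (hm : Squarefree m) (hn : Squarefree n)
    (h : m * n = k ^ 2) : m = n := by
  have key : ∀ {a b : ℕ}, Squarefree a → Squarefree b → a * b = k ^ 2 → a ∣ b := by
    intro a b ha hb hab
    obtain ⟨j, rfl⟩ := (ha.dvd_pow_iff_dvd two_ne_zero).1 ⟨b, hab.symm⟩
    exact ⟨j ^ 2, Nat.eq_of_mul_eq_mul_left (Nat.pos_of_ne_zero ha.ne_zero) (by rw [hab]; ring)⟩
  exact Nat.dvd_antisymm (key hm hn h) (key hn hm (by rw [mul_comm, h]))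

section Rational

variable {d : ℕ} {K : Type*} [Field K] [NumberField K] {α : K}

/-- The nonzero rational numbers that generate a square fractional ideal of `K`. -/
noncomputable def rationalIdealSquares (K : Type*) [Field K] [NumberField K] : Subgroup ℚˣ :=
  (idealSquares (𝓞 K) K).comap (Units.map (algebraMap ℚ K : ℚ →* K))

theorem mem_rationalIdealSquares {q : ℚˣ} : q ∈ rationalIdealSquares K ↔
    ∃ J : FractionalIdeal (𝓞 K)⁰ K, J * J = FractionalIdeal.spanSingleton (𝓞 K)⁰ ((q : ℚ) : K) := by
  rw [rationalIdealSquares, Subgroup.mem_comap, mem_idealSquares]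
  simp

theorem squares_le_rationalIdealSquares : squares ℚˣ ≤ rationalIdealSquares K := by
  rintro _ ⟨y, rfl⟩
  apply squares_le_idealSquares
  exact ⟨Units.map (algebraMap ℚ K : ℚ →* K) y, (map_pow _ y 2).symm⟩

theorem neg_one_mem_rationalIdealSquares : (-1 : ℚˣ) ∈ rationalIdealSquares K := by
  rw [mem_rationalIdealSquares]
  refine ⟨1, le_antisymm ?_ ?_⟩
  · rw [mul_one, FractionalIdeal.one_le]
    exact (FractionalIdeal.mem_spanSingleton _).2 ⟨-1, by simp⟩
  · rw [mul_one, FractionalIdeal.spanSingleton_le_iff_mem]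
    exact (FractionalIdeal.mem_one_iff _).2 ⟨-1, by simp⟩

/-- A natural number as a rational unit, with value `1` at zero. -/
noncomputable def natUnit (n : ℕ) : ℚˣ := if h : (n : ℚ) ≠ 0 then Units.mk0 n h else 1

theorem val_natUnit {n : ℕ} (hn : n ≠ 0) : (natUnit n : ℚ) = n := by
  rw [natUnit, dif_pos (Nat.cast_ne_zero.2 hn), Units.val_mk0]

/-- The rational unit given by a sign and a finite set of primes. -/
noncomputable def signedProd (x : ℤˣ × Finset ℕ) : ℚˣ :=
  Units.map (Int.castRingHom ℚ : ℤ →* ℚ) x.1 * ∏ p ∈ x.2, natUnit p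

theorem val_signedProd {x : ℤˣ × Finset ℕ} (hx : ∀ p ∈ x.2, p.Prime) :
    (signedProd x : ℚ) = ((x.1 : ℤ) : ℚ) * ((∏ p ∈ x.2, p : ℕ) : ℚ) := by
  rw [signedProd, Units.val_mul, Units.coe_prod, Nat.cast_prod]
  congr 1
  exact Finset.prod_congr rfl fun p hp => val_natUnit (hx p hp).ne_zero

theorem squarefree_prod_primes {T : Finset ℕ} (hT : ∀ p ∈ T, p.Prime) :
    Squarefree (∏ p ∈ T, p) := by
  refine Finset.squarefree_prod_of_pairwise_isCoprime ?_ fun p hp => (hT p hp).squarefree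
  intro p hp q hq hpq
  exact Nat.coprime_iff_isRelPrime.1 ((Nat.coprime_primes (hT p hp) (hT q hq)).2 hpq)

theorem relIndex_squares_rationalIdealSquares (hd1 : 1 < d) (hdsf : Squarefree d)
    (hα : α ^ 2 = (d : K)) (hdeg : Module.finrank ℚ K = 2) :
    (squares ℚˣ).relIndex (rationalIdealSquares K) = 2 ^ ((quadDisc d).primeFactors.card + 1) := by
  have hD0 : quadDisc d ≠ 0 := by unfold quadDisc; split_ifs <;> omega
  have hprime : ∀ T : (quadDisc d).primeFactors.powerset, ∀ p ∈ T.1, p.Prime := fun T p hp =>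
    Nat.prime_of_mem_primeFactors (Finset.mem_powerset.1 T.2 hp)
  have hsign : ∀ ε : ℤˣ, Units.map (Int.castRingHom ℚ : ℤ →* ℚ) ε ∈ rationalIdealSquares K := by
    intro ε
    rcases Int.units_eq_one_or ε with rfl | rfl
    · rw [map_one]; exact one_mem _
    · convert neg_one_mem_rationalIdealSquares (K := K)
      ext; simp
  have hmem : ∀ i : ℤˣ × (quadDisc d).primeFactors.powerset,
      signedProd (i.1, i.2.1) ∈ rationalIdealSquares K := by
    intro i
    refine mul_mem (hsign _) (prod_mem fun p hp => ?_)
    rw [mem_rationalIdealSquares, val_natUnit (hprime _ p hp).ne_zero]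
    simpa using exists_mul_self_eq_of_prime_dvd_quadDisc hdsf hα (hprime _ p hp)
      (Nat.dvd_of_mem_primeFactors (Finset.mem_powerset.1 i.2.2 hp))
  rw [relIndex_eq_card_of_transversal (ι := ℤˣ × (quadDisc d).primeFactors.powerset)
    (fun i => signedProd (i.1, i.2.1)) hmem]
  · rw [Nat.card_prod, Nat.card_eq_fintype_card, Nat.card_eq_fintype_card, Fintype.card_coe,
      Finset.card_powerset, Fintype.card_units_int, pow_succ, mul_comm]
  · rintro ⟨ε, T⟩ ⟨ε', T'⟩ ⟨y, hy⟩
    have hm := squarefree_prod_primes (hprime T)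
    have hm' := squarefree_prod_primes (hprime T')
    have hy' : (signedProd (ε, T.1) : ℚ) = (y : ℚ) ^ 2 * signedProd (ε', T'.1) := by
      rw [← Units.val_pow_eq_pow_val, ← Units.val_mul]
      congr 1
      rw [← div_eq_iff_eq_mul]
      exact hy.symm
    rw [val_signedProd (hprime T), val_signedProd (hprime T')] at hy'
    set m := ∏ p ∈ T.1, p with hmdef
    set m' := ∏ p ∈ T'.1, p with hmdef'
    have hmpos : (0 : ℚ) < m := Nat.cast_pos.2 (Nat.pos_of_ne_zero hm.ne_zero)
    have hmpos' : (0 : ℚ) < m' := Nat.cast_pos.2 (Nat.pos_of_ne_zero hm'.ne_zero)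
    have hypos : 0 < (y : ℚ) ^ 2 := sq_pos_of_ne_zero y.ne_zero
    have hε : ε = ε' := by
      have h1 : 0 < (y : ℚ) ^ 2 * m' := by positivity
      rcases Int.units_eq_one_or ε with rfl | rfl <;> rcases Int.units_eq_one_or ε' with rfl | rfl
      · rfl
      · simp at hy'; linarith
      · simp at hy'; linarith
      · rfl
    subst hε
    have hεne : ((ε : ℤ) : ℚ) ≠ 0 := by simp
    have h2 : (m : ℚ) = (y : ℚ) ^ 2 * m' := mul_left_cancel₀ hεne (by rw [hy']; ring)
    have h3 : IsSquare ((m * m' : ℕ) : ℚ) := ⟨y * m', by push_cast; rw [h2]; ring⟩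
    rw [Rat.isSquare_natCast_iff] at h3
    obtain ⟨k, hk⟩ := h3
    have h4 := eq_of_squarefree_of_mul_eq_sq hm hm' (by rw [hk, pow_two])
    have h5 := congrArg Nat.primeFactors h4
    rw [hmdef, hmdef', Nat.primeFactors_prod (hprime T), Nat.primeFactors_prod (hprime T')] at h5
    rw [Subtype.ext h5]
  · intro q hq
    obtain ⟨m, k, hmk, hm⟩ := Nat.sq_mul_squarefree ((q : ℚ).num.natAbs * (q : ℚ).den)
    have hq0 : (q : ℚ) ≠ 0 := q.ne_zero
    have hk0 : k ≠ 0 := by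
      rintro rfl
      rw [zero_pow two_ne_zero, zero_mul, eq_comm] at hmk
      simp at hmk
    have hm0 : m ≠ 0 := hm.ne_zero
    obtain ⟨ε, hε⟩ : ∃ ε : ℤˣ, (q : ℚ).num = ε * ((q : ℚ).num.natAbs : ℤ) := by
      rcases Int.natAbs_eq (q : ℚ).num with h | h
      · exact ⟨1, by simpa using h⟩
      · exact ⟨-1, by simpa using h⟩
    have hqd : ((q : ℚ).den : ℚ) ≠ 0 := Nat.cast_ne_zero.2 (q : ℚ).den_ne_zero
    have hval : (q : ℚ) = ((ε : ℤ) : ℚ) * m * (k / (q : ℚ).den) ^ 2 := by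
      have h1 : ((q : ℚ).num : ℚ) = ((ε : ℤ) : ℚ) * ((q : ℚ).num.natAbs : ℚ) := by
        rw [← Int.cast_natCast, ← Int.cast_mul, ← hε]
      have h2 : (k : ℚ) ^ 2 * m = ((q : ℚ).num.natAbs : ℚ) * (q : ℚ).den := by exact_mod_cast hmk
      conv_lhs => rw [← Rat.num_div_den (q : ℚ), h1]
      field_simp
      linear_combination -h2
    obtain ⟨r, hsq⟩ : ∃ r, q = Units.map (Int.castRingHom ℚ : ℤ →* ℚ) ε * natUnit m * r ^ 2 := by
      refine ⟨natUnit k / natUnit (q : ℚ).den, ?_⟩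
      ext
      conv_lhs => rw [hval]
      simp [val_natUnit hm0, val_natUnit hk0, val_natUnit (q : ℚ).den_ne_zero]
    have hmR : natUnit m ∈ rationalIdealSquares K := by
      have h1 : natUnit m = q * (Units.map (Int.castRingHom ℚ : ℤ →* ℚ) ε)⁻¹ * (r ^ 2)⁻¹ := by
        rw [hsq, mul_right_comm, mul_inv_cancel_right, mul_comm, inv_mul_cancel_left]
      rw [h1]
      exact mul_mem (mul_mem hq (inv_mem (hsign _)))
        (inv_mem (squares_le_rationalIdealSquares ⟨_, rfl⟩))
    obtain ⟨J, hJ⟩ := mem_rationalIdealSquares.1 hmR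
    rw [val_natUnit hm0, Rat.cast_natCast] at hJ
    have hdvd := dvd_quadDisc_of_mul_self_eq hd1 hdsf hα hdeg hm hJ
    refine ⟨(ε, ⟨m.primeFactors, Finset.mem_powerset.2 (Nat.primeFactors_mono hdvd hD0)⟩), r, ?_⟩
    have h3 : signedProd (ε, m.primeFactors) =
        Units.map (Int.castRingHom ℚ : ℤ →* ℚ) ε * natUnit m := by
      ext
      rw [val_signedProd fun p hp => Nat.prime_of_mem_primeFactors hp,
        Nat.prod_primeFactors_of_squarefree hm, Units.val_mul, val_natUnit hm0]
      rfl
    rw [h3, powMonoidHom_apply, eq_div_iff_mul_eq', mul_comm]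
    exact hsq.symm

end Rational

section Norm

variable {d : ℕ} {K : Type*} [Field K] [NumberField K] {α : K}

/-- The inclusion of the nonzero rational numbers into `Kˣ`. -/
noncomputable abbrev ratUnits (K : Type*) [Field K] [NumberField K] : ℚˣ →* Kˣ :=
  Units.map (algebraMap ℚ K : ℚ →* K)

/-- The norm map `Kˣ → ℚˣ`. -/
noncomputable abbrev normUnits (K : Type*) [Field K] [NumberField K] : Kˣ →* ℚˣ :=
  Units.map (Algebra.norm ℚ : K →* ℚ)

theorem relIndex_squares_comap_ratUnits (hd1 : 1 < d) (hdsf : Squarefree d)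
    (hα : α ^ 2 = (d : K)) (hdeg : Module.finrank ℚ K = 2) :
    (squares ℚˣ).relIndex ((squares Kˣ).comap (ratUnits K)) = 2 := by
  have hd0 : (d : ℚ) ≠ 0 := Nat.cast_ne_zero.2 (by omega)
  have hα0 : α ≠ 0 := by
    rintro rfl
    rw [zero_pow two_ne_zero, eq_comm, Nat.cast_eq_zero] at hα
    omega
  let D : ℚˣ := Units.mk0 d hd0
  have hDmem : D ∈ (squares Kˣ).comap (ratUnits K) :=
    ⟨Units.mk0 α hα0, by ext; simp [D, hα]⟩
  have hDnot : D ∉ squares ℚˣ := by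
    rintro ⟨y, hy⟩
    exact rat_sq_ne hd1 hdsf y (by simpa [D] using congrArg (Units.val : ℚˣ → ℚ) hy)
  have key : ∀ q ∈ (squares Kˣ).comap (ratUnits K), q ∈ squares ℚˣ ∨ q * D ∈ squares ℚˣ := by
    rintro q ⟨y, hy⟩
    obtain ⟨u, v, huv⟩ := exists_coords hd1 hdsf hα hdeg y
    have hy' : (y : K) ^ 2 = ((q : ℚ) : K) := by
      simpa using congrArg (Units.val : Kˣ → K) hy
    have h1 : ((u ^ 2 + d * v ^ 2 : ℚ) : K) + (2 * u * v : ℚ) * α = (q : ℚ) + (0 : ℚ) * α := by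
      rw [Rat.cast_zero, zero_mul, add_zero, ← hy', huv]
      push_cast
      rw [← hα]
      ring
    obtain ⟨h2, h3⟩ := coords_unique hd1 hdsf hα hdeg h1
    have hq0 := q.ne_zero
    rcases mul_eq_zero.1 h3 with h | rfl
    · have hu : u = 0 := by simpa using h
      subst hu
      have hv : v ≠ 0 := by
        rintro rfl
        apply hq0
        rw [← h2]
        ring
      refine Or.inr ⟨Units.mk0 (d * v) (mul_ne_zero hd0 hv), ?_⟩
      ext
      simp [D, ← h2]
      ring
    · have hu : u ≠ 0 := by
        rintro rfl
        apply hq0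
        rw [← h2]
        ring
      refine Or.inl ⟨Units.mk0 u hu, ?_⟩
      ext
      simp [← h2]
  rw [Subgroup.relIndex_eq_two_iff]
  refine ⟨D, hDmem, fun q hq => ?_⟩
  rcases key q hq with h | h
  · exact Or.inr ⟨h, by rwa [Subgroup.mul_mem_cancel_left _ h]⟩
  · exact Or.inl ⟨h, fun h' => hDnot ((Subgroup.mul_mem_cancel_left _ h').1 h)⟩

theorem relIndex_squares_sup_map_ratUnits (hd1 : 1 < d) (hdsf : Squarefree d)
    (hα : α ^ 2 = (d : K)) (hdeg : Module.finrank ℚ K = 2) :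
    (squares Kˣ).relIndex ((rationalIdealSquares K).map (ratUnits K) ⊔ squares Kˣ) =
      2 ^ (quadDisc d).primeFactors.card := by
  have hle : (squares Kˣ).comap (ratUnits K) ≤ rationalIdealSquares K :=
    Subgroup.comap_mono squares_le_idealSquares
  have hle' : squares ℚˣ ≤ (squares Kˣ).comap (ratUnits K) := by
    rintro _ ⟨y, rfl⟩
    exact ⟨ratUnits K y, (map_pow (ratUnits K) y 2).symm⟩
  have h := Subgroup.relIndex_mul_relIndex _ _ _ hle' hle
  rw [relIndex_squares_comap_ratUnits hd1 hdsf hα hdeg,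
    relIndex_squares_rationalIdealSquares hd1 hdsf hα hdeg, pow_succ', Subgroup.relIndex_comap] at h
  rw [Subgroup.relIndex_sup_right]
  exact Nat.eq_of_mul_eq_mul_left two_pos h

/-- An element whose norm is a square is a rational number times a square. -/
theorem exists_rat_mul_sq_of_norm_eq_sq (hd1 : 1 < d) (hdsf : Squarefree d)
    (hα : α ^ 2 = (d : K)) (hdeg : Module.finrank ℚ K = 2) {x : Kˣ}
    (hx : normUnits K x ∈ squares ℚˣ) : ∃ (q : ℚˣ) (y : Kˣ), x = ratUnits K q * y ^ 2 := by
  obtain ⟨r, hr⟩ := hx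
  have hr' : (r : ℚ) ^ 2 = Algebra.norm ℚ (x : K) := by
    simpa using congrArg (Units.val : ℚˣ → ℚ) hr
  have h := sq_eq_trace_mul_sub_norm hd1 hdsf hα hdeg (x : K)
  set T := Algebra.trace ℚ K (x : K)
  rw [← hr'] at h
  by_cases hz : (x : K) + (r : ℚ) = 0
  · refine ⟨-r, 1, ?_⟩
    ext
    simp
    linear_combination hz
  · have h1 : ((x : K) + (r : ℚ)) ^ 2 = ((T + 2 * r : ℚ) : K) * x := by
      push_cast at h ⊢
      linear_combination h
    have h2 : T + 2 * r ≠ 0 := by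
      intro h0
      rw [h0, Rat.cast_zero, zero_mul] at h1
      exact hz (pow_eq_zero_iff two_ne_zero |>.1 h1)
    refine ⟨(Units.mk0 _ h2)⁻¹, Units.mk0 _ hz, ?_⟩
    rw [map_inv, eq_inv_mul_iff_mul_eq]
    ext
    simp only [Units.val_mul, Units.val_pow_eq_pow_val, Units.val_mk0, Units.coe_map]
    rw [h1]
    simp

theorem map_ratUnits_sup_squares (hd1 : 1 < d) (hdsf : Squarefree d)
    (hα : α ^ 2 = (d : K)) (hdeg : Module.finrank ℚ K = 2) :
    (rationalIdealSquares K).map (ratUnits K) ⊔ squares Kˣ =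
      idealSquares (𝓞 K) K ⊓ (squares ℚˣ).comap (normUnits K) := by
  apply le_antisymm
  · refine sup_le ?_ (le_inf squares_le_idealSquares ?_)
    · rintro _ ⟨q, hq, rfl⟩
      refine ⟨hq, q, ?_⟩
      ext
      change (q : ℚ) ^ 2 = Algebra.norm ℚ (algebraMap ℚ K q)
      rw [Algebra.norm_algebraMap, hdeg]
    · rintro _ ⟨y, rfl⟩
      exact ⟨normUnits K y, (map_pow (normUnits K) y 2).symm⟩
  · rintro x ⟨hx, hxn⟩
    obtain ⟨q, y, rfl⟩ := exists_rat_mul_sq_of_norm_eq_sq hd1 hdsf hα hdeg hxn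
    have hy : y ^ 2 ∈ squares Kˣ := ⟨y, rfl⟩
    refine Subgroup.mul_mem_sup ⟨q, ?_, rfl⟩ hy
    exact (Subgroup.mul_mem_cancel_right _ (squares_le_idealSquares hy)).1 hx

theorem norm_mem_squares_or_neg {x : Kˣ} (hx : x ∈ idealSquares (𝓞 K) K) :
    normUnits K x ∈ squares ℚˣ ∨ -normUnits K x ∈ squares ℚˣ := by
  obtain ⟨J, hJ⟩ := mem_idealSquares.1 hx
  have h := congrArg FractionalIdeal.absNorm hJ
  rw [map_mul, FractionalIdeal.absNorm_span_singleton] at h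
  have hn : Algebra.norm ℚ (x : K) ≠ 0 := Algebra.norm_ne_zero_iff.2 x.ne_zero
  have hJ0 : FractionalIdeal.absNorm J ≠ 0 := by
    intro h0
    rw [h0, zero_mul, eq_comm, abs_eq_zero] at h
    exact hn h
  rcases abs_choice (Algebra.norm ℚ (x : K)) with h1 | h1
  · refine Or.inl ⟨Units.mk0 _ hJ0, ?_⟩
    ext
    simp [pow_two, h, h1]
  · refine Or.inr ⟨Units.mk0 _ hJ0, ?_⟩
    ext
    simp [pow_two, h, h1]

theorem neg_notMem_squares {q : ℚˣ} (hq : q ∈ squares ℚˣ) : -q ∉ squares ℚˣ := by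
  obtain ⟨a, rfl⟩ := hq
  rintro ⟨b, hb⟩
  have h : (b : ℚ) ^ 2 = -(a : ℚ) ^ 2 := by
    simpa using congrArg (Units.val : ℚˣ → ℚ) hb
  have ha := sq_pos_of_ne_zero a.ne_zero
  nlinarith [sq_nonneg (b : ℚ)]

theorem relIndex_norm_squares_eq_two (hd1 : 1 < d) (hdsf : Squarefree d)
    (hα : α ^ 2 = (d : K)) (hdeg : Module.finrank ℚ K = 2)
    (h : ∃ a b : ℤ, (d : ℤ) = a ^ 2 + b ^ 2) :
    ((squares ℚˣ).comap (normUnits K)).relIndex (idealSquares (𝓞 K) K) = 2 := by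
  obtain ⟨a, b, hab⟩ := h
  have hab' : (d : ℚ) = a ^ 2 + b ^ 2 := by exact_mod_cast hab
  have hb : (b : ℚ) ≠ 0 := by
    intro hb
    rw [hb] at hab'
    exact rat_sq_ne hd1 hdsf a (by rw [hab']; ring)
  obtain ⟨y, hy⟩ : ∃ y : K, Algebra.norm ℚ y = -1 := by
    refine ⟨((a / b : ℚ) : K) + ((1 / b : ℚ) : K) * α, ?_⟩
    rw [norm_coords hd1 hdsf hα hdeg, hab']
    field_simp
    ring
  obtain ⟨B, hB, J, hJ⟩ := exists_mul_self_eq_of_norm_eq_neg_one hd1 hdsf hα hdeg hy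
  have hB' : (B : ℚ) ≠ 0 := Nat.cast_ne_zero.2 hB
  have hn : Algebra.norm ℚ (y / B : K) = -(1 / B) ^ 2 := by
    have h1 : (y / B : K) = y * algebraMap ℚ K (1 / B) := by simp [div_eq_mul_inv]
    rw [h1, map_mul, hy, Algebra.norm_algebraMap, hdeg]
    ring
  have h0 : (y / B : K) ≠ 0 := by
    rw [← Algebra.norm_ne_zero_iff (R := ℚ), hn]
    simpa using hB
  have hneg : -normUnits K (Units.mk0 _ h0) ∈ squares ℚˣ := by
    refine ⟨Units.mk0 _ (one_div_ne_zero hB'), ?_⟩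
    ext
    simp [hn]
  rw [Subgroup.relIndex_eq_two_iff]
  refine ⟨Units.mk0 _ h0, mem_idealSquares.2 ⟨J, hJ⟩, fun x hx => ?_⟩
  rw [Subgroup.mem_comap, Subgroup.mem_comap, map_mul]
  rcases norm_mem_squares_or_neg hx with h1 | h1
  · refine Or.inr ⟨h1, ?_⟩
    rw [Subgroup.mul_mem_cancel_left _ h1]
    intro h2
    exact neg_notMem_squares h2 hneg
  · refine Or.inl ⟨?_, fun h2 => neg_notMem_squares h2 h1⟩
    rw [← neg_mul_neg]
    exact mul_mem h1 hneg

theorem sum_two_squares_of_mul_sq {a b c : ℕ} (hc : c ≠ 0) (h : d * c ^ 2 = a ^ 2 + b ^ 2) :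
    ∃ x y : ℕ, d = x ^ 2 + y ^ 2 := by
  rcases eq_or_ne d 0 with rfl | hd
  · exact ⟨0, 0, rfl⟩
  have h1 := Nat.eq_sq_add_sq_iff.1 ⟨a, b, h⟩
  rw [Nat.eq_sq_add_sq_iff]
  intro q hq hq4
  have hqp : q.Prime := Nat.prime_of_mem_primeFactors hq
  have : Fact q.Prime := ⟨hqp⟩
  have h2 := h1 (q := q) (Nat.mem_primeFactors.2 ⟨hqp, (Nat.dvd_of_mem_primeFactors hq).mul_right _,
    mul_ne_zero hd (pow_ne_zero 2 hc)⟩) hq4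
  rw [padicValNat.mul hd (pow_ne_zero 2 hc), padicValNat.pow, Nat.even_add] at h2
  exact h2.2 (even_two_mul _)

theorem relIndex_norm_squares_eq_one (hd1 : 1 < d) (hdsf : Squarefree d)
    (hα : α ^ 2 = (d : K)) (hdeg : Module.finrank ℚ K = 2)
    (h : ¬ ∃ a b : ℤ, (d : ℤ) = a ^ 2 + b ^ 2) :
    ((squares ℚˣ).comap (normUnits K)).relIndex (idealSquares (𝓞 K) K) = 1 := by
  rw [Subgroup.relIndex_eq_one]
  intro x hx
  refine (norm_mem_squares_or_neg hx).resolve_right fun hneg => h ?_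
  obtain ⟨r, hr⟩ := hneg
  obtain ⟨u, v, huv⟩ := exists_coords hd1 hdsf hα hdeg (x : K)
  have h1 : (r : ℚ) ^ 2 = -Algebra.norm ℚ (x : K) := by
    simpa using congrArg (Units.val : ℚˣ → ℚ) hr
  rw [huv, norm_coords hd1 hdsf hα hdeg] at h1
  have hv : v ≠ 0 := by
    rintro rfl
    have := sq_pos_of_ne_zero r.ne_zero
    nlinarith [sq_nonneg u]
  have hvn : (v.num : ℚ) ≠ 0 := Int.cast_ne_zero.2 (Rat.num_ne_zero.2 hv)
  have hden : ∀ q : ℚ, (q.den : ℚ) ≠ 0 := fun q => Nat.cast_ne_zero.2 q.den_ne_zero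
  have h2 : (d : ℚ) * ((v.num : ℚ) * (((r : ℚ).den : ℚ) * (u.den : ℚ))) ^ 2 =
      (((r : ℚ).num : ℚ) * ((v.den : ℚ) * (u.den : ℚ))) ^ 2 +
        ((u.num : ℚ) * ((v.den : ℚ) * ((r : ℚ).den : ℚ))) ^ 2 := by
    have h3 : (d : ℚ) * v ^ 2 = (r : ℚ) ^ 2 + u ^ 2 := by linear_combination -h1
    have e1 := Rat.num_div_den u
    have e2 := Rat.num_div_den v
    have e3 := Rat.num_div_den (r : ℚ)
    rw [← e1, ← e2, ← e3] at h3
    have d1 := hden u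
    have d2 := hden v
    have d3 := hden r
    generalize (u.num : ℚ) = a at *
    generalize (v.num : ℚ) = b at *
    generalize ((r : ℚ).num : ℚ) = c at *
    generalize (u.den : ℚ) = a' at *
    generalize (v.den : ℚ) = b' at *
    generalize ((r : ℚ).den : ℚ) = c' at *
    field_simp at h3
    linear_combination h3
  have h4 : d * (v.num * ((r : ℚ).den * u.den)) ^ 2 =
      ((r : ℚ).num * (v.den * u.den)) ^ 2 + (u.num * (v.den * (r : ℚ).den)) ^ 2 := by
    exact_mod_cast h2
  rw [← Int.natAbs_sq (_ * _), ← Int.natAbs_sq ((r : ℚ).num * _), ← Int.natAbs_sq (u.num * _)] at h4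
  obtain ⟨a, b, hab⟩ := sum_two_squares_of_mul_sq (d := d)
    (c := (v.num * ((r : ℚ).den * u.den)).natAbs) (by simp [hv]) (by exact_mod_cast h4)
  exact ⟨a, b, by exact_mod_cast hab⟩

theorem four_mul_index_squares_classGroup (hd1 : 1 < d) (hdsf : Squarefree d)
    (hα : α ^ 2 = (d : K)) (hdeg : Module.finrank ℚ K = 2) :
    4 * (squares (ClassGroup (𝓞 K))).index = 2 ^ (quadDisc d).primeFactors.card *
      ((squares ℚˣ).comap (normUnits K)).relIndex (idealSquares (𝓞 K) K) := by
  have := isTotallyReal hd1 hdsf hα hdeg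
  have h1 := relIndex_squares_idealSquares (R := 𝓞 K) (K := K)
  rw [index_squares_units hdeg] at h1
  rw [← h1, ← relIndex_squares_sup_map_ratUnits hd1 hdsf hα hdeg,
    ← Subgroup.inf_relIndex_left (idealSquares (𝓞 K) K) ((squares ℚˣ).comap (normUnits K)),
    ← map_ratUnits_sup_squares hd1 hdsf hα hdeg]
  refine (Subgroup.relIndex_mul_relIndex _ _ _ le_sup_right ?_).symm
  rw [map_ratUnits_sup_squares hd1 hdsf hα hdeg]
  exact inf_le_left

end Norm

end RealQuadratic

/-- Let `t = n_d` be the number of ramified primes of `K_d = ℚ(√d)`, and let `s = t - 1`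
if `d` is a sum of two squares of integers and `s = t - 2` otherwise. Then the quotient of
the ideal class group `C_d` by its subgroup of squares is isomorphic to `(ℤ/2ℤ)^s`; in
particular, this quotient has exactly `2 ^ s` elements. -/
theorem stmt_11 (d : ℕ) (hd1 : 1 < d) (hdsf : Squarefree d)
    (K : Type*) [Field K] [NumberField K] (α : K)
    (hα : α ^ 2 = (d : K)) (hdeg : Module.finrank ℚ K = 2)
    (t s : ℕ) (ht : t = (quadDisc d).primeFactors.card)
    (hs : ((∃ a b : ℤ, (d : ℤ) = a ^ 2 + b ^ 2) ∧ s = t - 1) ∨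
      (¬ (∃ a b : ℤ, (d : ℤ) = a ^ 2 + b ^ 2) ∧ s = t - 2)) :
    Nonempty
      ((ClassGroup (𝓞 K) ⧸
          (powMonoidHom 2 : ClassGroup (𝓞 K) →* ClassGroup (𝓞 K)).range) ≃*
        (Fin s → Multiplicative (ZMod 2))) ∧
    Nat.card
      (ClassGroup (𝓞 K) ⧸
        (powMonoidHom 2 : ClassGroup (𝓞 K) →* ClassGroup (𝓞 K)).range) = 2 ^ s := by
  have h4 := RealQuadratic.four_mul_index_squares_classGroup hd1 hdsf hα hdeg
  rw [← ht] at h4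
  have hidx : (RealQuadratic.squares (ClassGroup (𝓞 K))).index = 2 ^ s := by
    rcases hs with ⟨h, rfl⟩ | ⟨h, rfl⟩
    · rw [RealQuadratic.relIndex_norm_squares_eq_two hd1 hdsf hα hdeg h] at h4
      obtain _ | t := t
      · omega
      · rw [pow_succ] at h4
        simp only [Nat.add_sub_cancel]
        omega
    · rw [RealQuadratic.relIndex_norm_squares_eq_one hd1 hdsf hα hdeg h] at h4
      obtain _ | _ | t := t
      · omega
      · omega
      · rw [pow_succ, pow_succ] at h4
        simp only [Nat.reduceSubDiff]
        omega
  have hcard : Nat.card (ClassGroup (𝓞 K) ⧸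
      (powMonoidHom 2 : ClassGroup (𝓞 K) →* ClassGroup (𝓞 K)).range) = 2 ^ s := by
    rw [← hidx, Subgroup.index_eq_card]
  refine ⟨RealQuadratic.nonempty_mulEquiv_of_card_eq_two_pow _ (fun g => ?_) s hcard, hcard⟩
  induction g using QuotientGroup.induction_on with
  | H x =>
    rw [← QuotientGroup.mk_pow, QuotientGroup.eq_one_iff]
    exact ⟨x, rfl⟩
end
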